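/- arXiv:1710.11558 — 9 statements merged into one kernel-verified Lean document; each statement's English description precedes it below -/
import Mathlib

section
/- Let p be a prime and k a field of characteristic p. The commutative algebra k[x,y,z]/⟨x^p − y, y^p, z^p − z⟩ is isomorphic as a k-algebra to the product of p copies of the group algebra kC_{p^2}. -/
open MvPolynomial

section
variable {p : ℕ} {k : Type*} [Field k]

/-- The element `g - 1` of `k C_{p^2}`, for `g` the standard generator of `C_{p^2}`. -/
noncomputable def cyclicGenSubOne (p : ℕ) (k : Type*) [Field k] :
    AddMonoidAlgebra k (ZMod (p ^ 2)) :=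
  AddMonoidAlgebra.single 1 1 - 1

lemma cyclicGenSubOne_add_one_pow (n : ℕ) :
    (cyclicGenSubOne p k + 1) ^ n = AddMonoidAlgebra.single (n : ZMod (p ^ 2)) 1 := by
  simp [cyclicGenSubOne, AddMonoidAlgebra.single_pow]

lemma cyclicGenSubOne_pow (hp : p.Prime) [CharP k p] : (cyclicGenSubOne p k ^ p) ^ p = 0 := by
  have : Fact p.Prime := ⟨hp⟩
  have : CharP (AddMonoidAlgebra k (ZMod (p ^ 2))) p := charP_of_injective_algebraMap
    (algebraMap k (AddMonoidAlgebra k (ZMod (p ^ 2)))).injective p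
  rw [← pow_mul, ← sq, cyclicGenSubOne, sub_pow_char_pow, AddMonoidAlgebra.single_pow]
  simp only [nsmul_one, CharP.cast_eq_zero, one_pow]
  rw [AddMonoidAlgebra.one_def, sub_self]

/-- The evaluation map `k[x, y, z] → (k C_{p^2})^p` sending `x` to `g - 1`, `y` to `(g - 1)^p`
and `z` to `(0, 1, …, p - 1)`. -/
noncomputable def evalCyclic (p : ℕ) (k : Type*) [Field k] :
    MvPolynomial (Fin 3) k →ₐ[k] (Fin p → AddMonoidAlgebra k (ZMod (p ^ 2))) :=
  aeval ![fun _ ↦ cyclicGenSubOne p k, fun _ ↦ cyclicGenSubOne p k ^ p, fun i ↦ ((i : ℕ) : _)]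

lemma natCast_pow_char (hp : p.Prime) (R : Type*) [CommRing R] [CharP R p] (n : ℕ) :
    (n : R) ^ p = n := by
  have : Fact p.Prime := ⟨hp⟩
  exact map_natCast (frobenius R p) n

lemma evalCyclic_eq_zero (hp : p.Prime) [CharP k p] (a : MvPolynomial (Fin 3) k)
    (ha : a ∈ (Ideal.span {X 0 ^ p - X 1, X 1 ^ p, X 2 ^ p - X 2} :
            Ideal (MvPolynomial (Fin 3) k))) : evalCyclic p k a = 0 := by
  have : CharP (AddMonoidAlgebra k (ZMod (p ^ 2))) p := charP_of_injective_algebraMap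
    (algebraMap k (AddMonoidAlgebra k (ZMod (p ^ 2)))).injective p
  suffices h : (Ideal.span {X 0 ^ p - X 1, X 1 ^ p, X 2 ^ p - X 2} :
      Ideal (MvPolynomial (Fin 3) k)) ≤ RingHom.ker (evalCyclic p k) from h ha
  rw [Ideal.span_le]
  rintro _ (rfl | rfl | rfl)
  · simp only [SetLike.mem_coe, RingHom.mem_ker, evalCyclic, map_sub, map_pow, aeval_X]
    ext1 i
    simp
  · simp only [SetLike.mem_coe, RingHom.mem_ker, evalCyclic, map_pow, aeval_X]
    ext1 i
    simpa using cyclicGenSubOne_pow hp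
  · simp only [SetLike.mem_coe, RingHom.mem_ker, evalCyclic, map_sub, map_pow, aeval_X]
    ext1 i
    simpa [sub_eq_zero] using natCast_pow_char hp _ _

lemma const_mem_range_evalCyclic (hp : p.Prime) (f : AddMonoidAlgebra k (ZMod (p ^ 2))) :
    (fun _ ↦ f) ∈ (evalCyclic p k).range := by
  have : NeZero (p ^ 2) := ⟨pow_ne_zero _ hp.ne_zero⟩
  induction f using AddMonoidAlgebra.induction_on with
  | of g =>
    refine ⟨(X 0 + 1) ^ g.val, ?_⟩
    ext1 i
    simp [evalCyclic, cyclicGenSubOne_add_one_pow]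
  | add f g hf hg => exact add_mem hf hg
  | smul r f hf => exact Subalgebra.smul_mem _ hf r

lemma pi_single_mem_range_evalCyclic [CharP k p] (i : Fin p) :
    Pi.single i 1 ∈ (evalCyclic p k).range := by
  set c : k := ∏ j ∈ Finset.univ.erase i, ((i : ℕ) - (j : ℕ) : k) with hc
  have hc0 : c ≠ 0 := by
    refine Finset.prod_ne_zero_iff.2 fun j hj h ↦ (Finset.mem_erase.1 hj).1 ?_
    have := (CharP.natCast_eq_natCast k p).1 (sub_eq_zero.1 h)
    exact (Fin.ext (Nat.ModEq.eq_of_lt_of_lt this i.2 j.2)).symm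
  refine ⟨C c⁻¹ * ∏ j ∈ Finset.univ.erase i, (X 2 - C ((j : ℕ) : k)), ?_⟩
  ext1 m
  have h : evalCyclic p k (C c⁻¹ * ∏ j ∈ Finset.univ.erase i, (X 2 - C ((j : ℕ) : k))) m =
      algebraMap k _ (c⁻¹ * ∏ j ∈ Finset.univ.erase i, ((m : ℕ) - (j : ℕ) : k)) := by
    simp [evalCyclic, map_prod, Finset.prod_apply, -AddMonoidAlgebra.coe_algebraMap, algHom_C]
  refine h.trans ?_
  by_cases hm : m = i
  · subst hm
    rw [← hc, inv_mul_cancel₀ hc0, map_one, Pi.single_eq_same]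
  · rw [Finset.prod_eq_zero (Finset.mem_erase.2 ⟨hm, Finset.mem_univ m⟩) (sub_self _)]
    simp [hm]

lemma evalCyclic_surjective (hp : p.Prime) [CharP k p] :
    Function.Surjective (evalCyclic p k) := by
  intro f
  have : f = ∑ i, Pi.single i 1 * fun _ ↦ f i := by
    ext1 m
    simp [Finset.sum_apply, Pi.single_apply]
  change f ∈ (evalCyclic p k).range
  rw [this]
  exact sum_mem fun i _ ↦
    mul_mem (pi_single_mem_range_evalCyclic i) (const_mem_range_evalCyclic hp _)

open scoped TensorProduct in
/-- The quotient `k[x, y, z] / (x^p - y, y^p, z^p - z)` has dimension at most `p^3`. -/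
lemma finrank_quotient_le (hp : p.Prime) :
    Module.Finite k (MvPolynomial (Fin 3) k ⧸
      (Ideal.span {X 0 ^ p - X 1, X 1 ^ p, X 2 ^ p - X 2} : Ideal (MvPolynomial (Fin 3) k))) ∧
    Module.finrank k (MvPolynomial (Fin 3) k ⧸
      (Ideal.span {X 0 ^ p - X 1, X 1 ^ p, X 2 ^ p - X 2} : Ideal (MvPolynomial (Fin 3) k)))
      ≤ p ^ 2 * p := by
  set I : Ideal (MvPolynomial (Fin 3) k) :=
    Ideal.span {X 0 ^ p - X 1, X 1 ^ p, X 2 ^ p - X 2} with hI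
  have h0 : Ideal.Quotient.mkₐ k I (X 0) ^ p = Ideal.Quotient.mkₐ k I (X 1) := by
    rw [← map_pow, ← sub_eq_zero, ← map_sub]
    exact Ideal.Quotient.eq_zero_iff_mem.2 (Ideal.subset_span (by simp))
  have h1 : Ideal.Quotient.mkₐ k I (X 1) ^ p = 0 := by
    rw [← map_pow]
    exact Ideal.Quotient.eq_zero_iff_mem.2 (Ideal.subset_span (by simp))
  have h2 : Ideal.Quotient.mkₐ k I (X 2) ^ p = Ideal.Quotient.mkₐ k I (X 2) := by
    rw [← map_pow, ← sub_eq_zero, ← map_sub]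
    exact Ideal.Quotient.eq_zero_iff_mem.2 (Ideal.subset_span (by simp))
  have hf : (Polynomial.X ^ p ^ 2 : Polynomial k).Monic := Polynomial.monic_X_pow _
  have hdeg : (Polynomial.X : Polynomial k).degree < p := by
    rw [Polynomial.degree_X]
    exact_mod_cast hp.one_lt
  have hg : (Polynomial.X ^ p - Polynomial.X : Polynomial k).Monic :=
    Polynomial.monic_X_pow_sub hdeg
  have hgd : (Polynomial.X ^ p - Polynomial.X : Polynomial k).natDegree = p :=
    FiniteField.X_pow_card_sub_X_natDegree_eq k hp.one_lt
  have := hf.finite_adjoinRoot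
  have := hg.finite_adjoinRoot
  let u : AdjoinRoot (Polynomial.X ^ p ^ 2 : Polynomial k) →ₐ[k] MvPolynomial (Fin 3) k ⧸ I :=
    AdjoinRoot.liftAlgHom _ (Algebra.ofId k _) (Ideal.Quotient.mkₐ k I (X 0))
      (by rw [Polynomial.eval₂_pow, Polynomial.eval₂_X, sq, pow_mul, h0, h1])
  let v : AdjoinRoot (Polynomial.X ^ p - Polynomial.X : Polynomial k) →ₐ[k]
      MvPolynomial (Fin 3) k ⧸ I :=
    AdjoinRoot.liftAlgHom _ (Algebra.ofId k _) (Ideal.Quotient.mkₐ k I (X 2))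
      (by rw [Polynomial.eval₂_sub, Polynomial.eval₂_pow, Polynomial.eval₂_X, h2, sub_self])
  let w := Algebra.TensorProduct.productMap u v
  have hx : Ideal.Quotient.mkₐ k I (X 0) ∈ w.range :=
    ⟨AdjoinRoot.root _ ⊗ₜ 1, by simp [w, u]⟩
  have hz : Ideal.Quotient.mkₐ k I (X 2) ∈ w.range :=
    ⟨1 ⊗ₜ AdjoinRoot.root _, by simp [w, v]⟩
  have hw : Function.Surjective w := by
    intro a
    obtain ⟨a, rfl⟩ := Ideal.Quotient.mkₐ_surjective k I a
    change _ ∈ w.range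
    induction a using MvPolynomial.induction_on with
    | C r => exact (algHom_C (Ideal.Quotient.mkₐ k I) r) ▸ Subalgebra.algebraMap_mem _ r
    | add a b ha hb => rw [map_add]; exact add_mem ha hb
    | mul_X a i ha =>
      rw [map_mul]
      refine mul_mem ha ?_
      fin_cases i
      · exact hx
      · exact h0 ▸ pow_mem hx p
      · exact hz
  refine ⟨Module.Finite.of_surjective w.toLinearMap hw, ?_⟩
  refine (LinearMap.finrank_le_finrank_of_surjective (f := w.toLinearMap) hw).trans ?_
  rw [Module.finrank_tensorProduct, (AdjoinRoot.powerBasis' hf).finrank,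
    (AdjoinRoot.powerBasis' hg).finrank]
  simp [hgd]

end

/-- The algebra of type C8: `k[x,y,z]/⟨x^p − y, y^p, z^p − z⟩` is isomorphic as a
`k`-algebra to the product of `p` copies of the group algebra `k C_{p^2}`. -/
theorem stmt5 (p : ℕ) (hp : p.Prime) (k : Type*) [Field k] [CharP k p] :
    Nonempty
      ((MvPolynomial (Fin 3) k ⧸
          (Ideal.span {X 0 ^ p - X 1, X 1 ^ p, X 2 ^ p - X 2} :
            Ideal (MvPolynomial (Fin 3) k))) ≃ₐ[k]
        (Fin p → AddMonoidAlgebra k (ZMod (p ^ 2)))) := by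
  have : NeZero (p ^ 2) := ⟨pow_ne_zero _ hp.ne_zero⟩
  obtain ⟨_, hle⟩ := finrank_quotient_le (k := k) hp
  let φ := Ideal.Quotient.liftₐ _ (evalCyclic p k) (evalCyclic_eq_zero hp)
  have hφ : Function.Surjective φ :=
    Ideal.Quotient.lift_surjective_of_surjective _ _ (evalCyclic_surjective hp)
  have hfin : Module.Finite k (AddMonoidAlgebra k (ZMod (p ^ 2))) :=
    Module.Finite.of_basis (AddMonoidAlgebra.basis (ZMod (p ^ 2)) k)
  have hG : Module.finrank k (AddMonoidAlgebra k (ZMod (p ^ 2))) = p ^ 2 := by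
    rw [Module.finrank_eq_card_basis (AddMonoidAlgebra.basis (ZMod (p ^ 2)) k), ZMod.card]
  have hT : Module.finrank k (Fin p → AddMonoidAlgebra k (ZMod (p ^ 2))) = p ^ 2 * p := by
    rw [Module.finrank_pi_fintype]
    simp [hG, mul_comm]
  have hge := LinearMap.finrank_le_finrank_of_surjective (f := φ.toLinearMap) hφ
  have heq := le_antisymm (hle.trans_eq hT.symm) hge
  exact ⟨AlgEquiv.ofBijective φ
    ⟨(LinearMap.injective_iff_surjective_of_finrank_eq_finrank heq (f := φ.toLinearMap)).2 hφ, hφ⟩⟩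
end

section
/- Let p be a prime and k a field of characteristic p. The algebra Λ = k⟨x,y,z⟩/⟨[x,y] − z, [x,z], [y,z], x^p, y^p, z^p − z⟩ is isomorphic as a k-algebra to the product of the group algebra k(C_p × C_p) with p − 1 copies of the matrix algebra M_p(k). -/
noncomputable section

/-- The ring commutator `[a,b] = ab - ba`. -/
def commutator' {A : Type*} [Ring A] (a b : A) : A := a * b - b * a

/-- The relation on an algebra `A` identifying each element of `S` with `0`;
`RingQuot` of this relation is the quotient of `A` by the two-sided ideal
generated by `S`. -/
def relOf {A : Type*} [Ring A] (S : Set A) : A → A → Prop := fun a b => a ∈ S ∧ b = 0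

/-- The lowering operator: `e_j ↦ j • e_{j-1}`. -/
def lowering (k : Type*) [Field k] (n : ℕ) : Matrix (Fin n) (Fin n) k :=
  Matrix.of fun i j => if (j : ℕ) = i + 1 then (j : k) else 0

/-- The raising operator: `e_j ↦ e_{j+1}`, with the last basis vector sent to `0`. -/
def raising (k : Type*) [Field k] (n : ℕ) : Matrix (Fin n) (Fin n) k :=
  Matrix.of fun i j => if (i : ℕ) = j + 1 then 1 else 0

section Matrices

variable {k : Type*} [Field k] {n : ℕ}

theorem lowering_mul_apply (M : Matrix (Fin n) (Fin n) k) (i j : Fin n) :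
    (lowering k n * M) i j =
      if h : (i : ℕ) + 1 < n then ((i + 1 : ℕ) : k) * M ⟨i + 1, h⟩ j else 0 := by
  rw [Matrix.mul_apply]
  split_ifs with h
  · rw [Finset.sum_eq_single ⟨i + 1, h⟩]
    · simp [lowering]
    · intro b _ hb
      have : (b : ℕ) ≠ i + 1 := fun e => hb (Fin.ext e)
      simp [lowering, this]
    · simp
  · refine Finset.sum_eq_zero fun b _ => ?_
    have : (b : ℕ) ≠ i + 1 := by have := b.2; omega
    simp [lowering, this]

theorem mul_raising_apply (M : Matrix (Fin n) (Fin n) k) (i j : Fin n) :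
    (M * raising k n) i j = if h : (j : ℕ) + 1 < n then M i ⟨j + 1, h⟩ else 0 := by
  rw [Matrix.mul_apply]
  split_ifs with h
  · rw [Finset.sum_eq_single ⟨j + 1, h⟩]
    · simp [raising]
    · intro b _ hb
      have : (b : ℕ) ≠ j + 1 := fun e => hb (Fin.ext e)
      simp [raising, this]
    · simp
  · refine Finset.sum_eq_zero fun b _ => ?_
    have : (b : ℕ) ≠ j + 1 := by have := b.2; omega
    simp [raising, this]

theorem lowering_pow_apply (m : ℕ) (i j : Fin n) :
    (lowering k n ^ m) i j = if (j : ℕ) = i + m then (((j : ℕ).descFactorial m : ℕ) : k) else 0 := by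
  induction m generalizing i j with
  | zero => simp [Matrix.one_apply, Fin.ext_iff, eq_comm]
  | succ m ih =>
    rw [pow_succ', lowering_mul_apply]
    simp only [ih]
    by_cases h : (j : ℕ) = i + (m + 1)
    · have h1 : (i : ℕ) + 1 < n := by have := j.2; omega
      have h2 : (j : ℕ) = i + 1 + m := by omega
      rw [dif_pos h1, if_pos h2, if_pos h, Nat.descFactorial_succ, Nat.cast_mul,
        show (j : ℕ) - m = i + 1 by omega]
    · have h2 : (j : ℕ) ≠ i + 1 + m := by omega
      simp [h, h2]

theorem raising_pow_apply (m : ℕ) (i j : Fin n) :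
    (raising k n ^ m) i j = if (i : ℕ) = j + m then 1 else 0 := by
  induction m generalizing i j with
  | zero => simp [Matrix.one_apply, Fin.ext_iff]
  | succ m ih =>
    rw [pow_succ, mul_raising_apply]
    simp only [ih]
    by_cases h : (i : ℕ) = j + (m + 1)
    · have h1 : (j : ℕ) + 1 < n := by have := i.2; omega
      have h2 : (i : ℕ) = j + 1 + m := by omega
      rw [dif_pos h1, if_pos h2, if_pos h]
    · have h2 : (i : ℕ) ≠ j + 1 + m := by omega
      simp [h, h2]

theorem lowering_pow_self : lowering k n ^ n = 0 := by
  ext i j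
  have : (j : ℕ) ≠ i + n := by have := j.2; omega
  simp [lowering_pow_apply, this]

theorem raising_pow_self : raising k n ^ n = 0 := by
  ext i j
  have : (i : ℕ) ≠ j + n := by have := i.2; omega
  simp [raising_pow_apply, this]

theorem lowering_mul_raising_sub (hn : (n : k) = 0) :
    lowering k n * raising k n - raising k n * lowering k n = 1 := by
  ext i j
  rw [Matrix.sub_apply, lowering_mul_apply, Matrix.one_apply]
  have h2 : (raising k n * lowering k n) i j = if i = j then ((i : ℕ) : k) else 0 := by
    rw [Matrix.mul_apply]
    rcases Nat.eq_zero_or_pos (i : ℕ) with h0 | h0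
    · rw [Finset.sum_eq_zero]
      · simp [h0]
      · intro b _
        simp [raising, h0]
    · rw [Finset.sum_eq_single ⟨i - 1, by have := i.2; omega⟩]
      · by_cases hij : i = j
        · subst hij
          have : (i : ℕ) = i - 1 + 1 := by omega
          simp [raising, lowering, ← this]
        · have h1 : (i : ℕ) = i - 1 + 1 := by omega
          have h3 : (j : ℕ) ≠ i := fun e => hij (Fin.ext e.symm)
          simp [raising, lowering, ← h1, hij, h3]
      · intro b _ hb
        have : (i : ℕ) ≠ b + 1 := fun e => hb (Fin.ext (by simp; omega))
        simp [raising, this]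
      · simp
  rw [h2]
  by_cases hij : i = j
  · subst hij
    by_cases h : (i : ℕ) + 1 < n
    · simp [raising, h]
    · have hin : (i : ℕ) + 1 = n := by have := i.2; omega
      have : ((i : ℕ) : k) + 1 = 0 := by exact_mod_cast (congrArg (Nat.cast (R := k)) hin).trans hn
      simp only [h, dite_false, if_true]
      linear_combination -this
  · have h3 : (i : ℕ) ≠ j := fun e => hij (Fin.ext e)
    simp [raising, hij, h3]

theorem single_eq_raising_lowering (i j : Fin n) :
    Matrix.single i j (((n - 1).factorial : ℕ) : k) =
      raising k n ^ (i : ℕ) * lowering k n ^ (n - 1) * raising k n ^ (n - 1 - j) := by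
  have hn : 0 < n := i.pos
  have h1 : lowering k n ^ (n - 1) =
      Matrix.single ⟨0, hn⟩ ⟨n - 1, by omega⟩ (((n - 1).factorial : ℕ) : k) := by
    ext a b
    rw [lowering_pow_apply, Matrix.single_apply]
    by_cases h : (b : ℕ) = a + (n - 1)
    · have ha : (⟨0, hn⟩ : Fin n) = a := Fin.ext (by have := b.2; simp; omega)
      have hb : (⟨n - 1, by omega⟩ : Fin n) = b := Fin.ext (by have := b.2; simp; omega)
      rw [if_pos h, if_pos ⟨ha, hb⟩, ← hb, Nat.descFactorial_self]
    · rw [if_neg h, if_neg]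
      rintro ⟨rfl, rfl⟩
      simp at h
  rw [h1]
  ext a b
  rw [Matrix.mul_apply, Finset.sum_eq_single ⟨n - 1, by omega⟩]
  · rw [Matrix.mul_single_apply_same, raising_pow_apply, raising_pow_apply, Matrix.single_apply]
    have e1 : (a : ℕ) = 0 + i ↔ i = a := by rw [Fin.ext_iff]; omega
    have e2 : n - 1 = (b : ℕ) + (n - 1 - j) ↔ j = b := by
      rw [Fin.ext_iff]; have := j.2; omega
    simp only [e1, e2]
    by_cases hia : i = a <;> by_cases hjb : j = b <;> simp [hia, hjb]
  · intro c _ hc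
    rw [Matrix.mul_single_apply_of_ne (hbj := hc), zero_mul]
  · simp

theorem adjoin_lowering_raising (hn : (((n - 1).factorial : ℕ) : k) ≠ 0) {c : k} (hc : c ≠ 0) :
    Algebra.adjoin k {c • lowering k n, raising k n} = ⊤ := by
  set S := Algebra.adjoin k {c • lowering k n, raising k n} with hS
  have hR : raising k n ∈ S := Algebra.subset_adjoin (by simp)
  have hL : lowering k n ∈ S := by
    have : c • lowering k n ∈ S := Algebra.subset_adjoin (by simp)
    simpa [smul_smul, hc] using S.smul_mem this c⁻¹
  refine top_unique fun M _ => ?_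
  rw [Matrix.matrix_eq_sum_single M]
  refine sum_mem fun i _ => sum_mem fun j _ => ?_
  have h := S.smul_mem (S.mul_mem (S.mul_mem (S.pow_mem hR i) (S.pow_mem hL (n - 1)))
    (S.pow_mem hR (n - 1 - j))) (M i j * ((((n - 1).factorial : ℕ) : k))⁻¹)
  rw [← single_eq_raising_lowering, Matrix.smul_single, smul_eq_mul, mul_assoc,
    inv_mul_cancel₀ hn, mul_one] at h
  exact h

end Matrices

section GroupAlgebra

variable {k : Type*} [Field k] {p : ℕ}

theorem single_sub_one_pow_char [Fact p.Prime] [CharP k p] (g : ZMod p × ZMod p) :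
    (AddMonoidAlgebra.single g (1 : k) - 1) ^ p = 0 := by
  have : CharP (AddMonoidAlgebra k (ZMod p × ZMod p)) p :=
    charP_of_injective_algebraMap' k p
  have hg : p • g = 0 := by ext <;> simp
  rw [sub_pow_char, AddMonoidAlgebra.single_pow, hg, one_pow, one_pow,
    AddMonoidAlgebra.one_def, sub_self]

theorem adjoin_single_sub_one [Fact p.Prime] :
    Algebra.adjoin k {AddMonoidAlgebra.single ((1, 0) : ZMod p × ZMod p) (1 : k) - 1,
      AddMonoidAlgebra.single ((0, 1) : ZMod p × ZMod p) (1 : k) - 1} = ⊤ := by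
  set S := Algebra.adjoin k {AddMonoidAlgebra.single ((1, 0) : ZMod p × ZMod p) (1 : k) - 1,
      AddMonoidAlgebra.single ((0, 1) : ZMod p × ZMod p) (1 : k) - 1}
  have h1 : AddMonoidAlgebra.single ((1, 0) : ZMod p × ZMod p) (1 : k) ∈ S := by
    have : AddMonoidAlgebra.single ((1, 0) : ZMod p × ZMod p) (1 : k) - 1 ∈ S :=
      Algebra.subset_adjoin (by simp)
    simpa using add_mem this S.one_mem
  have h2 : AddMonoidAlgebra.single ((0, 1) : ZMod p × ZMod p) (1 : k) ∈ S := by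
    have : AddMonoidAlgebra.single ((0, 1) : ZMod p × ZMod p) (1 : k) - 1 ∈ S :=
      Algebra.subset_adjoin (by simp)
    simpa using add_mem this S.one_mem
  refine top_unique fun f _ => ?_
  induction f using AddMonoidAlgebra.induction_on with
  | of m =>
    have h := S.mul_mem (S.pow_mem h1 m.1.val) (S.pow_mem h2 m.2.val)
    have hm : m.1.val • ((1, 0) : ZMod p × ZMod p) + m.2.val • ((0, 1) : ZMod p × ZMod p) = m := by
      ext <;> simp
    rw [AddMonoidAlgebra.single_pow, AddMonoidAlgebra.single_pow,
      AddMonoidAlgebra.single_mul_single, hm] at h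
    simpa using h
  | add x y hx hy => exact add_mem (hx trivial) (hy trivial)
  | smul r x hx => exact S.smul_mem (hx trivial) r

end GroupAlgebra

section Spanning

variable {k A : Type*} [Field k] [Ring A] [Algebra k A] {p : ℕ} {x y z : A}

theorem mul_pow_of_commutator_central (hxy : x * y - y * x = z) (hyz : y * z = z * y) (j : ℕ) :
    x * y ^ j = y ^ j * x + (j : k) • (y ^ (j - 1) * z) := by
  induction j with
  | zero => simp
  | succ j ih =>
    have hxy' : x * y = y * x + z := by rw [← hxy]; abel
    rw [pow_succ, ← mul_assoc, ih, add_mul, mul_assoc, hxy', smul_mul_assoc, mul_assoc, ← hyz]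
    rcases j with - | j
    · simp
    · simp only [Nat.add_sub_cancel, Nat.cast_succ, add_smul, one_smul, mul_add, pow_succ, mul_assoc]
      abel

/-- The ordered monomials with exponents less than `p` span. -/
theorem span_monomials_eq_top (hp : 1 < p) (hxy : x * y - y * x = z)
    (hxz : x * z = z * x) (hyz : y * z = z * y) (hx : x ^ p = 0) (hy : y ^ p = 0)
    (hz : z ^ p = z) (hgen : Algebra.adjoin k {x, y, z} = ⊤) :
    Submodule.span k (Set.range fun t : Fin p × Fin p × Fin p =>
      y ^ (t.1 : ℕ) * x ^ (t.2.1 : ℕ) * z ^ (t.2.2 : ℕ)) = ⊤ := by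
  set S := Submodule.span k (Set.range fun t : Fin p × Fin p × Fin p =>
      y ^ (t.1 : ℕ) * x ^ (t.2.1 : ℕ) * z ^ (t.2.2 : ℕ)) with hS
  have hmon : ∀ j i l : ℕ, y ^ j * x ^ i * z ^ l ∈ S := by
    intro j i l
    by_cases hj : p ≤ j
    · simp [pow_eq_zero_of_le hj hy]
    by_cases hi : p ≤ i
    · simp [pow_eq_zero_of_le hi hx]
    induction l using Nat.strong_induction_on with
    | _ l ih =>
      by_cases hl : p ≤ l
      · have : z ^ l = z ^ (l - p + 1) := by
          conv_lhs => rw [show l = l - p + p by omega, pow_add, hz]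
          rw [pow_succ]
        rw [this]
        exact ih _ (by omega)
      · exact Submodule.subset_span
          ⟨(⟨j, by omega⟩, ⟨i, by omega⟩, ⟨l, by omega⟩), rfl⟩
  have hmul : ∀ a : A, (∀ j i l : ℕ, a * (y ^ j * x ^ i * z ^ l) ∈ S) → ∀ s ∈ S, a * s ∈ S := by
    intro a ha s hs
    induction hs using Submodule.span_induction with
    | mem s hs =>
      obtain ⟨t, rfl⟩ := hs
      exact ha _ _ _
    | zero => simp
    | add s t _ _ hs ht => rw [mul_add]; exact add_mem hs ht
    | smul c s _ hs => rw [mul_smul_comm]; exact S.smul_mem c hs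
  have hleft : ∀ a ∈ Algebra.adjoin k {x, y, z}, ∀ s ∈ S, a * s ∈ S := by
    intro a ha
    induction ha using Algebra.adjoin_induction with
    | mem a ha =>
      refine hmul a fun j i l => ?_
      have hzx : ∀ i, z * x ^ i = x ^ i * z := fun i =>
        (Commute.pow_right (show Commute z x from hxz.symm) i)
      have hzy : ∀ j, z * y ^ j = y ^ j * z := fun j =>
        (Commute.pow_right (show Commute z y from hyz.symm) j)
      rcases ha with rfl | rfl | rfl
      · have : a * (y ^ j * a ^ i * z ^ l) =
            y ^ j * a ^ (i + 1) * z ^ l + (j : k) • (y ^ (j - 1) * a ^ i * z ^ (l + 1)) := by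
          rw [← mul_assoc, ← mul_assoc, mul_pow_of_commutator_central (k := k) hxy hyz, add_mul,
            add_mul, pow_succ', pow_succ', smul_mul_assoc, smul_mul_assoc]
          simp only [mul_assoc]
          rw [← mul_assoc z, hzx, mul_assoc]
        rw [this]
        exact add_mem (hmon _ _ _) (S.smul_mem _ (hmon _ _ _))
      · rw [← mul_assoc, ← mul_assoc, ← pow_succ']
        exact hmon _ _ _
      · have : a * (y ^ j * x ^ i * a ^ l) = y ^ j * x ^ i * a ^ (l + 1) := by
          rw [← mul_assoc, ← mul_assoc, hzy, mul_assoc (y ^ j), hzx, pow_succ']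
          simp only [mul_assoc]
        rw [this]
        exact hmon _ _ _
    | algebraMap r =>
      intro s hs
      rw [← Algebra.smul_def]
      exact S.smul_mem r hs
    | add a b _ _ ha hb => intro s hs; rw [add_mul]; exact add_mem (ha s hs) (hb s hs)
    | mul a b _ _ ha hb => intro s hs; rw [mul_assoc]; exact ha _ (hb s hs)
  refine top_unique fun a _ => ?_
  have h1 : (1 : A) ∈ S := by simpa using hmon 0 0 0
  simpa using hleft a (by rw [hgen]; trivial) 1 h1

end Spanning

theorem bijective_of_surjective_of_span {k V W ι : Type*} [Field k] [AddCommGroup V] [Module k V]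
    [AddCommGroup W] [Module k W] [Module.Finite k W] [Fintype ι] {v : ι → V}
    (hv : Submodule.span k (Set.range v) = ⊤) (hW : Module.finrank k W = Fintype.card ι)
    (f : V →ₗ[k] W) (hf : Function.Surjective f) : Function.Bijective f := by
  refine ⟨?_, hf⟩
  have hg := (span_range_eq_top_iff_surjective_fintypeLinearCombination k v).1 hv
  have hinj : Function.Injective (f ∘ₗ Fintype.linearCombination k v) :=
    (LinearMap.injective_iff_surjective_of_finrank_eq_finrank (by simp [hW])).2 (hf.comp hg)
  exact Function.Injective.of_comp_right (f := f) hinj hg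

theorem sub_pow_char_sub_one {k : Type*} [Field k] [DecidableEq k] {p : ℕ} [Fact p.Prime] [CharP k p] {c d : k}
    (hc : c ^ p = c) (hd : d ^ p = d) : (c - d) ^ (p - 1) = if c = d then 0 else 1 := by
  have hp : p.Prime := Fact.out
  split_ifs with h
  · have := hp.one_lt
    rw [h, sub_self, zero_pow (by omega)]
  · have h0 : c - d ≠ 0 := sub_ne_zero.2 h
    refine mul_right_cancel₀ h0 ?_
    rw [← pow_succ, Nat.sub_add_cancel hp.one_le, sub_pow_char, hc, hd, one_mul]

/-- An algebra map to `B × Mⁿ` is surjective as soon as each component is and some element maps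
to pairwise distinct scalars of the prime field in the components. -/
theorem surjective_of_separating {k A B M ι : Type*} [Field k] {p : ℕ} [Fact p.Prime] [CharP k p]
    [Ring A] [Algebra k A] [Ring B] [Algebra k B] [Ring M] [Algebra k M] [Fintype ι]
    (f : A →ₐ[k] B × (ι → M)) (z : A) (c : ι → k) (hc : ∀ i, c i ^ p = c i)
    (hc0 : ∀ i, c i ≠ 0) (hinj : Function.Injective c)
    (hz : f z = (0, fun i => algebraMap k M (c i)))
    (h1 : Function.Surjective fun a => (f a).1)
    (h2 : ∀ i, Function.Surjective fun a => (f a).2 i) : Function.Surjective f := by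
  classical
  have hp : p.Prime := Fact.out
  have h0 : (0 : k) ^ p = 0 := zero_pow hp.ne_zero
  have key : ∀ d : k, d ^ p = d → f (1 - (z - algebraMap k A d) ^ (p - 1)) =
      (if d = 0 then 1 else 0, fun i => if c i = d then 1 else 0) := by
    intro d hd
    rw [map_sub, map_one, map_pow, map_sub, hz, AlgHom.commutes]
    refine Prod.ext ?_ (funext fun i => ?_)
    · simp only [Prod.fst_sub, Prod.fst_one, Prod.pow_fst, Prod.algebraMap_apply]
      rw [← map_zero (algebraMap k B), ← map_sub, ← map_pow, sub_pow_char_sub_one h0 hd]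
      by_cases h : d = 0
      · simp [h]
      · simp [h, Ne.symm h]
    · simp only [Prod.snd_sub, Prod.snd_one, Prod.pow_snd, Prod.algebraMap_apply, Pi.sub_apply,
        Pi.one_apply, Pi.pow_apply, Pi.algebraMap_apply]
      rw [← map_sub, ← map_pow, sub_pow_char_sub_one (hc i) hd]
      split_ifs <;> simp
  rintro ⟨b, m⟩
  obtain ⟨a, ha⟩ := h1 b
  choose u h_comp using fun i => h2 i (m i)
  refine ⟨(1 - (z - algebraMap k A 0) ^ (p - 1)) * a +
    ∑ i, (1 - (z - algebraMap k A (c i)) ^ (p - 1)) * u i, ?_⟩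
  rw [map_add, map_mul, map_sum, key 0 h0]
  simp only [map_mul, key _ (hc _), hc0, hinj.eq_iff]
  refine Prod.ext ?_ (funext fun j => ?_)
  · simpa [Prod.fst_sum] using ha
  · simpa [Prod.snd_sum, hc0] using h_comp j

/-- The algebra of type C10:
`k⟨x,y,z⟩/⟨[x,y] − z, [x,z], [y,z], x^p, y^p, z^p − z⟩` is isomorphic as a
`k`-algebra to the product of the group algebra `k(C_p × C_p)` with `p − 1`
copies of the matrix algebra `M_p(k)`. -/
theorem stmt7 (p : ℕ) (hp : p.Prime) (k : Type*) [Field k] [CharP k p] :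
    Nonempty
      (RingQuot (relOf
          (({commutator' (FreeAlgebra.ι k (0 : Fin 3)) (FreeAlgebra.ι k 1) - FreeAlgebra.ι k 2,
             commutator' (FreeAlgebra.ι k (0 : Fin 3)) (FreeAlgebra.ι k 2),
             commutator' (FreeAlgebra.ι k (1 : Fin 3)) (FreeAlgebra.ι k 2),
             FreeAlgebra.ι k (0 : Fin 3) ^ p,
             FreeAlgebra.ι k (1 : Fin 3) ^ p,
             FreeAlgebra.ι k (2 : Fin 3) ^ p - FreeAlgebra.ι k 2} :
            Set (FreeAlgebra k (Fin 3))))) ≃ₐ[k]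
        (AddMonoidAlgebra k (ZMod p × ZMod p) ×
          (Fin (p - 1) → Matrix (Fin p) (Fin p) k))) := by
  have : Fact p.Prime := ⟨hp⟩
  have hpk : (p : k) = 0 := CharP.cast_eq_zero k p
  have hfac : (((p - 1).factorial : ℕ) : k) ≠ 0 := by
    rw [Ne, CharP.cast_eq_zero_iff k p, hp.dvd_factorial]
    have := hp.one_lt
    omega
  set c : Fin (p - 1) → k := fun i => ((i + 1 : ℕ) : k) with hcdef
  have hc : ∀ i, c i ^ p = c i := fun i => by
    simpa [frobenius_def, hcdef] using map_natCast (frobenius k p) ((i : ℕ) + 1)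
  have hinj' : ∀ a b : ℕ, a < p → b < p → (a : k) = b → a = b := fun a b ha hb h =>
    CharP.natCast_injOn_Iio k p ha hb h
  have hc0 : ∀ i, c i ≠ 0 := fun i h => by
    have := hinj' (i + 1) 0 (by have := i.2; omega) hp.pos (by simpa [hcdef] using h)
    omega
  have hinj : Function.Injective c := fun i j h => by
    have := hinj' (i + 1) (j + 1) (by have := i.2; omega) (by have := j.2; omega) h
    exact Fin.ext (by omega)
  set S : Set (FreeAlgebra k (Fin 3)) := _
  change Nonempty (RingQuot (relOf S) ≃ₐ[k] _)
  set X : AddMonoidAlgebra k (ZMod p × ZMod p) × (Fin (p - 1) → Matrix (Fin p) (Fin p) k) :=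
    (AddMonoidAlgebra.single (1, 0) 1 - 1, fun i => c i • lowering k p) with hX
  set Y : AddMonoidAlgebra k (ZMod p × ZMod p) × (Fin (p - 1) → Matrix (Fin p) (Fin p) k) :=
    (AddMonoidAlgebra.single (0, 1) 1 - 1, fun _ => raising k p) with hY
  set Z : AddMonoidAlgebra k (ZMod p × ZMod p) × (Fin (p - 1) → Matrix (Fin p) (Fin p) k) :=
    (0, fun i => algebraMap k _ (c i)) with hZ
  set F := FreeAlgebra.lift k ![X, Y, Z] with hF
  have hXY : X * Y - Y * X = Z := by
    refine Prod.ext ?_ (funext fun i => ?_)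
    · simp [hX, hY, hZ, mul_comm]
    · simp [hX, hY, hZ, ← smul_sub, lowering_mul_raising_sub hpk, Algebra.algebraMap_eq_smul_one]
  have hXZ : X * Z - Z * X = 0 := by
    rw [sub_eq_zero]
    refine Prod.ext (by simp [hX, hZ]) (funext fun i => ?_)
    exact (Algebra.commutes _ _).symm
  have hYZ : Y * Z - Z * Y = 0 := by
    rw [sub_eq_zero]
    refine Prod.ext (by simp [hY, hZ]) (funext fun i => ?_)
    exact (Algebra.commutes _ _).symm
  have hXp : X ^ p = 0 := by
    refine Prod.ext (single_sub_one_pow_char _) (funext fun i => ?_)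
    simp [hX, smul_pow, lowering_pow_self]
  have hYp : Y ^ p = 0 :=
    Prod.ext (single_sub_one_pow_char _) (funext fun i => raising_pow_self)
  have hZp : Z ^ p - Z = 0 := by
    rw [sub_eq_zero]
    refine Prod.ext (zero_pow hp.ne_zero) (funext fun i => ?_)
    simp only [hZ, Prod.pow_snd, Pi.pow_apply]
    rw [← map_pow, hc]
  have hFS : ∀ ⦃a b⦄, relOf S a b → F a = F b := by
    rintro a b ⟨ha, rfl⟩
    rw [map_zero]
    rcases ha with rfl | rfl | rfl | rfl | rfl | rfl
    · simp [hF, commutator', hXY]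
    · simpa [hF, commutator'] using hXZ
    · simpa [hF, commutator'] using hYZ
    · simpa [hF] using hXp
    · simpa [hF] using hYp
    · simpa [hF] using hZp
  set φ := RingQuot.liftAlgHom k ⟨F, hFS⟩ with hφ
  set q := RingQuot.mkAlgHom k (relOf S) with hq
  have hφq : ∀ a, φ (q a) = F a := fun a => RingQuot.liftAlgHom_mkAlgHom_apply k F hFS a
  set x := q (FreeAlgebra.ι k 0) with hx
  set y := q (FreeAlgebra.ι k 1) with hy
  set z := q (FreeAlgebra.ι k 2) with hz
  have hφx : φ x = X := by simp [hx, hφq, hF]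
  have hφy : φ y = Y := by simp [hy, hφq, hF]
  have hφz : φ z = Z := by simp [hz, hφq, hF]
  have hqS : ∀ a ∈ S, q a = 0 := fun a ha => by
    rw [← map_zero q]
    exact RingQuot.mkAlgHom_rel k ⟨ha, rfl⟩
  have hgen : Algebra.adjoin k {x, y, z} = ⊤ := by
    have h := congrArg (Subalgebra.map q) (FreeAlgebra.adjoin_range_ι (R := k) (X := Fin 3))
    rw [AlgHom.map_adjoin, Algebra.map_top,
      (AlgHom.range_eq_top q).2 (RingQuot.mkAlgHom_surjective k _), ← Set.range_comp] at h
    refine top_unique (h.ge.trans (Algebra.adjoin_mono ?_))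
    rintro _ ⟨i, rfl⟩
    fin_cases i <;> simp [hx, hy, hz]
  have hspan := span_monomials_eq_top hp.one_lt (x := x) (y := y) (z := z) (k := k)
    (by
      have := hqS (commutator' (FreeAlgebra.ι k 0) (FreeAlgebra.ι k 1) - FreeAlgebra.ι k 2)
        (by simp [S])
      simpa [commutator', sub_eq_zero] using this)
    (by
      have := hqS (commutator' (FreeAlgebra.ι k 0) (FreeAlgebra.ι k 2)) (by simp [S])
      simpa [commutator', sub_eq_zero] using this)
    (by
      have := hqS (commutator' (FreeAlgebra.ι k 1) (FreeAlgebra.ι k 2)) (by simp [S])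
      simpa [commutator', sub_eq_zero] using this)
    (by simpa using hqS (FreeAlgebra.ι k 0 ^ p) (by simp [S]))
    (by simpa using hqS (FreeAlgebra.ι k 1 ^ p) (by simp [S]))
    (by
      have := hqS (FreeAlgebra.ι k 2 ^ p - FreeAlgebra.ι k 2) (by simp [S])
      simpa [sub_eq_zero] using this)
    hgen
  have hsurj : Function.Surjective φ := by
    refine surjective_of_separating (p := p) φ z c hc hc0 hinj hφz ?_ fun i => ?_
    · change Function.Surjective ((AlgHom.fst k _ _).comp φ)
      rw [← AlgHom.range_eq_top, ← top_le_iff, ← adjoin_single_sub_one, Algebra.adjoin_le_iff]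
      rintro _ (rfl | rfl)
      · exact ⟨x, by simp [hφx, hX]⟩
      · exact ⟨y, by simp [hφy, hY]⟩
    · change Function.Surjective
        (((Pi.evalAlgHom k _ i).comp (AlgHom.snd k _ _)).comp φ)
      rw [← AlgHom.range_eq_top, ← top_le_iff, ← adjoin_lowering_raising hfac (hc0 i),
        Algebra.adjoin_le_iff]
      rintro _ (rfl | rfl)
      · exact ⟨x, by simp [hφx, hX]⟩
      · exact ⟨y, by simp [hφy, hY]⟩
  have hker : Function.Bijective φ := by
    let e : AddMonoidAlgebra k (ZMod p × ZMod p) ≃ₗ[k] (ZMod p × ZMod p →₀ k) :=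
      AddMonoidAlgebra.coeffLinearEquiv k
    have : Module.Finite k (AddMonoidAlgebra k (ZMod p × ZMod p)) := Module.Finite.equiv e.symm
    refine bijective_of_surjective_of_span hspan ?_ φ.toLinearMap hsurj
    rw [Module.finrank_prod, e.finrank_eq, Module.finrank_finsupp_self, Module.finrank_pi_fintype]
    simp only [Module.finrank_matrix, Fintype.card_prod, ZMod.card, Fintype.card_fin,
      Module.finrank_self, Finset.sum_const, Finset.card_univ, smul_eq_mul, mul_one]
    obtain ⟨m, rfl⟩ : ∃ m, p = m + 1 := ⟨p - 1, (Nat.sub_add_cancel hp.one_le).symm⟩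
    simp only [Nat.add_sub_cancel]
    ring
  exact ⟨AlgEquiv.ofBijective φ hker⟩
end
end

section
/- Let p be a prime and k a field of characteristic p. The algebra Λ = k⟨x,y,z⟩/⟨[x,y] − y, [x,z], [y,z], x^p − x, y^p, z^p − z⟩ is isomorphic as a k-algebra to the product of p copies of the algebra B = k⟨x,y⟩/⟨[x,y] − y, x^p − x, y^p⟩. -/
noncomputable section

open Polynomial in
theorem nodal_natCast_eq_X_pow_sub_X (p : ℕ) (hp : p.Prime) (k : Type*) [Field k] [CharP k p] :
    Lagrange.nodal Finset.univ (fun i : Fin p => (i : k)) = X ^ p - X := by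
  have : Fact p.Prime := ⟨hp⟩
  have hv : Function.Injective (fun i : Fin p => (i : k)) := fun i j h =>
    Fin.ext (CharP.natCast_injOn_Iio k p i.2 j.2 h)
  have hlt : (X : k[X]).degree < (p : WithBot ℕ) := by
    rw [degree_X]
    exact_mod_cast hp.one_lt
  have hdeg : (X ^ p - X : k[X]).degree = p := by
    rw [degree_sub_eq_left_of_degree_lt] <;> simp [hp.one_lt]
  refine eq_of_degree_le_of_eval_index_eq Finset.univ hv.injOn ?_ ?_ ?_ ?_
  · simp
  · simp [hdeg]
  · rw [Lagrange.nodal_monic, (monic_X_pow_sub hlt).leadingCoeff]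
  · intro i _
    refine (Lagrange.eval_nodal_at_node (v := fun i : Fin p => (i : k))
      (Finset.mem_univ i)).trans ?_
    rw [eval_sub, eval_pow, eval_X, ← frobenius_def, map_natCast, sub_self]

open Polynomial in
theorem X_sub_C_mul_basis {F ι : Type*} [Field F] [DecidableEq ι] (s : Finset ι) (v : ι → F)
    {i : ι} (hi : i ∈ s) :
    (X - C (v i)) * Lagrange.basis s v i =
      C (Lagrange.nodalWeight s v i) * Lagrange.nodal s v := by
  simp only [Lagrange.basis, Lagrange.basisDivisor, Lagrange.nodalWeight,
    Lagrange.nodal_eq_mul_nodal_erase hi, Finset.prod_mul_distrib, Lagrange.nodal_eq, map_prod]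
  ring

open Polynomial in
/-- A central element `z` annihilated by a split separable polynomial decomposes an algebra
generated by `z` and a subalgebra `B` as a power of `B`, provided that `z` can be specialised
to every root. -/
theorem bijective_of_central_of_aeval_nodal_eq_zero {k A B ι : Type*} [Field k] [Ring A] [Ring B]
    [Algebra k A] [Algebra k B] [Fintype ι] [Nonempty ι] {v : ι → k} (hv : Function.Injective v)
    (φ : A →ₐ[k] (ι → B)) (ψ : B →ₐ[k] A) (z : A) (hz : ∀ a, Commute z a)
    (hz0 : aeval z (Lagrange.nodal Finset.univ v) = 0)
    (hgen : Algebra.adjoin k (insert z (Set.range ψ)) = ⊤)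
    (hφψ : ∀ b i, φ (ψ b) i = b) (hφz : ∀ i, φ z i = algebraMap k B (v i)) :
    Function.Bijective φ := by
  classical
  let e : ι → A := fun i => aeval z (Lagrange.basis Finset.univ v i)
  have hsum : ∑ i, e i = 1 := by
    rw [← map_sum, Lagrange.sum_basis hv.injOn Finset.univ_nonempty, map_one]
  have hcomm : ∀ i a, Commute (e i) a := fun i a =>
    Algebra.commute_of_mem_adjoin_singleton_of_commute
      (aeval_mem_adjoin_singleton k z) (hz a).symm |>.symm
  have hze : ∀ i, z * e i = algebraMap k A (v i) * e i := fun i => by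
    have h := congrArg (aeval z) (X_sub_C_mul_basis Finset.univ v (Finset.mem_univ i))
    rw [map_mul, map_mul, hz0, mul_zero, map_sub, aeval_X, aeval_C, sub_mul, sub_eq_zero] at h
    exact h
  have hφe : ∀ i j, φ (e i) j = if i = j then 1 else 0 := fun i j => by
    have h : φ (e i) j = aeval (φ z j) (Lagrange.basis Finset.univ v i) :=
      (aeval_algHom_apply ((Pi.evalAlgHom k (fun _ : ι => B) j).comp φ) z _).symm
    rw [h, hφz, aeval_algebraMap_apply_eq_algebraMap_eval]
    split_ifs with hij
    · rw [← hij, Lagrange.eval_basis_self hv.injOn (Finset.mem_univ i), map_one]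
    · rw [Lagrange.eval_basis_of_ne hij (Finset.mem_univ j), map_zero]
  have key : ∀ a i, a * e i = ψ (φ a i) * e i := fun a i => by
    have ha : a ∈ Algebra.adjoin k (insert z (Set.range ψ)) := hgen ▸ Algebra.mem_top
    induction ha using Algebra.adjoin_induction with
    | mem x hx =>
      rcases hx with rfl | ⟨b, rfl⟩
      · rw [hφz, AlgHom.commutes, hze]
      · rw [hφψ]
    | algebraMap r => simp
    | add x y _ _ hx hy => simp only [map_add, Pi.add_apply, add_mul, hx, hy]
    | mul x y _ _ hx hy =>
      rw [map_mul, Pi.mul_apply, map_mul, mul_assoc, hy, ← (hcomm i _).eq, ← mul_assoc, hx,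
        mul_assoc, (hcomm i _).eq, mul_assoc]
  constructor
  · rw [injective_iff_map_eq_zero]
    intro a ha
    rw [← mul_one a, ← hsum, Finset.mul_sum]
    exact Finset.sum_eq_zero fun i _ => by rw [key, ha, Pi.zero_apply, map_zero, zero_mul]
  · intro b
    refine ⟨∑ i, ψ (b i) * e i, funext fun j => ?_⟩
    simp [hφψ, hφe]

theorem mkAlgHom_relOf_eq_zero (k : Type*) {A : Type*} [CommSemiring k] [Ring A] [Algebra k A]
    {S : Set A} {a : A} (ha : a ∈ S) : RingQuot.mkAlgHom k (relOf S) a = 0 :=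
  (RingQuot.mkAlgHom_rel k ⟨ha, rfl⟩).trans (map_zero _)

/-- An algebra homomorphism out of a free algebra that kills `S` factors through the quotient. -/
theorem exists_algHom_relOf {k X A : Type*} [CommRing k] [Ring A] [Algebra k A]
    {S : Set (FreeAlgebra k X)} (g : X → A) (h : ∀ a ∈ S, FreeAlgebra.lift k g a = 0) :
    ∃ f : RingQuot (relOf S) →ₐ[k] A,
      ∀ x, f (RingQuot.mkAlgHom k (relOf S) (FreeAlgebra.ι k x)) = g x :=
  ⟨RingQuot.liftAlgHom k ⟨FreeAlgebra.lift k g, by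
    rintro a _ ⟨ha, rfl⟩
    rw [h a ha, map_zero]⟩, fun x => by
    rw [RingQuot.liftAlgHom_mkAlgHom_apply, FreeAlgebra.lift_ι_apply]⟩

theorem adjoin_range_mkAlgHom_ι {k X : Type*} [CommRing k] (S : Set (FreeAlgebra k X)) :
    Algebra.adjoin k
      (Set.range fun x => RingQuot.mkAlgHom k (relOf S) (FreeAlgebra.ι k x)) = ⊤ := by
  rw [Set.range_comp', ← AlgHom.map_adjoin, FreeAlgebra.adjoin_range_ι, Algebra.map_top,
    AlgHom.range_eq_top]
  exact RingQuot.mkAlgHom_surjective k _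

/-- The algebra of type C13:
`k⟨x,y,z⟩/⟨[x,y] − y, [x,z], [y,z], x^p − x, y^p, z^p − z⟩` is isomorphic as a
`k`-algebra to the product of `p` copies of `B = k⟨x,y⟩/⟨[x,y] − y, x^p − x, y^p⟩`. -/
theorem stmt9 (p : ℕ) (hp : p.Prime) (k : Type*) [Field k] [CharP k p] :
    Nonempty
      (RingQuot (relOf
          (({commutator' (FreeAlgebra.ι k (0 : Fin 3)) (FreeAlgebra.ι k 1) - FreeAlgebra.ι k 1,
             commutator' (FreeAlgebra.ι k (0 : Fin 3)) (FreeAlgebra.ι k 2),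
             commutator' (FreeAlgebra.ι k (1 : Fin 3)) (FreeAlgebra.ι k 2),
             FreeAlgebra.ι k (0 : Fin 3) ^ p - FreeAlgebra.ι k 0,
             FreeAlgebra.ι k (1 : Fin 3) ^ p,
             FreeAlgebra.ι k (2 : Fin 3) ^ p - FreeAlgebra.ι k 2} :
            Set (FreeAlgebra k (Fin 3))))) ≃ₐ[k]
        (Fin p →
          RingQuot (relOf
            (({commutator' (FreeAlgebra.ι k (0 : Fin 2)) (FreeAlgebra.ι k 1) -
                 FreeAlgebra.ι k 1,
               FreeAlgebra.ι k (0 : Fin 2) ^ p - FreeAlgebra.ι k 0,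
               FreeAlgebra.ι k (1 : Fin 2) ^ p} :
              Set (FreeAlgebra k (Fin 2))))))) := by
  have : Fact p.Prime := ⟨hp⟩
  have : NeZero p := ⟨hp.ne_zero⟩
  set S : Set (FreeAlgebra k (Fin 3)) := {_, _, _, _, _, _} with hS
  set T : Set (FreeAlgebra k (Fin 2)) := {_, _, _} with hT
  let q := RingQuot.mkAlgHom k (relOf S)
  let r := RingQuot.mkAlgHom k (relOf T)
  have hq : ∀ a ∈ S, q a = 0 := fun a => mkAlgHom_relOf_eq_zero k
  have hr : ∀ a ∈ T, r a = 0 := fun a => mkAlgHom_relOf_eq_zero k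
  simp only [hS, Set.mem_insert_iff, Set.mem_singleton_iff, forall_eq_or_imp, forall_eq,
    commutator', map_sub, map_mul, map_pow] at hq
  simp only [hT, Set.mem_insert_iff, Set.mem_singleton_iff, forall_eq_or_imp, forall_eq,
    commutator', map_sub, map_mul, map_pow] at hr
  obtain ⟨hxy, hxz, hyz, hx, hy, hz⟩ := hq
  obtain ⟨hxy', hx', hy'⟩ := hr
  obtain ⟨ψ, hψ⟩ := exists_algHom_relOf (S := T)
    ![q (FreeAlgebra.ι k 0), q (FreeAlgebra.ι k 1)] (by
      simp [hT, commutator', hxy, hx, hy])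
  have hc (a : RingQuot (relOf T)) (c : k) : a * algebraMap k _ c - algebraMap k _ c * a = 0 :=
    sub_eq_zero.2 (Algebra.commutes c a).symm
  obtain ⟨φ, hφ⟩ := exists_algHom_relOf (S := S)
    (![fun _ => r (FreeAlgebra.ι k 0), fun _ => r (FreeAlgebra.ι k 1),
      fun i => algebraMap k _ (i : k)] : Fin 3 → Fin p → RingQuot (relOf T)) (by
      simp only [hS, Set.mem_insert_iff, Set.mem_singleton_iff, forall_eq_or_imp, forall_eq,
        commutator', map_sub, map_mul, map_pow, FreeAlgebra.lift_ι_apply]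
      refine ⟨funext fun i => hxy', funext fun i => ?_, funext fun i => ?_, funext fun i => hx',
        funext fun i => hy', funext fun i => ?_⟩
      · exact hc (r (FreeAlgebra.ι k 0)) i
      · exact hc (r (FreeAlgebra.ι k 1)) i
      · change algebraMap k (RingQuot (relOf T)) (i : k) ^ p - algebraMap k _ (i : k) = 0
        rw [← map_pow, ← frobenius_def, map_natCast, sub_self])
  have hgen := adjoin_range_mkAlgHom_ι S
  have hgen' := adjoin_range_mkAlgHom_ι T
  refine ⟨AlgEquiv.ofBijective φ (bijective_of_central_of_aeval_nodal_eq_zero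
    (v := fun i : Fin p => (i : k)) (fun i j h => Fin.ext (CharP.natCast_injOn_Iio k p i.2 j.2 h))
    φ ψ (q (FreeAlgebra.ι k 2)) (fun a => ?_) ?_ ?_ (fun b i => ?_) fun i => ?_)⟩
  · have ha : a ∈ Algebra.adjoin k _ := hgen ▸ Algebra.mem_top
    refine (Algebra.commute_of_mem_adjoin_of_forall_mem_commute ha ?_)
    rintro _ ⟨j, rfl⟩
    fin_cases j
    · exact (sub_eq_zero.1 hxz).symm
    · exact (sub_eq_zero.1 hyz).symm
    · exact Commute.refl _
  · simpa [nodal_natCast_eq_X_pow_sub_X p hp k] using hz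
  · rw [eq_top_iff, ← hgen]
    refine Algebra.adjoin_mono ?_
    rintro _ ⟨j, rfl⟩
    fin_cases j
    · exact Or.inr ⟨_, hψ 0⟩
    · exact Or.inr ⟨_, hψ 1⟩
    · exact Or.inl rfl
  · have h : ((Pi.evalAlgHom k (fun _ : Fin p => RingQuot (relOf T)) i).comp φ).comp ψ =
        AlgHom.id k _ := by
      refine AlgHom.ext_of_adjoin_eq_top hgen' ?_
      rintro _ ⟨j, rfl⟩
      fin_cases j
      · exact congrFun ((congrArg φ (hψ 0)).trans (hφ 0)) i
      · exact congrFun ((congrArg φ (hψ 1)).trans (hφ 1)) i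
    exact DFunLike.congr_fun h b
  · exact congrFun (hφ 2) i
end
end

section
/- Let p be a prime and k a field of characteristic p. The algebra Λ = k⟨x,y,z⟩/⟨[x,y] − y, [x,z], [y,z], x^p − x, y^p − z, z^p − z⟩ is isomorphic as a k-algebra to the product of B = k⟨x,y⟩/⟨[x,y] − y, x^p − x, y^p⟩ with p − 1 copies of the matrix algebra M_p(k). -/
noncomputable section

open Polynomial

section Idempotents

variable {p : ℕ} [Fact p.Prime] {k : Type*} [Field k] [CharP k p]

/-- The polynomial `1 - (X - i) ^ (p - 1)`, which takes the value `1` at `i` and `0` at every other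
element of the prime field. -/
def primeFieldDelta (p : ℕ) [Fact p.Prime] (k : Type*) [Field k] [CharP k p] (i : ZMod p) : k[X] :=
  1 - (X - C (ZMod.castHom dvd_rfl k i)) ^ (p - 1)

lemma castHom_pow_card (i : ZMod p) :
    ZMod.castHom dvd_rfl k i ^ p = ZMod.castHom dvd_rfl k i := by
  rw [← map_pow, ZMod.pow_card]

lemma X_sub_C_mul_primeFieldDelta (i : ZMod p) :
    (X - C (ZMod.castHom dvd_rfl k i)) * primeFieldDelta p k i = X - X ^ p := by
  have hp : 0 < p := (Fact.out : p.Prime).pos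
  rw [primeFieldDelta, mul_sub, mul_one, ← pow_succ', Nat.sub_add_cancel hp, sub_pow_char, ← C_pow,
    castHom_pow_card]
  ring

lemma eval_primeFieldDelta (i j : ZMod p) :
    (primeFieldDelta p k i).eval (ZMod.castHom dvd_rfl k j) = if i = j then 1 else 0 := by
  have hp : p - 1 ≠ 0 := (Nat.sub_pos_of_lt (Fact.out : p.Prime).one_lt).ne'
  simp only [primeFieldDelta, eval_sub, eval_one, eval_pow, eval_X, eval_C, ← map_sub, ← map_pow]
  split_ifs with h
  · subst h
    simp [hp]
  · rw [ZMod.pow_card_sub_one_eq_one (sub_ne_zero.mpr (Ne.symm h)), map_one, sub_self]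

lemma primeFieldDelta_comp (i : ZMod p) :
    (primeFieldDelta p k (i + 1)).comp (X + 1) = primeFieldDelta p k i := by
  simp only [primeFieldDelta, sub_comp, one_comp, pow_comp, X_comp, C_comp, map_add, map_one,
    add_comp, add_sub_add_right_eq_sub]

lemma degree_primeFieldDelta_lt (i : ZMod p) : (primeFieldDelta p k i).degree < p := by
  have hp : 1 < p := (Fact.out : p.Prime).one_lt
  refine (degree_sub_le _ _).trans_lt (max_lt ?_ ?_)
  · rw [degree_one]
    exact_mod_cast (by lia : 0 < p)
  · rw [degree_pow, degree_X_sub_C, nsmul_one]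
    exact_mod_cast (by lia : p - 1 < p)

lemma sum_primeFieldDelta : ∑ i : ZMod p, primeFieldDelta p k i = 1 := by
  have hp : 0 < p := (Fact.out : p.Prime).pos
  refine eq_of_degrees_lt_of_eval_index_eq (Finset.univ : Finset (ZMod p))
    (v := ZMod.castHom dvd_rfl k) (ZMod.castHom dvd_rfl k).injective.injOn ?_ ?_ ?_
  · rw [Finset.card_univ, ZMod.card]
    refine (degree_sum_le _ _).trans_lt ?_
    rw [Finset.sup_lt_iff (by exact_mod_cast WithBot.bot_lt_coe p)]
    exact fun i _ => degree_primeFieldDelta_lt i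
  · rw [Finset.card_univ, ZMod.card, degree_one]
    exact_mod_cast hp
  · intro j _
    simp [eval_finsetSum, eval_primeFieldDelta, -ZMod.castHom_apply]

variable {A : Type*} [Ring A] [Algebra k A]

lemma mul_aeval_primeFieldDelta {t : A} (ht : t ^ p = t) (i : ZMod p) :
    t * aeval t (primeFieldDelta p k i) =
      ZMod.castHom dvd_rfl k i • aeval t (primeFieldDelta p k i) := by
  have h := congrArg (aeval t) (X_sub_C_mul_primeFieldDelta (k := k) i)
  rw [map_mul, map_sub, map_sub, aeval_X, aeval_C, map_pow, aeval_X, ht, sub_self, sub_mul,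
    sub_eq_zero] at h
  rw [h, Algebra.smul_def]

lemma aeval_mul_of_mul_eq_smul {z e : A} {c : k} (h : z * e = c • e) (P : k[X]) :
    aeval z P * e = P.eval c • e := by
  induction P using Polynomial.induction_on' with
  | add P Q hP hQ => rw [map_add, add_mul, hP, hQ, eval_add, add_smul]
  | monomial n a =>
    have hn : z ^ n * e = c ^ n • e := by
      induction n with
      | zero => simp
      | succ n ih => rw [pow_succ, mul_assoc, h, mul_smul_comm, ih, smul_smul, pow_succ']
    rw [aeval_monomial, eval_monomial, mul_assoc, hn, ← Algebra.smul_def, smul_smul]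

lemma aeval_mul_of_mul_eq {x x' u : A} (h : x * u = u * x') (P : k[X]) :
    aeval x P * u = u * aeval x' P := by
  induction P using Polynomial.induction_on' with
  | add P Q hP hQ => rw [map_add, map_add, add_mul, mul_add, hP, hQ]
  | monomial n a =>
    have hn : x ^ n * u = u * x' ^ n := SemiconjBy.pow_right (a := u) h.symm n |>.symm
    rw [aeval_monomial, aeval_monomial, mul_assoc, hn, Algebra.left_comm]

lemma mul_aeval_primeFieldDelta_shift {x u : A} (h : x * u = u * (x + 1)) (i : ZMod p) :
    u * aeval x (primeFieldDelta p k i) = aeval x (primeFieldDelta p k (i + 1)) * u := by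
  rw [aeval_mul_of_mul_eq h, ← primeFieldDelta_comp i, aeval_comp]
  simp

end Idempotents

section Matrices

variable (p : ℕ) [Fact p.Prime] (k : Type*) [Field k]

/-- The cyclic shift sending the basis vector `j` to `j + 1`. -/
def shiftMatrix : Matrix (ZMod p) (ZMod p) k := Matrix.of fun i j => if i = j + 1 then 1 else 0

variable {p k}

lemma shiftMatrix_mul_apply (m : Matrix (ZMod p) (ZMod p) k) (i j : ZMod p) :
    (shiftMatrix p k * m) i j = m (i - 1) j := by
  have h : ∀ l : ZMod p, (i = l + 1) ↔ (i - 1 = l) := fun l => sub_eq_iff_eq_add.symm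
  simp [Matrix.mul_apply, shiftMatrix, h]

lemma shiftMatrix_pow_apply (n : ℕ) (i j : ZMod p) :
    (shiftMatrix p k ^ n) i j = if i = j + n then 1 else 0 := by
  induction n generalizing i with
  | zero => simp [Matrix.one_apply]
  | succ n ih =>
    rw [pow_succ', shiftMatrix_mul_apply, ih]
    congr 1
    rw [sub_eq_iff_eq_add, Nat.cast_succ, add_assoc]

lemma shiftMatrix_pow_card : shiftMatrix p k ^ p = 1 := by
  ext i j
  rw [shiftMatrix_pow_apply, CharP.cast_eq_zero, add_zero, Matrix.one_apply]

variable [CharP k p]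

variable (p k) in
/-- The diagonal matrix whose entries are the elements of the prime field. -/
def clockMatrix : Matrix (ZMod p) (ZMod p) k := Matrix.diagonal (ZMod.castHom dvd_rfl k)

lemma clockMatrix_pow_card : clockMatrix p k ^ p = clockMatrix p k := by
  rw [clockMatrix, Matrix.diagonal_pow]
  congr 1
  ext i
  exact castHom_pow_card i

lemma clockMatrix_mul_shiftMatrix_sub :
    clockMatrix p k * shiftMatrix p k - shiftMatrix p k * clockMatrix p k = shiftMatrix p k := by
  ext i j
  rw [Matrix.sub_apply, clockMatrix, Matrix.diagonal_mul, Matrix.mul_diagonal]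
  simp only [shiftMatrix, Matrix.of_apply]
  split_ifs with h
  · rw [h, map_add, map_one]
    ring
  · ring

lemma aeval_clockMatrix_primeFieldDelta_mul (i : ZMod p) (m : Matrix (ZMod p) (ZMod p) k)
    (a b : ZMod p) :
    (aeval (clockMatrix p k) (primeFieldDelta p k i) * m) a b = if i = a then m a b else 0 := by
  have h : aeval (clockMatrix p k) (primeFieldDelta p k i) =
      Matrix.diagonal fun j => (primeFieldDelta p k i).eval (ZMod.castHom dvd_rfl k j) := by
    have := (Polynomial.aeval_algHom_apply (Matrix.diagonalAlgHom k (n := ZMod p) (α := k))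
      (ZMod.castHom dvd_rfl k : ZMod p → k) (primeFieldDelta p k i))
    refine this.trans ?_
    rw [Matrix.diagonalAlgHom_apply]
    congr 1
    ext j
    rw [Polynomial.aeval_pi_apply]
    rfl
  rw [h, Matrix.diagonal_mul, eval_primeFieldDelta]
  split_ifs <;> simp

end Matrices

section FromMatrices

variable {p : ℕ} [Fact p.Prime] {k : Type*} [Field k] [CharP k p]
variable {A : Type*} [Ring A] [Algebra k A]

/-- The linear map sending the matrix unit `(i, j)` to `δ_i(x) u ^ (i - j) e`. -/
def ofMatrix (x u e : A) : Matrix (ZMod p) (ZMod p) k →ₗ[k] A where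
  toFun m := ∑ i, ∑ j, m i j • (aeval x (primeFieldDelta p k i) * (u ^ (i - j).val * e))
  map_add' m n := by simp only [Matrix.add_apply, add_smul, Finset.sum_add_distrib]
  map_smul' c m := by
    simp only [Matrix.smul_apply, smul_assoc, Finset.smul_sum, RingHom.id_apply]

lemma ofMatrix_apply (x u e : A) (m : Matrix (ZMod p) (ZMod p) k) :
    ofMatrix x u e m =
      ∑ i, ∑ j, m i j • (aeval x (primeFieldDelta p k i) * (u ^ (i - j).val * e)) := rfl

lemma ofMatrix_one (x u e : A) : ofMatrix x u e (1 : Matrix (ZMod p) (ZMod p) k) = e := by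
  have h : ∀ i : ZMod p, ∑ j, (1 : Matrix (ZMod p) (ZMod p) k) i j •
      (aeval x (primeFieldDelta p k i) * (u ^ (i - j).val * e)) =
      aeval x (primeFieldDelta p k i) * e := by
    intro i
    simp [Matrix.one_apply]
  rw [ofMatrix_apply, Finset.sum_congr rfl fun i _ => h i, ← Finset.sum_mul, ← map_sum,
    sum_primeFieldDelta, map_one, one_mul]

lemma ofMatrix_clockMatrix_mul {x : A} (hx : x ^ p = x) (u e : A)
    (m : Matrix (ZMod p) (ZMod p) k) :
    ofMatrix x u e (clockMatrix p k * m) = x * ofMatrix x u e m := by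
  simp only [ofMatrix_apply, Finset.mul_sum]
  refine Finset.sum_congr rfl fun i _ => Finset.sum_congr rfl fun j _ => ?_
  rw [clockMatrix, Matrix.diagonal_mul, mul_smul_comm, ← mul_assoc x, mul_aeval_primeFieldDelta hx,
    smul_mul_assoc, smul_smul, mul_comm]

lemma pow_val_add_one_mul {u e : A} (he : u ^ p * e = e) (n : ZMod p) :
    u ^ (n + 1).val * e = u * (u ^ n.val * e) := by
  have h : ∀ q : ℕ, (u ^ p) ^ q * e = e := by
    intro q
    induction q with
    | zero => simp
    | succ q ih => rw [pow_succ, mul_assoc, he, ih]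
  have hval : (n + 1).val = (n.val + 1) % p := by
    rw [ZMod.val_add, ZMod.val_one]
  rw [hval, ← mul_assoc, ← pow_succ']
  conv_rhs => rw [← Nat.mod_add_div (n.val + 1) p, pow_add, mul_assoc, pow_mul, h]

lemma ofMatrix_shiftMatrix_mul {x u e : A} (hxu : x * u = u * (x + 1)) (he : u ^ p * e = e)
    (m : Matrix (ZMod p) (ZMod p) k) :
    ofMatrix x u e (shiftMatrix p k * m) = u * ofMatrix x u e m := by
  simp only [ofMatrix_apply, Finset.mul_sum]
  rw [← Equiv.sum_comp (Equiv.addRight (1 : ZMod p))]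
  refine Finset.sum_congr rfl fun i _ => Finset.sum_congr rfl fun j _ => ?_
  simp only [Equiv.coe_addRight]
  rw [shiftMatrix_mul_apply, add_sub_cancel_right, add_sub_right_comm, pow_val_add_one_mul he,
    mul_smul_comm, ← mul_assoc u (aeval _ _), mul_aeval_primeFieldDelta_shift hxu, mul_assoc]

lemma mul_ofMatrix {x u e z : A} {c : k} (hxz : Commute z x) (huz : Commute z u)
    (he : z * e = c • e) (m : Matrix (ZMod p) (ZMod p) k) :
    z * ofMatrix x u e m = c • ofMatrix x u e m := by
  simp only [ofMatrix_apply, Finset.mul_sum, Finset.smul_sum]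
  refine Finset.sum_congr rfl fun i _ => Finset.sum_congr rfl fun j _ => ?_
  have h : Commute z (aeval x (primeFieldDelta p k i)) :=
    (aeval_mul_of_mul_eq (hxz : z * x = x * z).symm _).symm
  rw [mul_smul_comm, ← mul_assoc z, h.eq, mul_assoc, ← mul_assoc z, (huz.pow_right _).eq, mul_assoc,
    he, mul_smul_comm, mul_smul_comm, smul_comm]

lemma map_ofMatrix (φ : A →ₐ[k] Matrix (ZMod p) (ZMod p) k) {x u e : A}
    (hx : φ x = clockMatrix p k) (hu : φ u = shiftMatrix p k) (he : φ e = 1)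
    (m : Matrix (ZMod p) (ZMod p) k) : φ (ofMatrix x u e m) = m := by
  ext a b
  have h : ∀ j : ZMod p, (a = b + (a - j)) ↔ b = j := fun j =>
    ⟨fun h => by linear_combination -h, fun h => by rw [h]; ring⟩
  simp [ofMatrix_apply, ← Polynomial.aeval_algHom_apply, hx, hu, he, Matrix.sum_apply,
    aeval_clockMatrix_primeFieldDelta_mul, shiftMatrix_pow_apply, h]

end FromMatrices

lemma map_mul_of_adjoin_eq_top {k A M : Type*} [CommRing k] [Ring A] [Algebra k A] [Ring M]
    [Algebra k M] {s : Set A} (hs : Algebra.adjoin k s = ⊤) (φ : A →ₐ[k] M) (T : M →ₗ[k] A)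
    (h : ∀ a ∈ s, ∀ m, T (φ a * m) = a * T m) (a : A) (m : M) : T (φ a * m) = a * T m := by
  have ha : a ∈ Algebra.adjoin k s := hs ▸ Algebra.mem_top
  induction ha using Algebra.adjoin_induction generalizing m with
  | mem a ha => exact h a ha m
  | algebraMap r => rw [AlgHom.commutes, ← Algebra.smul_def, map_smul, Algebra.smul_def]
  | add a b _ _ iha ihb => rw [map_add, add_mul, map_add, iha, ihb, add_mul]
  | mul a b _ _ iha ihb => rw [map_mul φ, mul_assoc, iha, ihb, mul_assoc]

section Presentations

variable {k : Type*} [CommRing k] {ι : Type*} (S : Set (FreeAlgebra k ι))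

/-- The class of the `i`-th free generator in the algebra with relations `S`. -/
def relGen (i : ι) : RingQuot (relOf S) := RingQuot.mkAlgHom k (relOf S) (FreeAlgebra.ι k i)

lemma adjoin_range_relGen : Algebra.adjoin k (Set.range (relGen S)) = ⊤ := by
  have h : Set.range (relGen S) =
      RingQuot.mkAlgHom k (relOf S) '' Set.range (FreeAlgebra.ι k) := by
    rw [← Set.range_comp]
    rfl
  rw [h, ← AlgHom.map_adjoin, FreeAlgebra.adjoin_range_ι, Algebra.map_top]
  exact (AlgHom.range_eq_top _).mpr (RingQuot.mkAlgHom_surjective k _)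

variable {S} in
lemma lift_relGen_eq_zero {s : FreeAlgebra k ι} (hs : s ∈ S) :
    FreeAlgebra.lift k (relGen S) s = 0 := by
  have h : FreeAlgebra.lift k (relGen S) = RingQuot.mkAlgHom k (relOf S) :=
    FreeAlgebra.hom_ext (funext fun i => FreeAlgebra.lift_ι_apply _ _)
  rw [h, RingQuot.mkAlgHom_rel k (show relOf S s 0 from ⟨hs, rfl⟩), map_zero]

lemma exists_algHom_relGen {M : Type*} [Ring M] [Algebra k M] (f : ι → M)
    (hf : ∀ s ∈ S, FreeAlgebra.lift k f s = 0) :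
    ∃ φ : RingQuot (relOf S) →ₐ[k] M, ∀ i, φ (relGen S i) = f i := by
  refine ⟨RingQuot.liftAlgHom k ⟨FreeAlgebra.lift k f, ?_⟩, fun i => ?_⟩
  · rintro a b ⟨ha, rfl⟩
    rw [hf a ha, map_zero]
  · rw [relGen, RingQuot.liftAlgHom_mkAlgHom_apply, FreeAlgebra.lift_ι_apply]

end Presentations

section Decomposition

variable {p : ℕ} [Fact p.Prime] {k : Type*} [Field k] [CharP k p]
variable {A B : Type*} [Ring A] [Algebra k A] [Ring B] [Algebra k B]

lemma map_aeval_primeFieldDelta (φ : A →ₐ[k] B) {z : A} {d : ZMod p}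
    (hz : φ z = algebraMap k B (ZMod.castHom dvd_rfl k d)) (c : ZMod p) :
    φ (aeval z (primeFieldDelta p k c)) = if c = d then 1 else 0 := by
  rw [← aeval_algHom_apply, hz, aeval_algebraMap_apply, coe_aeval_eq_eval, eval_primeFieldDelta]
  split_ifs <;> simp

lemma exists_ofMatrix {x y z : A} (hxy : x * y - y * x = y) (hxz : Commute z x)
    (hyz : Commute z y) (hx : x ^ p = x) (hy : y ^ p = z) (hz : z ^ p = z)
    (hgen : Algebra.adjoin k {x, y, z} = ⊤) {c : ZMod p} (hc : c ≠ 0)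
    (φ : A →ₐ[k] Matrix (ZMod p) (ZMod p) k) (hφx : φ x = clockMatrix p k)
    (hφy : φ y = ZMod.castHom dvd_rfl k c • shiftMatrix p k)
    (hφz : φ z = algebraMap k _ (ZMod.castHom dvd_rfl k c)) :
    ∃ T : Matrix (ZMod p) (ZMod p) k →ₗ[k] A,
      (∀ m, φ (T m) = m) ∧ ∀ a, T (φ a) = a * aeval z (primeFieldDelta p k c) := by
  set e := aeval z (primeFieldDelta p k c) with he
  set r : k := ZMod.castHom dvd_rfl k c with hr
  have hr0 : r ≠ 0 := by rwa [hr, _root_.map_ne_zero]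
  have hze : z * e = r • e := mul_aeval_primeFieldDelta hz c
  have hxu : x * (r⁻¹ • y) = (r⁻¹ • y) * (x + 1) := by
    rw [mul_smul_comm, smul_mul_assoc, mul_add, mul_one, ← sub_eq_iff_eq_add'.mp hxy]
  have hu : (r⁻¹ • y) ^ p * e = e := by
    rw [_root_.smul_pow, hy, smul_mul_assoc, hze, smul_smul, inv_pow, hr, castHom_pow_card, ← hr,
      inv_mul_cancel₀ hr0, one_smul]
  have hyu : y = r • r⁻¹ • y := by rw [smul_smul, mul_inv_cancel₀ hr0, one_smul]
  refine ⟨ofMatrix x (r⁻¹ • y) e, map_ofMatrix φ hφx ?_ ?_, fun a => ?_⟩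
  · rw [map_smul, hφy, smul_smul, inv_mul_cancel₀ hr0, one_smul]
  · rw [he, map_aeval_primeFieldDelta φ hφz, if_pos rfl]
  · have h := map_mul_of_adjoin_eq_top hgen φ (ofMatrix x (r⁻¹ • y) e) ?_ a 1
    · rwa [mul_one, ofMatrix_one] at h
    · rintro a (rfl | rfl | rfl) m
      · rw [hφx, ofMatrix_clockMatrix_mul hx]
      · rw [hφy, smul_mul_assoc, map_smul, ofMatrix_shiftMatrix_mul hxu hu, ← smul_mul_assoc, ← hyu]
      · rw [hφz, ← Algebra.smul_def, map_smul, mul_ofMatrix hxz (hyz.smul_right _) hze]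

lemma exists_ofNilpotentBlock {x y z : A} (hxz : Commute z x)
    (hyz : Commute z y) (hz : z ^ p = z) (hgen : Algebra.adjoin k {x, y, z} = ⊤) {X Y : B}
    (hgenB : Algebra.adjoin k {X, Y} = ⊤) (φ : A →ₐ[k] B) (hφx : φ x = X) (hφy : φ y = Y)
    (hφz : φ z = 0) (β : B →ₐ[k] A) (hβX : β X = x)
    (hβY : β Y = aeval z (primeFieldDelta p k 0) * y) :
    ∃ T : B →ₗ[k] A,
      (∀ b, φ (T b) = b) ∧ ∀ a, T (φ a) = a * aeval z (primeFieldDelta p k 0) := by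
  have hφe := map_aeval_primeFieldDelta φ (z := z) (d := 0) (by simpa using hφz) 0
  rw [if_pos rfl] at hφe
  have hcomm : ∀ {t : A}, Commute z t → Commute (aeval z (primeFieldDelta p k 0)) t := fun h =>
    aeval_mul_of_mul_eq h.eq _
  have hze := mul_aeval_primeFieldDelta (k := k) hz 0
  have hee := aeval_mul_of_mul_eq_smul hze (primeFieldDelta p k 0)
  rw [eval_primeFieldDelta, if_pos rfl, one_smul] at hee
  rw [map_zero, zero_smul] at hze
  set e := aeval z (primeFieldDelta p k 0) with he
  have hφβ : φ.comp β = AlgHom.id k B := by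
    refine AlgHom.ext_of_adjoin_eq_top hgenB ?_
    rintro b (rfl | rfl)
    · simp [hβX, hφx]
    · simp [hβY, hφy, hφe]
  refine ⟨LinearMap.mulLeft k e ∘ₗ β.toLinearMap, fun b => ?_, fun a => ?_⟩
  · simpa [hφe] using DFunLike.congr_fun hφβ b
  · have h := map_mul_of_adjoin_eq_top hgen φ (LinearMap.mulLeft k e ∘ₗ β.toLinearMap) ?_ a 1
    · simpa using h
    · rintro a (rfl | rfl | rfl) m
      · simp [hφx, hβX, ← mul_assoc, (hcomm hxz).eq]
      · simp only [LinearMap.comp_apply, AlgHom.toLinearMap_apply, LinearMap.mulLeft_apply, map_mul,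
          hφy, hβY]
        rw [← mul_assoc, ← mul_assoc, hee, (hcomm hyz).eq, mul_assoc]
      · simp [hφz, ← mul_assoc, hze]

lemma bijective_prod_pi {z : A} (φ₀ : A →ₐ[k] B)
    (φ : (ZMod p)ˣ → A →ₐ[k] Matrix (ZMod p) (ZMod p) k) (hφ₀z : φ₀ z = 0)
    (hφz : ∀ c : (ZMod p)ˣ, φ c z = algebraMap k _ (ZMod.castHom dvd_rfl k (c : ZMod p)))
    (h₀ : ∃ T : B →ₗ[k] A,
      (∀ b, φ₀ (T b) = b) ∧ ∀ a, T (φ₀ a) = a * aeval z (primeFieldDelta p k 0))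
    (h : ∀ c : (ZMod p)ˣ, ∃ T : Matrix (ZMod p) (ZMod p) k →ₗ[k] A,
      (∀ m, φ c (T m) = m) ∧ ∀ a, T (φ c a) = a * aeval z (primeFieldDelta p k (c : ZMod p))) :
    Function.Bijective (φ₀.prod (AlgHom.pi φ)) := by
  obtain ⟨T₀, hT₀, hT₀'⟩ := h₀
  choose T hT hT' using h
  constructor
  · rw [injective_iff_map_eq_zero]
    intro a ha
    have ha₀ : φ₀ a = 0 := congrArg Prod.fst ha
    have hac : ∀ c, φ c a = 0 := congrFun (congrArg Prod.snd ha)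
    have key : ∀ c : ZMod p, a * aeval z (primeFieldDelta p k c) = 0 := by
      intro c
      by_cases hc : c = 0
      · rw [hc, ← hT₀', ha₀, map_zero]
      · have := hT' (Units.mk0 c hc) a
        rw [hac, map_zero] at this
        exact this.symm
    rw [← mul_one a, ← map_one (aeval (R := k) z), ← sum_primeFieldDelta (p := p), map_sum,
      Finset.mul_sum, Finset.sum_eq_zero fun c _ => key c]
  · rintro ⟨b, m⟩
    refine ⟨aeval z (primeFieldDelta p k 0) * T₀ b +
      ∑ c : (ZMod p)ˣ, aeval z (primeFieldDelta p k (c : ZMod p)) * T c (m c), Prod.ext ?_ ?_⟩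
    · have e := map_aeval_primeFieldDelta φ₀ (z := z) (d := (0 : ZMod p)) (by simpa using hφ₀z)
      simp [e, hT₀]
    · funext d
      have e := map_aeval_primeFieldDelta (φ d) (hφz d)
      have hd : (0 : ZMod p) ≠ d := d.ne_zero.symm
      simp [e, hT, Units.val_inj, hd]

end Decomposition

/-- The algebra of type C14:
`k⟨x,y,z⟩/⟨[x,y] − y, [x,z], [y,z], x^p − x, y^p − z, z^p − z⟩` is isomorphic as a
`k`-algebra to the product of `B = k⟨x,y⟩/⟨[x,y] − y, x^p − x, y^p⟩` with `p − 1`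
copies of the matrix algebra `M_p(k)`. -/
theorem stmt10 (p : ℕ) (hp : p.Prime) (k : Type*) [Field k] [CharP k p] :
    Nonempty
      (RingQuot (relOf
          (({commutator' (FreeAlgebra.ι k (0 : Fin 3)) (FreeAlgebra.ι k 1) - FreeAlgebra.ι k 1,
             commutator' (FreeAlgebra.ι k (0 : Fin 3)) (FreeAlgebra.ι k 2),
             commutator' (FreeAlgebra.ι k (1 : Fin 3)) (FreeAlgebra.ι k 2),
             FreeAlgebra.ι k (0 : Fin 3) ^ p - FreeAlgebra.ι k 0,
             FreeAlgebra.ι k (1 : Fin 3) ^ p - FreeAlgebra.ι k 2,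
             FreeAlgebra.ι k (2 : Fin 3) ^ p - FreeAlgebra.ι k 2} :
            Set (FreeAlgebra k (Fin 3))))) ≃ₐ[k]
        (RingQuot (relOf
            (({commutator' (FreeAlgebra.ι k (0 : Fin 2)) (FreeAlgebra.ι k 1) -
                 FreeAlgebra.ι k 1,
               FreeAlgebra.ι k (0 : Fin 2) ^ p - FreeAlgebra.ι k 0,
               FreeAlgebra.ι k (1 : Fin 2) ^ p} :
              Set (FreeAlgebra k (Fin 2))))) ×
          (Fin (p - 1) → Matrix (Fin p) (Fin p) k))) := by
  have : Fact p.Prime := ⟨hp⟩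
  set S : Set (FreeAlgebra k (Fin 3)) :=
    {commutator' (FreeAlgebra.ι k (0 : Fin 3)) (FreeAlgebra.ι k 1) - FreeAlgebra.ι k 1,
      commutator' (FreeAlgebra.ι k (0 : Fin 3)) (FreeAlgebra.ι k 2),
      commutator' (FreeAlgebra.ι k (1 : Fin 3)) (FreeAlgebra.ι k 2),
      FreeAlgebra.ι k (0 : Fin 3) ^ p - FreeAlgebra.ι k 0,
      FreeAlgebra.ι k (1 : Fin 3) ^ p - FreeAlgebra.ι k 2,
      FreeAlgebra.ι k (2 : Fin 3) ^ p - FreeAlgebra.ι k 2} with hS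
  set S' : Set (FreeAlgebra k (Fin 2)) :=
    {commutator' (FreeAlgebra.ι k (0 : Fin 2)) (FreeAlgebra.ι k 1) - FreeAlgebra.ι k 1,
      FreeAlgebra.ι k (0 : Fin 2) ^ p - FreeAlgebra.ι k 0,
      FreeAlgebra.ι k (1 : Fin 2) ^ p} with hS'
  have rel := fun s hs => lift_relGen_eq_zero (S := S) (s := s) hs
  simp only [hS, Set.mem_insert_iff, Set.mem_singleton_iff, forall_eq_or_imp, forall_eq, map_sub,
    map_mul, map_pow, FreeAlgebra.lift_ι_apply, commutator', sub_eq_zero] at rel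
  have rel' := fun s hs => lift_relGen_eq_zero (S := S') (s := s) hs
  simp only [hS', Set.mem_insert_iff, Set.mem_singleton_iff, forall_eq_or_imp, forall_eq, map_sub,
    map_mul, map_pow, FreeAlgebra.lift_ι_apply, commutator', sub_eq_zero] at rel'
  have hgen : Algebra.adjoin k {relGen S 0, relGen S 1, relGen S 2} = ⊤ := by
    rw [← adjoin_range_relGen S]
    congr 1
    ext a
    simp [Fin.exists_fin_succ, eq_comm]
  have hgen' : Algebra.adjoin k {relGen S' 0, relGen S' 1} = ⊤ := by
    rw [← adjoin_range_relGen S']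
    congr 1
    ext a
    simp [Fin.exists_fin_succ, eq_comm]
  obtain ⟨hxy, hxz, hyz, hx, hy, hz⟩ := rel
  obtain ⟨hXY, hX, hY⟩ := rel'
  obtain ⟨φ₀, hφ₀⟩ := exists_algHom_relGen S ![relGen S' 0, relGen S' 1, 0] (by
    simp [hS, commutator', hXY, hX, hY, hp.ne_zero])
  have hβ : ∃ β : RingQuot (relOf S') →ₐ[k] RingQuot (relOf S), ∀ i, β (relGen S' i) =
      ![relGen S 0, aeval (relGen S 2) (primeFieldDelta p k 0) * relGen S 1] i := by
    have hcomm : ∀ {t}, t * relGen S 2 = relGen S 2 * t →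
        Commute (aeval (relGen S 2) (primeFieldDelta p k 0)) t := fun h =>
      aeval_mul_of_mul_eq h.symm _
    have hze := mul_aeval_primeFieldDelta (k := k) hz 0
    rw [map_zero, zero_smul] at hze
    refine exists_algHom_relGen S' _ ?_
    set e := aeval (relGen S 2) (primeFieldDelta p k 0)
    have h₁ : relGen S 0 * (e * relGen S 1) - e * relGen S 1 * relGen S 0 = e * relGen S 1 := by
      rw [← mul_assoc, ← (hcomm hxz).eq, mul_assoc, mul_assoc, ← mul_sub, hxy]
    have h₂ : (e * relGen S 1) ^ p = 0 := by
      rw [(hcomm hyz).mul_pow, hy, ← Nat.sub_add_cancel hp.pos, pow_succ, mul_assoc,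
        (hcomm rfl).eq, hze, mul_zero]
    simp [hS', commutator', h₁, h₂, hx]
  obtain ⟨β, hβ⟩ := hβ
  have hφ : ∀ c : (ZMod p)ˣ, ∃ φ : RingQuot (relOf S) →ₐ[k] Matrix (ZMod p) (ZMod p) k,
      ∀ i, φ (relGen S i) = ![clockMatrix p k, ZMod.castHom dvd_rfl k (c : ZMod p) • shiftMatrix p k,
        algebraMap k _ (ZMod.castHom dvd_rfl k (c : ZMod p))] i := by
    intro c
    refine exists_algHom_relGen S _ ?_
    set r := ZMod.castHom dvd_rfl k (c : ZMod p) with hr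
    have hrp : r ^ p = r := castHom_pow_card _
    have h₁ : clockMatrix p k * r • shiftMatrix p k - r • shiftMatrix p k * clockMatrix p k =
        r • shiftMatrix p k := by
      rw [mul_smul_comm, smul_mul_assoc, ← smul_sub, clockMatrix_mul_shiftMatrix_sub]
    have h₂ : (r • shiftMatrix p k) ^ p = algebraMap k _ r := by
      rw [_root_.smul_pow, shiftMatrix_pow_card, hrp, Algebra.algebraMap_eq_smul_one]
    have h₃ : (algebraMap k (Matrix (ZMod p) (ZMod p) k) r) ^ p = algebraMap k _ r := by
      rw [← map_pow, hrp]
    have h₄ := fun m : Matrix (ZMod p) (ZMod p) k => Algebra.commutes r m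
    simp only [hS, commutator', Set.mem_insert_iff, Set.mem_singleton_iff, forall_eq_or_imp,
      forall_eq, map_sub, map_mul, map_pow, FreeAlgebra.lift_ι_apply, Matrix.cons_val, h₁, h₂, h₃,
      h₄, clockMatrix_pow_card, sub_self, and_self]
  choose φ hφ using hφ
  have hbij := bijective_prod_pi φ₀ φ (hφ₀ 2) (fun c => hφ c 2)
    (exists_ofNilpotentBlock hxz.symm hyz.symm hz hgen hgen' φ₀ (hφ₀ 0) (hφ₀ 1) (hφ₀ 2) β (hβ 0)
      (hβ 1))
    (fun c => exists_ofMatrix hxy hxz.symm hyz.symm hx hy hz hgen c.ne_zero (φ c) (hφ c 0) (hφ c 1)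
      (hφ c 2))
  have eU : (ZMod p)ˣ ≃ Fin (p - 1) := Fintype.equivFinOfCardEq (ZMod.card_units p)
  have eZ : ZMod p ≃ Fin p := Fintype.equivFinOfCardEq (ZMod.card p)
  exact ⟨(AlgEquiv.ofBijective _ hbij).trans (AlgEquiv.prodCongr AlgEquiv.refl
    ((AlgEquiv.piCongrRight fun _ => Matrix.reindexAlgEquiv k k eZ).trans
      (AlgEquiv.piCongrLeft k (fun _ => Matrix (Fin p) (Fin p) k) eU)))⟩
end
end

section
/- Let p be a prime, k a field of characteristic p, and let Λ = k⟨x,y,z⟩/⟨[x,y] − y, [x,z], [y,z] − y·f(x), x^p − x, y^p, z^p − z⟩ where f(x) = Σ_{i=1}^{p−1} (−1)^{i−1}(p−i)^{−1} x^i (with (p−i)^{−1} the inverse of p−i in the prime field of k). Then the two-sided ideal ⟨y⟩ generated by the image of y satisfies ⟨y⟩^p = 0, the quotient Λ/⟨y⟩ is isomorphic as a k-algebra to the product k^{p^2}, and ⟨y⟩ equals the Jacobson radical of Λ. -/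
noncomputable section

/-- `f(x) = Σ_{i=1}^{p−1} (−1)^{i−1} (p−i)^{−1} x^i` as an element of the free
algebra `k⟨x,y,z⟩` (the inverse of `p − i` being taken in `k`, equivalently in the
prime field of `k`). -/
def B2f (p : ℕ) (k : Type*) [Field k] : FreeAlgebra k (Fin 3) :=
  ∑ i ∈ Finset.Icc 1 (p - 1),
    ((-1 : k) ^ (i - 1) * (((p - i : ℕ) : k))⁻¹) • (FreeAlgebra.ι k (0 : Fin 3)) ^ i

/-- The defining relations of the algebra of type B2:
`[x,y] − y, [x,z], [y,z] − y·f(x), x^p − x, y^p, z^p − z`. -/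
def B2rels (p : ℕ) (k : Type*) [Field k] : Set (FreeAlgebra k (Fin 3)) :=
  {commutator' (FreeAlgebra.ι k (0 : Fin 3)) (FreeAlgebra.ι k 1) - FreeAlgebra.ι k 1,
   commutator' (FreeAlgebra.ι k (0 : Fin 3)) (FreeAlgebra.ι k 2),
   commutator' (FreeAlgebra.ι k (1 : Fin 3)) (FreeAlgebra.ι k 2) -
     FreeAlgebra.ι k 1 * B2f p k,
   FreeAlgebra.ι k (0 : Fin 3) ^ p - FreeAlgebra.ι k 0,
   FreeAlgebra.ι k (1 : Fin 3) ^ p,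
   FreeAlgebra.ι k (2 : Fin 3) ^ p - FreeAlgebra.ι k 2}

/-- The algebra of type B2. -/
def B2alg (p : ℕ) (k : Type*) [Field k] : Type _ := RingQuot (relOf (B2rels p k))

instance (p : ℕ) (k : Type*) [Field k] : Ring (B2alg p k) :=
  inferInstanceAs (Ring (RingQuot (relOf (B2rels p k))))

instance (p : ℕ) (k : Type*) [Field k] : Algebra k (B2alg p k) :=
  inferInstanceAs (Algebra k (RingQuot (relOf (B2rels p k))))

namespace B2

open Polynomial

/-! ### Idempotents attached to an element with `t ^ p = t` -/

section Idempotent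

variable (p : ℕ) [Fact p.Prime] (k : Type*) [Field k] [CharP k p]

/-- The inclusion of the prime field into `k`. -/
def node : ZMod p →+* k := ZMod.castHom dvd_rfl k

/-- The Lagrange basis polynomial at `u` with nodes the elements of the prime field. -/
def idemPoly (u : ZMod p) : k[X] := Lagrange.basis Finset.univ (node p k) u

lemma node_pow (u : ZMod p) : node p k u ^ p = node p k u := by
  rw [← map_pow, ZMod.pow_card]

lemma nodal_univ_node : Lagrange.nodal Finset.univ (node p k) = X ^ p - X := by
  have hp : 1 < p := (Fact.out : p.Prime).one_lt
  refine eq_of_degree_sub_lt_of_eval_index_eq Finset.univ (node p k).injective.injOn ?_ ?_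
  · have hd : (X ^ p - X : k[X]).degree = p := by
      rw [degree_eq_natDegree (FiniteField.X_pow_card_sub_X_ne_zero k hp),
        FiniteField.X_pow_card_sub_X_natDegree_eq k hp]
    have hn : (Lagrange.nodal Finset.univ (node p k)).degree = p := by
      rw [Lagrange.degree_nodal, Finset.card_univ, ZMod.card]
    have hm : (X ^ p - X : k[X]).leadingCoeff = 1 := by
      refine (monic_X_pow_sub ?_).leadingCoeff
      rw [degree_X]; exact_mod_cast hp
    rw [Finset.card_univ, ZMod.card, ← hn]
    refine degree_sub_lt_left (hn.trans hd.symm) Lagrange.nodal_ne_zero ?_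
    rw [hm, Lagrange.nodal_monic.leadingCoeff]
  · intro u _
    rw [Lagrange.eval_nodal_at_node (Finset.mem_univ u)]
    simp [node_pow]

lemma sum_idemPoly : ∑ u, idemPoly p k u = 1 :=
  Lagrange.sum_basis (node p k).injective.injOn Finset.univ_nonempty

lemma X_sub_C_mul_idemPoly (u : ZMod p) :
    (X - C (node p k u)) * idemPoly p k u =
      C (Lagrange.nodalWeight Finset.univ (node p k) u) * (X ^ p - X) := by
  rw [idemPoly, Lagrange.basis_eq_prod_sub_inv_mul_nodal_div (Finset.mem_univ u),
    ← Lagrange.nodal_erase_eq_nodal_div (Finset.mem_univ u), ← nodal_univ_node,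
    Lagrange.nodal_eq_mul_nodal_erase (Finset.mem_univ u)]
  ring

lemma eval_idemPoly (u v : ZMod p) :
    (idemPoly p k u).eval (node p k v) = if u = v then 1 else 0 := by
  split_ifs with h
  · rw [← h]
    exact Lagrange.eval_basis_self (node p k).injective.injOn (Finset.mem_univ u)
  · exact Lagrange.eval_basis_of_ne h (Finset.mem_univ v)

variable {p k} {A : Type*} [Ring A] [Algebra k A]

lemma mul_aeval_idemPoly {t : A} (ht : t ^ p = t) (u : ZMod p) :
    t * aeval t (idemPoly p k u) = node p k u • aeval t (idemPoly p k u) := by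
  have h := congrArg (aeval t) (X_sub_C_mul_idemPoly p k u)
  simp only [map_mul, map_sub, map_pow, aeval_X, aeval_C, ht, sub_self, mul_zero, sub_mul] at h
  rw [Algebra.smul_def, ← sub_eq_zero, h]

end Idempotent

variable (p : ℕ) (k : Type*) [Field k]

/-- The images in `B2alg p k` of the generators `x, y, z` of the free algebra. -/
def gen (i : Fin 3) : B2alg p k := RingQuot.mkAlgHom k (relOf (B2rels p k)) (FreeAlgebra.ι k i)

/-- The quotient map from the free algebra. -/
def proj : FreeAlgebra k (Fin 3) →ₐ[k] B2alg p k := RingQuot.mkAlgHom k (relOf (B2rels p k))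

lemma proj_surjective : Function.Surjective (proj p k) :=
  RingQuot.mkAlgHom_surjective k _

lemma proj_ι (i : Fin 3) : proj p k (FreeAlgebra.ι k i) = gen p k i := rfl

variable {p k}

lemma proj_eq_zero {a : FreeAlgebra k (Fin 3)} (ha : a ∈ B2rels p k) : proj p k a = 0 :=
  (RingQuot.mkAlgHom_rel k (s := relOf (B2rels p k)) ⟨ha, rfl⟩).trans (map_zero (proj p k))

lemma gen_induction {P : B2alg p k → Prop} (algebraMap : ∀ r, P (algebraMap k _ r))
    (gen : ∀ i, P (gen p k i)) (mul : ∀ a b, P a → P b → P (a * b))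
    (add : ∀ a b, P a → P b → P (a + b)) (a : B2alg p k) : P a := by
  obtain ⟨a, rfl⟩ := proj_surjective p k a
  induction a with
  | grade0 r => simpa using algebraMap r
  | grade1 i => exact gen i
  | mul a b ha hb => simpa using mul _ _ ha hb
  | add a b ha hb => simpa using add _ _ ha hb

lemma x_mul_y : gen p k 0 * gen p k 1 = gen p k 1 * (gen p k 0 + 1) := by
  have h := proj_eq_zero (p := p) (k := k) (.inl rfl)
  simp only [commutator', map_sub, map_mul, proj_ι] at h
  rw [sub_sub, sub_eq_zero] at h
  rw [h, mul_add, mul_one]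

lemma x_mul_z : gen p k 0 * gen p k 2 = gen p k 2 * gen p k 0 := by
  have h := proj_eq_zero (p := p) (k := k) (.inr (.inl rfl))
  simpa only [commutator', map_sub, map_mul, proj_ι, sub_eq_zero] using h

lemma z_mul_y : gen p k 2 * gen p k 1 = gen p k 1 * (gen p k 2 - proj p k (B2f p k)) := by
  have h := proj_eq_zero (p := p) (k := k) (.inr (.inr (.inl rfl)))
  simp only [commutator', map_sub, map_mul, proj_ι] at h
  rw [mul_sub, eq_comm, sub_eq_iff_eq_add', ← sub_eq_iff_eq_add, ← sub_eq_zero, h]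

lemma x_pow : gen p k 0 ^ p = gen p k 0 := by
  have h := proj_eq_zero (p := p) (k := k) (.inr (.inr (.inr (.inl rfl))))
  simpa only [map_sub, map_pow, proj_ι, sub_eq_zero] using h

lemma y_pow : gen p k 1 ^ p = 0 := by
  have h := proj_eq_zero (p := p) (k := k) (.inr (.inr (.inr (.inr (.inl rfl)))))
  simpa only [map_pow, proj_ι] using h

lemma z_pow : gen p k 2 ^ p = gen p k 2 := by
  have h := proj_eq_zero (p := p) (k := k) (.inr (.inr (.inr (.inr (.inr rfl)))))
  simpa only [map_sub, map_pow, proj_ι, sub_eq_zero] using h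

/-! ### The ideal generated by `y` -/

lemma mul_y_mem (a : B2alg p k) : ∃ b, a * gen p k 1 = gen p k 1 * b := by
  induction a using gen_induction with
  | algebraMap r => exact ⟨_, Algebra.commutes r _⟩
  | gen i =>
    fin_cases i
    · exact ⟨_, x_mul_y⟩
    · exact ⟨_, rfl⟩
    · exact ⟨_, z_mul_y⟩
  | mul a b ha hb =>
    obtain ⟨a', ha⟩ := ha
    obtain ⟨b', hb⟩ := hb
    exact ⟨a' * b', by rw [mul_assoc, hb, ← mul_assoc, ha, mul_assoc]⟩
  | add a b ha hb =>
    obtain ⟨a', ha⟩ := ha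
    obtain ⟨b', hb⟩ := hb
    exact ⟨a' + b', by rw [add_mul, ha, hb, mul_add]⟩

lemma mul_y_pow_mem (a : B2alg p k) (n : ℕ) : ∃ b, a * gen p k 1 ^ n = gen p k 1 ^ n * b := by
  induction n with
  | zero => exact ⟨a, by simp⟩
  | succ n ih =>
    obtain ⟨b, hb⟩ := ih
    obtain ⟨c, hc⟩ := mul_y_mem b
    exact ⟨c, by rw [pow_succ, ← mul_assoc, hb, mul_assoc, hc, mul_assoc]⟩

variable (p k) in
/-- The ideal `⟨y⟩`. -/
abbrev yIdeal : TwoSidedIdeal (B2alg p k) := TwoSidedIdeal.span {gen p k 1}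

lemma y_mem : gen p k 1 ∈ yIdeal p k := TwoSidedIdeal.subset_span rfl

lemma mem_yIdeal_iff {a : B2alg p k} : a ∈ yIdeal p k ↔ ∃ b, a = gen p k 1 * b := by
  constructor
  · intro ha
    let I : TwoSidedIdeal (B2alg p k) := .mk' {a | ∃ b, a = gen p k 1 * b}
      ⟨0, by simp⟩
      (by rintro _ _ ⟨a, rfl⟩ ⟨b, rfl⟩; exact ⟨a + b, (mul_add _ _ _).symm⟩)
      (by rintro _ ⟨a, rfl⟩; exact ⟨-a, (mul_neg _ _).symm⟩)
      (by
        rintro c _ ⟨a, rfl⟩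
        obtain ⟨b, hb⟩ := mul_y_mem c
        exact ⟨b * a, by rw [← mul_assoc, hb, mul_assoc]⟩)
      (by rintro _ c ⟨a, rfl⟩; exact ⟨a * c, mul_assoc _ _ _⟩)
    have hI : yIdeal p k ≤ I := TwoSidedIdeal.span_le.2 <| by
      rintro _ rfl
      exact (TwoSidedIdeal.mem_mk' _ _ _ _ _ _ _).2 ⟨1, (mul_one _).symm⟩
    simpa [I, TwoSidedIdeal.mem_mk'] using hI ha
  · rintro ⟨b, rfl⟩
    exact TwoSidedIdeal.mul_mem_right _ _ _ y_mem

lemma prod_mem_y_pow (l : List (B2alg p k)) (hl : ∀ a ∈ l, a ∈ yIdeal p k) :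
    ∃ b, l.prod = gen p k 1 ^ l.length * b := by
  induction l with
  | nil => exact ⟨1, by simp⟩
  | cons a l ih =>
    obtain ⟨b, hb⟩ := ih fun a ha => hl a (List.mem_cons_of_mem _ ha)
    obtain ⟨c, rfl⟩ := mem_yIdeal_iff.1 (hl a List.mem_cons_self)
    obtain ⟨d, hd⟩ := mul_y_pow_mem c l.length
    refine ⟨d * b, ?_⟩
    rw [List.prod_cons, hb, List.length_cons, pow_succ', mul_assoc, ← mul_assoc c, hd]
    simp only [mul_assoc]

lemma prod_eq_zero (f : Fin p → B2alg p k) (hf : ∀ m, f m ∈ yIdeal p k) :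
    (List.ofFn f).prod = 0 := by
  obtain ⟨b, hb⟩ := prod_mem_y_pow (List.ofFn f) (by simpa [List.mem_ofFn] using hf)
  rw [hb, List.length_ofFn, y_pow, zero_mul]

lemma isNilpotent_of_mem {a : B2alg p k} (ha : a ∈ yIdeal p k) : IsNilpotent a :=
  ⟨p, by simpa [List.ofFn_const] using prod_eq_zero (fun _ => a) fun _ => ha⟩

/-! ### The quotient by `⟨y⟩` -/

section Quotient

variable [Fact p.Prime] [CharP k p] {ι : Type*} (e : ι → ZMod p × ZMod p)

/-- The values of `x`, `y`, `z` under the characters of the algebra indexed by `ι`. -/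
def genVal : Fin 3 → ι → k :=
  ![fun i => node p k (e i).1, 0, fun i => node p k (e i).2]

lemma lift_genVal_eq_zero {a : FreeAlgebra k (Fin 3)} (ha : a ∈ B2rels p k) :
    FreeAlgebra.lift k (genVal (k := k) e) a = 0 := by
  have hp : p ≠ 0 := (Fact.out : p.Prime).ne_zero
  rcases ha with rfl | rfl | rfl | rfl | rfl | rfl <;> ext i <;>
    simp [commutator', genVal, node_pow, mul_comm, hp]

/-- The product of the characters of the algebra indexed by `ι`. -/
def character : B2alg p k →ₐ[k] (ι → k) :=
  RingQuot.liftAlgHom k ⟨FreeAlgebra.lift k (genVal e), fun _ _ h => by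
    rw [lift_genVal_eq_zero e h.1, h.2, map_zero]⟩

lemma character_gen (j : Fin 3) : character (k := k) e (gen p k j) = genVal e j :=
  (RingQuot.liftAlgHom_mkAlgHom_apply k _ _ _).trans (FreeAlgebra.lift_ι_apply _ _)

/-- The element of the algebra that induces the idempotent at `u` of the quotient by `⟨y⟩`. -/
def idem (u : ZMod p × ZMod p) : B2alg p k :=
  aeval (gen p k 0) (idemPoly p k u.1) * aeval (gen p k 2) (idemPoly p k u.2)

lemma sum_idem : ∑ u, idem (k := k) (p := p) u = 1 := by
  simp only [idem, Fintype.sum_prod_type, ← Finset.mul_sum, ← map_sum,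
    sum_idemPoly, map_one, mul_one]

lemma character_idem (u : ZMod p × ZMod p) (i : ι) :
    character (k := k) e (idem u) i = if u = e i then 1 else 0 := by
  have h (t : ι → k) (q : k[X]) : aeval t q i = q.eval (t i) := by
    rw [← coe_aeval_eq_eval]
    exact (aeval_algHom_apply (Pi.evalAlgHom k (fun _ => k) i) t q).symm
  rw [idem, map_mul, ← aeval_algHom_apply, ← aeval_algHom_apply, Pi.mul_apply, h, h,
    character_gen, character_gen]
  simp [genVal, eval_idemPoly, Prod.ext_iff, ← ite_and, and_comm]

lemma mul_idem_sub_mem (i : ι) (a : B2alg p k) :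
    a * idem (e i) - character e a i • idem (e i) ∈ yIdeal p k := by
  induction a using gen_induction with
  | algebraMap r => simp [Algebra.smul_def, zero_mem]
  | gen j =>
    rw [character_gen]
    fin_cases j
    · simp [genVal, idem, ← mul_assoc, mul_aeval_idemPoly x_pow, zero_mem]
    · simpa [genVal] using TwoSidedIdeal.mul_mem_right _ _ _ y_mem
    · have hc : Commute (gen p k 2) (aeval (gen p k 0) (idemPoly p k (e i).1)) :=
        (Algebra.commute_of_mem_adjoin_singleton_of_commute
          (aeval_mem_adjoin_singleton k _) x_mul_z.symm)
      have h : gen p k 2 * idem (e i) = genVal (k := k) e 2 i • idem (e i) := by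
        rw [idem, ← mul_assoc, hc.eq, mul_assoc, mul_aeval_idemPoly z_pow, mul_smul_comm]
        rfl
      exact (sub_eq_zero.2 h).symm ▸ zero_mem _
  | mul a b ha hb =>
    have h : a * b * idem (e i) - character e (a * b) i • idem (e i) =
        a * (b * idem (e i) - character e b i • idem (e i)) +
          algebraMap k _ (character e b i) * (a * idem (e i) - character e a i • idem (e i)) := by
      simp only [map_mul, Pi.mul_apply, mul_sub, ← Algebra.smul_def, smul_smul, mul_assoc,
        mul_smul_comm, mul_comm (character e a i)]
      abel
    rw [h]
    exact add_mem (TwoSidedIdeal.mul_mem_left _ _ _ hb) (TwoSidedIdeal.mul_mem_left _ _ _ ha)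
  | add a b ha hb =>
    simpa only [map_add, Pi.add_apply, add_mul, add_smul, add_sub_add_comm] using add_mem ha hb

lemma character_eq_zero_of_mem {a : B2alg p k} (ha : a ∈ yIdeal p k) :
    character (k := k) e a = 0 := by
  obtain ⟨b, rfl⟩ := mem_yIdeal_iff.1 ha
  simp [character_gen, genVal]

lemma character_eq_zero_iff (he : Function.Surjective e) (a : B2alg p k) :
    character (k := k) e a = 0 ↔ a ∈ yIdeal p k := by
  refine ⟨fun h => ?_, character_eq_zero_of_mem e⟩
  rw [← mul_one a, ← sum_idem, Finset.mul_sum]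
  refine sum_mem fun u _ => ?_
  obtain ⟨i, rfl⟩ := he u
  simpa [h] using mul_idem_sub_mem e i a

lemma character_surjective [Fintype ι] (he : Function.Injective e) :
    Function.Surjective (character (k := k) e) := by
  classical
  intro g
  refine ⟨∑ i, g i • idem (e i), ?_⟩
  ext j
  simp [Finset.sum_apply, character_idem, he.eq_iff]

lemma yIdeal_eq_jacobson : yIdeal p k = TwoSidedIdeal.jacobson ⊥ := by
  ext a
  rw [TwoSidedIdeal.mem_jacobson_iff]
  constructor
  · intro ha b
    obtain ⟨u, hu⟩ := (isNilpotent_of_mem (TwoSidedIdeal.mul_mem_left _ b _ ha)).isUnit_add_one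
    refine ⟨↑u⁻¹, (TwoSidedIdeal.mem_bot _).2 ?_⟩
    rw [mul_assoc, ← mul_add_one, ← hu, Units.inv_mul, sub_self]
  · intro ha
    rw [← character_eq_zero_iff id Function.surjective_id]
    ext i
    by_contra hc
    obtain ⟨c, hac⟩ := ha (algebraMap k _ (-(character id a i)⁻¹))
    have h := congrFun (congrArg (character id) ((TwoSidedIdeal.mem_bot _).1 hac)) i
    simp only [map_sub, map_add, map_mul, map_one, map_zero, AlgHom.commutes, Pi.sub_apply,
      Pi.add_apply, Pi.mul_apply, Pi.one_apply, Pi.zero_apply, Pi.algebraMap_apply,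
      Algebra.algebraMap_self, RingHom.id_apply] at h
    rw [mul_assoc, neg_mul, inv_mul_cancel₀ hc] at h
    simp at h

end Quotient

end B2

/-- In the algebra `Λ` of type B2, the two-sided ideal `⟨y⟩` generated by the image
of `y` satisfies `⟨y⟩^p = 0`, the quotient `Λ/⟨y⟩` is isomorphic as a `k`-algebra to
`k^(p^2)`, and `⟨y⟩` is the Jacobson radical of `Λ`. -/
theorem stmt11 (p : ℕ) (hp : p.Prime) (k : Type*) [Field k] [CharP k p] :
    (∀ f : Fin p → B2alg p k,
      (∀ m, f m ∈ TwoSidedIdeal.span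
        {RingQuot.mkAlgHom k (relOf (B2rels p k)) (FreeAlgebra.ι k 1)}) →
      (List.ofFn f).prod = 0) ∧
    (∃ π : B2alg p k →ₐ[k] (Fin (p ^ 2) → k),
      Function.Surjective π ∧
      ∀ a : B2alg p k,
        π a = 0 ↔ a ∈ TwoSidedIdeal.span
          {RingQuot.mkAlgHom k (relOf (B2rels p k)) (FreeAlgebra.ι k 1)}) ∧
    TwoSidedIdeal.span
        {RingQuot.mkAlgHom k (relOf (B2rels p k)) (FreeAlgebra.ι k 1)} =
      TwoSidedIdeal.jacobson (⊥ : TwoSidedIdeal (B2alg p k)) := by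
  have : Fact p.Prime := ⟨hp⟩
  have e : Fin (p ^ 2) ≃ ZMod p × ZMod p :=
    Fintype.equivOfCardEq (by simp [ZMod.card, sq])
  exact ⟨B2.prod_eq_zero, ⟨B2.character e, B2.character_surjective e e.injective,
    B2.character_eq_zero_iff e e.surjective⟩, B2.yIdeal_eq_jacobson⟩
end
end

section
/- Let p be a prime and define f : Z/pZ → Z/pZ by f(i) = Σ_{m=1}^{p−1} (−1)^{m−1}(p−m)^{−1} i^m, where inverses are taken in Z/pZ. Let σ : Z/pZ × Z/pZ → Z/pZ × Z/pZ be the map σ(i,j) = (i+1, j − f(i)). Then the forward orbit of (0,0) under iteration of σ is all of Z/pZ × Z/pZ; in particular σ is a permutation consisting of a single cycle of length p^2, and for every k ≥ 0 the (kp)-th iterate of σ applied to (0,0) equals (0,−k). -/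
section SkewTranslation

variable {p : ℕ}

lemma skew_iterate (g : ZMod p → ZMod p) (a b : ZMod p) (n : ℕ) :
    (fun w : ZMod p × ZMod p => (w.1 + 1, w.2 - g w.1))^[n] (a, b) =
      (a + n, b - ∑ t ∈ Finset.range n, g (a + t)) := by
  induction n with
  | zero => simp
  | succ n ih =>
    rw [Function.iterate_succ_apply', ih, Finset.sum_range_succ]
    ext
    · push_cast; ring
    · simp only; ring

lemma skew_bijective (g : ZMod p → ZMod p) :
    Function.Bijective (fun w : ZMod p × ZMod p => (w.1 + 1, w.2 - g w.1)) :=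
  Function.bijective_iff_has_inverse.mpr
    ⟨fun w => (w.1 - 1, w.2 + g (w.1 - 1)), fun w => by simp, fun w => by simp⟩

lemma ZMod.sum_range_natCast [NeZero p] (g : ZMod p → ZMod p) :
    ∑ t ∈ Finset.range p, g t = ∑ x : ZMod p, g x :=
  Finset.sum_nbij' (fun t => (t : ZMod p)) ZMod.val (by simp)
    (fun x _ => Finset.mem_range.mpr x.val_lt)
    (fun t ht => ZMod.val_natCast_of_lt (Finset.mem_range.mp ht))
    (by simp) (by simp)

lemma skew_iterate_mul [NeZero p] (g : ZMod p → ZMod p) (hg : ∑ x, g x = 1) (k : ℕ) :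
    (fun w : ZMod p × ZMod p => (w.1 + 1, w.2 - g w.1))^[k * p] (0, 0) =
      (0, -(k : ZMod p)) := by
  induction k with
  | zero => simp
  | succ k ih =>
    rw [Nat.succ_mul, Nat.add_comm, Function.iterate_add_apply, ih, skew_iterate]
    simp only [zero_add, ZMod.sum_range_natCast, hg, CharP.cast_eq_zero]
    ext
    · rfl
    · push_cast; ring

lemma skew_orbit [NeZero p] (g : ZMod p → ZMod p) (hg : ∑ x, g x = 1)
    (v : ZMod p × ZMod p) :
    ∃ n : ℕ, (fun w : ZMod p × ZMod p => (w.1 + 1, w.2 - g w.1))^[n] (0, 0) = v := by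
  obtain ⟨a, b⟩ := v
  refine ⟨a.val + (-b - ∑ t ∈ Finset.range a.val, g t).val * p, ?_⟩
  rw [Function.iterate_add_apply, skew_iterate_mul g hg, skew_iterate]
  simp

lemma sq_dvd_of_skew_iterate_eq_zero [NeZero p] (g : ZMod p → ZMod p) (hg : ∑ x, g x = 1)
    (n : ℕ)
    (h : (fun w : ZMod p × ZMod p => (w.1 + 1, w.2 - g w.1))^[n] (0, 0) = (0, 0)) :
    p ^ 2 ∣ n := by
  have hn : p ∣ n := by
    rw [skew_iterate, Prod.mk.injEq, zero_add] at h
    exact (ZMod.natCast_eq_zero_iff n p).mp h.1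
  obtain ⟨k, rfl⟩ := hn
  rw [mul_comm p k, skew_iterate_mul g hg, Prod.mk.injEq, neg_eq_zero] at h
  rw [sq]
  exact Nat.mul_dvd_mul_left p ((ZMod.natCast_eq_zero_iff k p).mp h.2)

end SkewTranslation

lemma ZMod.sum_pow_sub_one (p : ℕ) [Fact p.Prime] : ∑ x : ZMod p, x ^ (p - 1) = -1 := by
  have hp : p - 1 ≠ 0 := Nat.sub_ne_zero_of_lt (Fact.out : p.Prime).one_lt
  have h (x : ZMod p) : x ^ (p - 1) = 1 - if x = 0 then 1 else 0 := by
    split_ifs with hx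
    · simp [hx, hp]
    · simp [ZMod.pow_card_sub_one_eq_one hx]
  simp [h]

lemma ZMod.sum_truncated_log (p : ℕ) [Fact p.Prime] :
    ∑ x : ZMod p, ∑ m ∈ Finset.Icc 1 (p - 1),
      (-1 : ZMod p) ^ (m - 1) * (((p - m : ℕ) : ZMod p))⁻¹ * x ^ m = 1 := by
  have hp : 1 < p := (Fact.out : p.Prime).one_lt
  rw [Finset.sum_comm]
  simp_rw [← Finset.mul_sum]
  rw [Finset.sum_eq_single (p - 1)]
  · have h : (-1 : ZMod p) ^ (p - 1) = 1 := ZMod.pow_card_sub_one_eq_one (by simp)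
    rw [ZMod.sum_pow_sub_one, Nat.sub_sub_self hp.le, Nat.cast_one, inv_one, mul_one,
      ← pow_succ, Nat.sub_add_cancel (Nat.le_sub_one_of_lt hp), h]
  · intro m hm hne
    rw [FiniteField.sum_pow_lt_card_sub_one, mul_zero]
    rw [ZMod.card]
    exact lt_of_le_of_ne (Finset.mem_Icc.mp hm).2 hne
  · intro h
    exact absurd (Finset.mem_Icc.mpr ⟨Nat.le_sub_one_of_lt hp, le_rfl⟩) h


/-- Let `f : ZMod p → ZMod p`, `f i = Σ_{m=1}^{p−1} (−1)^{m−1} (p−m)^{−1} i^m`, and let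
`σ(i,j) = (i+1, j − f(i))` on `ZMod p × ZMod p`.  Then the forward orbit of `(0,0)`
under `σ` is all of `ZMod p × ZMod p`; in particular `σ` is a permutation consisting
of a single cycle of length `p^2`, and the `(kp)`-th iterate of `σ` at `(0,0)` is
`(0, −k)` for every `k ≥ 0`. -/
theorem stmt12 (p : ℕ) (hp : p.Prime) :
    (∀ v : ZMod p × ZMod p,
      ∃ n : ℕ,
        (fun w : ZMod p × ZMod p =>
            (w.1 + 1,
              w.2 - ∑ m ∈ Finset.Icc 1 (p - 1),
                (-1 : ZMod p) ^ (m - 1) * (((p - m : ℕ) : ZMod p))⁻¹ * w.1 ^ m))^[n]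
          (0, 0) = v) ∧
    Function.Bijective
      (fun w : ZMod p × ZMod p =>
        (w.1 + 1,
          w.2 - ∑ m ∈ Finset.Icc 1 (p - 1),
            (-1 : ZMod p) ^ (m - 1) * (((p - m : ℕ) : ZMod p))⁻¹ * w.1 ^ m)) ∧
    (∀ n : ℕ, 0 < n →
      ((fun w : ZMod p × ZMod p =>
          (w.1 + 1,
            w.2 - ∑ m ∈ Finset.Icc 1 (p - 1),
              (-1 : ZMod p) ^ (m - 1) * (((p - m : ℕ) : ZMod p))⁻¹ * w.1 ^ m))^[n]
        (0, 0) = (0, 0) → p ^ 2 ∣ n)) ∧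
    (∀ k : ℕ,
      (fun w : ZMod p × ZMod p =>
          (w.1 + 1,
            w.2 - ∑ m ∈ Finset.Icc 1 (p - 1),
              (-1 : ZMod p) ^ (m - 1) * (((p - m : ℕ) : ZMod p))⁻¹ * w.1 ^ m))^[k * p]
        (0, 0) = (0, -(k : ZMod p))) := by
  have : Fact p.Prime := ⟨hp⟩
  let g : ZMod p → ZMod p := fun x => ∑ m ∈ Finset.Icc 1 (p - 1),
    (-1 : ZMod p) ^ (m - 1) * (((p - m : ℕ) : ZMod p))⁻¹ * x ^ m
  have hg : ∑ x, g x = 1 := ZMod.sum_truncated_log p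
  exact ⟨skew_orbit g hg, skew_bijective g,
    fun n _ => sq_dvd_of_skew_iterate_eq_zero g hg n, skew_iterate_mul g hg⟩
end

section
/- Let p be a prime, k a field of characteristic p, and let Λ = k⟨x,y,z⟩/⟨[x,y] − y, [x,z], [y,z], x^p − x, y^p, z^p⟩ (the algebra of types B1 and C11). Then the two-sided ideal ⟨y,z⟩ generated by the images of y and z is nilpotent, the quotient Λ/⟨y,z⟩ is isomorphic as a k-algebra to the product k^p, and ⟨y,z⟩ equals the Jacobson radical of Λ. -/
noncomputable section

/-- The defining relations of the algebra of types B1 and C11: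
`[x,y] − y, [x,z], [y,z], x^p − x, y^p, z^p`. -/
def B1rels (p : ℕ) (k : Type*) [Field k] : Set (FreeAlgebra k (Fin 3)) :=
  {commutator' (FreeAlgebra.ι k (0 : Fin 3)) (FreeAlgebra.ι k 1) - FreeAlgebra.ι k 1,
   commutator' (FreeAlgebra.ι k (0 : Fin 3)) (FreeAlgebra.ι k 2),
   commutator' (FreeAlgebra.ι k (1 : Fin 3)) (FreeAlgebra.ι k 2),
   FreeAlgebra.ι k (0 : Fin 3) ^ p - FreeAlgebra.ι k 0,
   FreeAlgebra.ι k (1 : Fin 3) ^ p,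
   FreeAlgebra.ι k (2 : Fin 3) ^ p}

/-- The algebra of types B1 and C11. -/
def B1alg (p : ℕ) (k : Type*) [Field k] : Type _ := RingQuot (relOf (B1rels p k))

instance (p : ℕ) (k : Type*) [Field k] : Ring (B1alg p k) :=
  inferInstanceAs (Ring (RingQuot (relOf (B1rels p k))))

instance (p : ℕ) (k : Type*) [Field k] : Algebra k (B1alg p k) :=
  inferInstanceAs (Algebra k (RingQuot (relOf (B1rels p k))))

open Algebra in
theorem exists_mul_eq_mul_of_adjoin_eq_top {k A : Type*} [Field k] [Ring A] [Algebra k A]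
    {S : Set A} (hS : adjoin k S = ⊤) {y : A} (h : ∀ s ∈ S, ∃ b, s * y = y * b) (a : A) :
    ∃ b, a * y = y * b := by
  have ha : a ∈ adjoin k S := hS ▸ mem_top
  induction ha using adjoin_induction with
  | mem x hx => exact h x hx
  | algebraMap r => exact ⟨algebraMap k A r, commutes r y⟩
  | add a b _ _ iha ihb =>
    obtain ⟨a', ha'⟩ := iha
    obtain ⟨b', hb'⟩ := ihb
    exact ⟨a' + b', by rw [add_mul, mul_add, ha', hb']⟩
  | mul a b _ _ iha ihb =>
    obtain ⟨a', ha'⟩ := iha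
    obtain ⟨b', hb'⟩ := ihb
    exact ⟨a' * b', by rw [mul_assoc, hb', ← mul_assoc, ha', mul_assoc]⟩

open Algebra in
theorem exists_mul_eq_mul_of_adjoin_eq_top' {k A : Type*} [Field k] [Ring A] [Algebra k A]
    {S : Set A} (hS : adjoin k S = ⊤) {y : A} (h : ∀ s ∈ S, ∃ b, y * s = b * y) (a : A) :
    ∃ b, y * a = b * y := by
  have ha : a ∈ adjoin k S := hS ▸ mem_top
  induction ha using adjoin_induction with
  | mem x hx => exact h x hx
  | algebraMap r => exact ⟨algebraMap k A r, (commutes r y).symm⟩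
  | add a b _ _ iha ihb =>
    obtain ⟨a', ha'⟩ := iha
    obtain ⟨b', hb'⟩ := ihb
    exact ⟨a' + b', by rw [add_mul, mul_add, ha', hb']⟩
  | mul a b _ _ iha ihb =>
    obtain ⟨a', ha'⟩ := iha
    obtain ⟨b', hb'⟩ := ihb
    exact ⟨a' * b', by rw [← mul_assoc, ha', mul_assoc, hb', mul_assoc]⟩

theorem Submodule.commute_top_span_singleton {k A : Type*} [Field k] [Ring A] [Algebra k A]
    {y : A} (hl : ∀ a, ∃ b, a * y = y * b) (hr : ∀ a, ∃ b, y * a = b * y) :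
    Commute (⊤ : Submodule k A) (Submodule.span k {y}) := by
  apply le_antisymm
  · rw [Submodule.mul_le]
    rintro a - _ hw
    obtain ⟨c, rfl⟩ := Submodule.mem_span_singleton.1 hw
    obtain ⟨b, hb⟩ := hl a
    rw [mul_smul_comm, hb, ← smul_mul_assoc]
    exact Submodule.mul_mem_mul (Submodule.smul_mem _ _ (Submodule.mem_span_singleton_self y))
      trivial
  · rw [Submodule.mul_le]
    rintro _ hw a -
    obtain ⟨c, rfl⟩ := Submodule.mem_span_singleton.1 hw
    obtain ⟨b, hb⟩ := hr a
    rw [smul_mul_assoc, hb, ← mul_smul_comm]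
    exact Submodule.mul_mem_mul trivial
      (Submodule.smul_mem _ _ (Submodule.mem_span_singleton_self y))

theorem Submodule.top_mul_span_singleton_pow_eq_zero {k A : Type*} [Field k] [Ring A] [Algebra k A]
    {y : A} {n : ℕ} (h : Commute (⊤ : Submodule k A) (Submodule.span k {y})) (hy : y ^ n = 0) :
    ((⊤ : Submodule k A) * Submodule.span k {y}) ^ n = 0 := by
  rw [h.mul_pow, Submodule.span_pow, Set.singleton_pow, hy, Submodule.span_zero_singleton,
    Submodule.mul_bot]
  rfl

/-- Two commuting nilpotent normal elements generate a nilpotent two-sided ideal. -/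
theorem TwoSidedIdeal.prod_ofFn_eq_zero_of_mem_span_pair (k : Type*) {A : Type*} [Field k] [Ring A]
    [Algebra k A] {y z : A} {m n : ℕ}
    (hyl : ∀ a, ∃ b, a * y = y * b) (hyr : ∀ a, ∃ b, y * a = b * y)
    (hzl : ∀ a, ∃ b, a * z = z * b) (hzr : ∀ a, ∃ b, z * a = b * z)
    (hyz : y * z = z * y) (hy : y ^ m = 0) (hz : z ^ n = 0)
    (f : Fin (m + n) → A) (hf : ∀ i, f i ∈ TwoSidedIdeal.span {y, z}) :
    (List.ofFn f).prod = 0 := by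
  have cy := Submodule.commute_top_span_singleton (k := k) hyl hyr
  have cz := Submodule.commute_top_span_singleton (k := k) hzl hzr
  have cyz : Commute (Submodule.span k {y}) (Submodule.span k {z}) := by
    rw [Commute, SemiconjBy, Submodule.span_mul_span, Submodule.span_mul_span,
      Set.singleton_mul_singleton, Set.singleton_mul_singleton, hyz]
  set T : Submodule k A := ⊤
  set M : Submodule k A := T * Submodule.span k {y} + T * Submodule.span k {z} with hM
  have hTT : T * T = T := by
    refine le_antisymm le_top fun a _ => ?_
    simpa using Submodule.mul_mem_mul (M := T) (N := T) (m := a) (n := 1) trivial trivial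
  have hTM : T * M = M := by rw [hM, mul_add, ← mul_assoc, ← mul_assoc, hTT]
  have hMT : M * T = M := by
    rw [hM, add_mul, mul_assoc, mul_assoc, ← cy.eq, ← cz.eq, ← mul_assoc, ← mul_assoc, hTT]
  have hpow : M ^ (m + n) = 0 := by
    have hc : Commute (T * Submodule.span k {y}) (T * Submodule.span k {z}) :=
      ((Commute.refl T).mul_right cz).mul_left (cy.symm.mul_right cyz)
    exact hc.add_pow_eq_zero_of_add_le_succ_of_pow_eq_zero
      (Submodule.top_mul_span_singleton_pow_eq_zero cy hy)
      (Submodule.top_mul_span_singleton_pow_eq_zero cz hz) (Nat.le_succ _)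
  have hgen (w : A) : w ∈ T * Submodule.span k {w} := by
    simpa using Submodule.mul_mem_mul (M := T) (m := 1) trivial
      (Submodule.mem_span_singleton_self (R := k) w)
  have hle {a : A} (ha : a ∈ TwoSidedIdeal.span {y, z}) : a ∈ M := by
    induction ha using TwoSidedIdeal.span_induction with
    | mem x hx =>
      rcases hx with rfl | rfl
      · exact Submodule.mem_sup_left (hgen _)
      · exact Submodule.mem_sup_right (hgen _)
    | zero => exact M.zero_mem
    | add _ _ _ _ h₁ h₂ => exact M.add_mem h₁ h₂
    | neg _ _ h => exact M.neg_mem h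
    | left_absorb a x _ h => exact hTM ▸ Submodule.mul_mem_mul (M := T) trivial h
    | right_absorb b x _ h => exact hMT ▸ Submodule.mul_mem_mul (N := T) h trivial
  have hprod : ∀ (l : List A), (∀ a ∈ l, a ∈ M) → l.prod ∈ M ^ l.length := by
    intro l
    induction l with
    | nil => intro _; simp [Submodule.one_le.1 le_rfl]
    | cons a l ih =>
      intro h
      rw [List.prod_cons, List.length_cons, pow_succ']
      exact Submodule.mul_mem_mul (h a (by simp)) (ih fun b hb => h b (by simp [hb]))
  have := hprod (List.ofFn f) (by
    intro a ha
    obtain ⟨i, rfl⟩ := (List.mem_ofFn' f a).1 ha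
    exact hle (hf i))
  rw [List.length_ofFn, hpow] at this
  simpa using this

/-- A two-sided ideal of nilpotent elements, with quotient a power of a field, is the
Jacobson radical. -/
theorem TwoSidedIdeal.eq_jacobson_bot_of_isNilpotent {k A ι : Type*} [Field k] [Ring A]
    [Algebra k A] {I : TwoSidedIdeal A} (hnil : ∀ a ∈ I, IsNilpotent a) (π : A →ₐ[k] (ι → k))
    (hker : ∀ a, π a = 0 ↔ a ∈ I) : I = TwoSidedIdeal.jacobson ⊥ := by
  ext a
  rw [TwoSidedIdeal.mem_jacobson_iff]
  refine ⟨fun ha y => ?_, fun h => (hker a).1 (funext fun i => ?_)⟩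
  · obtain ⟨u, hu⟩ := (hnil _ (I.mul_mem_left y a ha)).isUnit_add_one
    refine ⟨↑u⁻¹, ?_⟩
    rw [TwoSidedIdeal.mem_bot, mul_assoc, ← mul_add_one, ← hu, Units.inv_mul, sub_self]
  · by_contra hi
    change π a i ≠ 0 at hi
    obtain ⟨z, hz⟩ := h (algebraMap k A (-(π a i)⁻¹))
    rw [TwoSidedIdeal.mem_bot] at hz
    have := congrFun (congrArg π hz) i
    simp [mul_assoc, hi] at this

theorem Polynomial.surjective_aeval_of_injective {k ι : Type*} [Field k] [Finite ι] {v : ι → k}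
    (hv : Function.Injective v) :
    Function.Surjective (Polynomial.aeval v : Polynomial k →ₐ[k] (ι → k)) := by
  classical
  have := Fintype.ofFinite ι
  intro g
  refine ⟨Lagrange.interpolate Finset.univ v g, ?_⟩
  ext i
  rw [Polynomial.aeval_pi_apply₂, Polynomial.coe_aeval_eq_eval]
  exact Lagrange.eval_interpolate_at_node g hv.injOn (Finset.mem_univ i)

theorem CharP.injective_fin_natCast (k : Type*) [Field k] (p : ℕ) [CharP k p] :
    Function.Injective fun i : Fin p => ((i : ℕ) : k) := fun i j h =>
  Fin.ext (CharP.natCast_injOn_Iio k p i.2 j.2 h)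

theorem Polynomial.aeval_eq_zero_of_pow_eq_self {k A : Type*} [Field k] [Ring A] [Algebra k A]
    {p : ℕ} [Fact p.Prime] [CharP k p] {x : A} (hx : x ^ p = x) {f : Polynomial k}
    (hf : ∀ i : Fin p, f.eval ((i : ℕ) : k) = 0) : Polynomial.aeval x f = 0 := by
  have hp : 1 < p := (Fact.out : p.Prime).one_lt
  have hmonic : (Polynomial.X ^ p - Polynomial.X : Polynomial k).Monic :=
    Polynomial.monic_X_pow_sub (by simpa using hp)
  have hdeg : (Polynomial.X ^ p - Polynomial.X : Polynomial k).natDegree = p :=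
    FiniteField.X_pow_card_sub_X_natDegree_eq k hp
  have hdvd : f = (Polynomial.X ^ p - Polynomial.X) * (f /ₘ (Polynomial.X ^ p - Polynomial.X)) := by
    have hdecomp := Polynomial.modByMonic_add_div f (Polynomial.X ^ p - Polynomial.X)
    have hmod : f %ₘ (Polynomial.X ^ p - Polynomial.X) = 0 := by
      apply Polynomial.eq_zero_of_natDegree_lt_card_of_eval_eq_zero _
        (CharP.injective_fin_natCast k p)
      · intro i
        have hi := hf i
        have : ((i : ℕ) : k) ^ p = (i : ℕ) := map_natCast (frobenius k p) i
        rw [← hdecomp] at hi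
        simpa [this] using hi
      · rw [Fintype.card_fin]
        refine (Polynomial.natDegree_modByMonic_lt f hmonic fun h => ?_).trans_eq hdeg
        rw [h, Polynomial.natDegree_one] at hdeg
        omega
    rw [hmod, zero_add] at hdecomp
    exact hdecomp.symm
  rw [hdvd]
  simp [hx]

namespace B1alg

variable (p : ℕ) (k : Type*) [Field k]

/-- The images in `B1alg p k` of the free generators `x, y, z`. -/
def gen (i : Fin 3) : B1alg p k := RingQuot.mkAlgHom k (relOf (B1rels p k)) (FreeAlgebra.ι k i)

/-- The quotient map from the free algebra onto `B1alg p k`. -/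
def mk : FreeAlgebra k (Fin 3) →ₐ[k] B1alg p k := RingQuot.mkAlgHom k (relOf (B1rels p k))

theorem mk_surjective : Function.Surjective (mk p k) := RingQuot.mkAlgHom_surjective k _

@[simp]
theorem mk_ι (i : Fin 3) : mk p k (FreeAlgebra.ι k i) = gen p k i := rfl

variable {p k}

theorem mk_eq_zero {a : FreeAlgebra k (Fin 3)} (ha : a ∈ B1rels p k) : mk p k a = 0 :=
  (RingQuot.mkAlgHom_rel k (s := relOf (B1rels p k)) (x := a) (y := 0) ⟨ha, rfl⟩).trans
    (map_zero _)

theorem gen_zero_mul_gen_one : gen p k 0 * gen p k 1 = gen p k 1 * (gen p k 0 + 1) := by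
  have h := mk_eq_zero (p := p) (k := k) (Or.inl rfl)
  simp only [commutator', map_sub, map_mul, mk_ι] at h
  rw [mul_add, mul_one, ← sub_eq_zero, ← h]
  abel

theorem gen_zero_mul_gen_two : gen p k 0 * gen p k 2 = gen p k 2 * gen p k 0 := by
  have h := mk_eq_zero (p := p) (k := k) (Or.inr (Or.inl rfl))
  simpa only [commutator', map_sub, map_mul, mk_ι, sub_eq_zero] using h

theorem gen_one_mul_gen_two : gen p k 1 * gen p k 2 = gen p k 2 * gen p k 1 := by
  have h := mk_eq_zero (p := p) (k := k) (Or.inr (Or.inr (Or.inl rfl)))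
  simpa only [commutator', map_sub, map_mul, mk_ι, sub_eq_zero] using h

theorem gen_zero_pow : gen p k 0 ^ p = gen p k 0 := by
  have h := mk_eq_zero (p := p) (k := k) (Or.inr (Or.inr (Or.inr (Or.inl rfl))))
  simpa only [map_sub, map_pow, mk_ι, sub_eq_zero] using h

theorem gen_one_pow : gen p k 1 ^ p = 0 := by
  have h := mk_eq_zero (p := p) (k := k) (Or.inr (Or.inr (Or.inr (Or.inr (Or.inl rfl)))))
  simpa only [map_pow, mk_ι] using h

theorem gen_two_pow : gen p k 2 ^ p = 0 := by
  have h := mk_eq_zero (p := p) (k := k) (Or.inr (Or.inr (Or.inr (Or.inr (Or.inr rfl)))))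
  simpa only [map_pow, mk_ι] using h

variable (p k) in
theorem adjoin_range_gen : Algebra.adjoin k (Set.range (gen p k)) = ⊤ := by
  have : Set.range (gen p k) = mk p k '' Set.range (FreeAlgebra.ι k) := by
    rw [← Set.range_comp]
    rfl
  rw [this, ← AlgHom.map_adjoin, FreeAlgebra.adjoin_range_ι, Algebra.map_top,
    AlgHom.range_eq_top]
  exact mk_surjective p k

theorem exists_mul_gen_one (a : B1alg p k) : ∃ b, a * gen p k 1 = gen p k 1 * b := by
  refine exists_mul_eq_mul_of_adjoin_eq_top (adjoin_range_gen p k) ?_ a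
  rintro _ ⟨i, rfl⟩
  fin_cases i
  exacts [⟨_, gen_zero_mul_gen_one⟩, ⟨_, rfl⟩, ⟨_, gen_one_mul_gen_two.symm⟩]

theorem exists_gen_one_mul (a : B1alg p k) : ∃ b, gen p k 1 * a = b * gen p k 1 := by
  refine exists_mul_eq_mul_of_adjoin_eq_top' (adjoin_range_gen p k) ?_ a
  rintro _ ⟨i, rfl⟩
  fin_cases i
  · refine ⟨gen p k 0 - 1, ?_⟩
    change gen p k 1 * gen p k 0 = _
    rw [sub_mul, gen_zero_mul_gen_one, mul_add, mul_one, one_mul, add_sub_cancel_right]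
  exacts [⟨_, rfl⟩, ⟨_, gen_one_mul_gen_two⟩]

theorem exists_mul_gen_two (a : B1alg p k) : ∃ b, a * gen p k 2 = gen p k 2 * b := by
  refine exists_mul_eq_mul_of_adjoin_eq_top (adjoin_range_gen p k) ?_ a
  rintro _ ⟨i, rfl⟩
  fin_cases i
  exacts [⟨_, gen_zero_mul_gen_two⟩, ⟨_, gen_one_mul_gen_two⟩, ⟨_, rfl⟩]

theorem exists_gen_two_mul (a : B1alg p k) : ∃ b, gen p k 2 * a = b * gen p k 2 := by
  refine exists_mul_eq_mul_of_adjoin_eq_top' (adjoin_range_gen p k) ?_ a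
  rintro _ ⟨i, rfl⟩
  fin_cases i
  exacts [⟨_, gen_zero_mul_gen_two.symm⟩, ⟨_, gen_one_mul_gen_two.symm⟩, ⟨_, rfl⟩]

theorem prod_ofFn_eq_zero (f : Fin (p + p) → B1alg p k)
    (hf : ∀ i, f i ∈ TwoSidedIdeal.span {gen p k 1, gen p k 2}) : (List.ofFn f).prod = 0 :=
  TwoSidedIdeal.prod_ofFn_eq_zero_of_mem_span_pair k exists_mul_gen_one exists_gen_one_mul
    exists_mul_gen_two exists_gen_two_mul gen_one_mul_gen_two gen_one_pow gen_two_pow f hf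

theorem isNilpotent_of_mem_span {a : B1alg p k}
    (ha : a ∈ TwoSidedIdeal.span {gen p k 1, gen p k 2}) : IsNilpotent a :=
  ⟨p + p, by simpa using prod_ofFn_eq_zero (fun _ => a) fun _ => ha⟩

theorem exists_sub_aeval_mem_span (a : B1alg p k) : ∃ f : Polynomial k,
    a - Polynomial.aeval (gen p k 0) f ∈ TwoSidedIdeal.span {gen p k 1, gen p k 2} := by
  have ha : a ∈ Algebra.adjoin k (Set.range (gen p k)) := adjoin_range_gen p k ▸ Algebra.mem_top
  induction ha using Algebra.adjoin_induction with
  | mem x hx =>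
    obtain ⟨i, rfl⟩ := hx
    fin_cases i
    · exact ⟨Polynomial.X, by simp⟩
    · exact ⟨0, by rw [map_zero, sub_zero]; exact TwoSidedIdeal.subset_span (Or.inl rfl)⟩
    · exact ⟨0, by rw [map_zero, sub_zero]; exact TwoSidedIdeal.subset_span (Or.inr rfl)⟩
  | algebraMap r => exact ⟨Polynomial.C r, by simp⟩
  | add a b _ _ iha ihb =>
    obtain ⟨f, hf⟩ := iha
    obtain ⟨g, hg⟩ := ihb
    refine ⟨f + g, ?_⟩
    rw [map_add, add_sub_add_comm]
    exact add_mem hf hg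
  | mul a b _ _ iha ihb =>
    obtain ⟨f, hf⟩ := iha
    obtain ⟨g, hg⟩ := ihb
    refine ⟨f * g, ?_⟩
    have : a * b - Polynomial.aeval (gen p k 0) (f * g) =
        (a - Polynomial.aeval (gen p k 0) f) * b +
          Polynomial.aeval (gen p k 0) f * (b - Polynomial.aeval (gen p k 0) g) := by
      rw [map_mul]
      noncomm_ring
    rw [this]
    exact add_mem (TwoSidedIdeal.mul_mem_right _ _ _ hf) (TwoSidedIdeal.mul_mem_left _ _ _ hg)

variable (p k) in
/-- The values of the generators `x, y, z` under the projection of `B1alg p k` to `k^p`. -/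
def projGen : Fin 3 → Fin p → k := ![fun i => ((i : ℕ) : k), 0, 0]

variable [Fact p.Prime] [CharP k p]

theorem lift_projGen_eq_zero {a : FreeAlgebra k (Fin 3)} (ha : a ∈ B1rels p k) :
    FreeAlgebra.lift k (projGen p k) a = 0 := by
  have hp : p ≠ 0 := (Fact.out : p.Prime).ne_zero
  have hfrob : (fun i : Fin p => ((i : ℕ) : k)) ^ p = fun i : Fin p => ((i : ℕ) : k) :=
    funext fun i => map_natCast (frobenius k p) i
  rcases ha with rfl | rfl | rfl | rfl | rfl | rfl <;>
    simp [commutator', projGen, hp, hfrob]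

variable (p k) in
/-- The projection of `B1alg p k` to `k^p` sending `x` to `(0, 1, …, p - 1)` and killing
`y` and `z`. -/
def proj : B1alg p k →ₐ[k] (Fin p → k) :=
  RingQuot.liftAlgHom k ⟨FreeAlgebra.lift k (projGen p k), by
    rintro a b ⟨ha, rfl⟩
    rw [lift_projGen_eq_zero ha, map_zero]⟩

@[simp]
theorem proj_gen (i : Fin 3) : proj p k (gen p k i) = projGen p k i :=
  (RingQuot.liftAlgHom_mkAlgHom_apply k _ _ _).trans (FreeAlgebra.lift_ι_apply _ _)

theorem proj_aeval (f : Polynomial k) :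
    proj p k (Polynomial.aeval (gen p k 0) f) =
      Polynomial.aeval (fun i : Fin p => ((i : ℕ) : k)) f := by
  rw [← Polynomial.aeval_algHom_apply, proj_gen]
  rfl

variable (p k) in
theorem proj_surjective : Function.Surjective (proj p k) := fun g => by
  obtain ⟨f, hf⟩ := Polynomial.surjective_aeval_of_injective (CharP.injective_fin_natCast k p) g
  exact ⟨_, (proj_aeval f).trans hf⟩

theorem proj_eq_zero_of_mem_span {a : B1alg p k}
    (ha : a ∈ TwoSidedIdeal.span {gen p k 1, gen p k 2}) : proj p k a = 0 := by
  rw [← TwoSidedIdeal.mem_ker]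
  refine TwoSidedIdeal.span_le.2 ?_ ha
  rintro _ (rfl | rfl) <;> simp [TwoSidedIdeal.mem_ker, projGen]

theorem proj_eq_zero_iff (a : B1alg p k) :
    proj p k a = 0 ↔ a ∈ TwoSidedIdeal.span {gen p k 1, gen p k 2} := by
  refine ⟨fun ha => ?_, proj_eq_zero_of_mem_span⟩
  obtain ⟨f, hf⟩ := exists_sub_aeval_mem_span a
  have h := proj_eq_zero_of_mem_span hf
  rw [map_sub, ha, zero_sub, neg_eq_zero, proj_aeval] at h
  have hzero : Polynomial.aeval (gen p k 0) f = 0 :=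
    Polynomial.aeval_eq_zero_of_pow_eq_self gen_zero_pow fun i => by
      have hi := congrFun h i
      rwa [Polynomial.aeval_pi_apply₂, Polynomial.coe_aeval_eq_eval] at hi
  rwa [hzero, sub_zero] at hf

end B1alg

/-- In the algebra `Λ` of types B1 and C11, the two-sided ideal `⟨y,z⟩` generated by
the images of `y` and `z` is nilpotent, the quotient `Λ/⟨y,z⟩` is isomorphic as a
`k`-algebra to `k^p`, and `⟨y,z⟩` is the Jacobson radical of `Λ`. -/
theorem stmt13 (p : ℕ) (hp : p.Prime) (k : Type*) [Field k] [CharP k p] :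
    (∃ n : ℕ, 0 < n ∧ ∀ f : Fin n → B1alg p k,
      (∀ m, f m ∈ TwoSidedIdeal.span
        {RingQuot.mkAlgHom k (relOf (B1rels p k)) (FreeAlgebra.ι k 1),
         RingQuot.mkAlgHom k (relOf (B1rels p k)) (FreeAlgebra.ι k 2)}) →
      (List.ofFn f).prod = 0) ∧
    (∃ π : B1alg p k →ₐ[k] (Fin p → k),
      Function.Surjective π ∧
      ∀ a : B1alg p k,
        π a = 0 ↔ a ∈ TwoSidedIdeal.span
          {RingQuot.mkAlgHom k (relOf (B1rels p k)) (FreeAlgebra.ι k 1),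
           RingQuot.mkAlgHom k (relOf (B1rels p k)) (FreeAlgebra.ι k 2)}) ∧
    TwoSidedIdeal.span
        {RingQuot.mkAlgHom k (relOf (B1rels p k)) (FreeAlgebra.ι k 1),
         RingQuot.mkAlgHom k (relOf (B1rels p k)) (FreeAlgebra.ι k 2)} =
      TwoSidedIdeal.jacobson (⊥ : TwoSidedIdeal (B1alg p k)) := by
  have : Fact p.Prime := ⟨hp⟩
  exact ⟨⟨p + p, Nat.add_pos_left hp.pos p, B1alg.prod_ofFn_eq_zero⟩,
    ⟨B1alg.proj p k, B1alg.proj_surjective p k, B1alg.proj_eq_zero_iff⟩,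
    TwoSidedIdeal.eq_jacobson_bot_of_isNilpotent (fun _ => B1alg.isNilpotent_of_mem_span)
      (B1alg.proj p k) B1alg.proj_eq_zero_iff⟩
end
end

section
/- Let k be a field of characteristic 2. The algebra Λ = k⟨x,y,z⟩/⟨x^2, y^2, [x,y], [x,z], [y,z] − x, z^2 + xy⟩ is isomorphic as a k-algebra to the 8-dimensional algebra k⟨y,z⟩/⟨(yz)^2 − (zy)^2, y^2, z^2 − yzy⟩. -/
noncomputable section

open FreeAlgebra in
/-- The relators of the semidihedral algebra `k⟨y,z⟩/⟨(yz)² − (zy)², y², z² − yzy⟩`. -/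
abbrev semidihedralRelators (k : Type*) [Field k] : Set (FreeAlgebra k (Fin 2)) :=
  {(ι k (0 : Fin 2) * ι k 1) ^ 2 - (ι k (1 : Fin 2) * ι k 0) ^ 2,
    ι k (0 : Fin 2) ^ 2,
    ι k (1 : Fin 2) ^ 2 - ι k 0 * ι k 1 * ι k 0}

open FreeAlgebra in
/-- The relators of the algebra of type A5. -/
abbrev typeA5Relators (k : Type*) [Field k] : Set (FreeAlgebra k (Fin 3)) :=
  {ι k (0 : Fin 3) ^ 2,
    ι k (1 : Fin 3) ^ 2,
    commutator' (ι k (0 : Fin 3)) (ι k 1),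
    commutator' (ι k (0 : Fin 3)) (ι k 2),
    commutator' (ι k (1 : Fin 3)) (ι k 2) - ι k 0,
    ι k (2 : Fin 3) ^ 2 + ι k 0 * ι k 1}

section Presentations

variable {k : Type*} [Field k] {n : ℕ} {S : Set (FreeAlgebra k (Fin n))}
  {A : Type*} [Ring A] [Algebra k A]

/-- The image of the `i`-th generator in the algebra with relators `S`. -/
def presGen (S : Set (FreeAlgebra k (Fin n))) (i : Fin n) : RingQuot (relOf S) :=
  RingQuot.mkAlgHom k (relOf S) (FreeAlgebra.ι k i)

theorem mkAlgHom_eq_zero {a : FreeAlgebra k (Fin n)} (ha : a ∈ S) :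
    RingQuot.mkAlgHom k (relOf S) a = 0 := by
  simpa using RingQuot.mkAlgHom_rel k (s := relOf S) (show relOf S a 0 from ⟨ha, rfl⟩)

/-- The homomorphism out of a presented algebra determined by images of the generators
that satisfy the relators. -/
def presLift (f : Fin n → A) (hf : ∀ a ∈ S, FreeAlgebra.lift k f a = 0) :
    RingQuot (relOf S) →ₐ[k] A :=
  RingQuot.liftAlgHom k ⟨FreeAlgebra.lift k f, by
    rintro a b ⟨ha, rfl⟩
    rw [hf a ha, map_zero]⟩

@[simp]
theorem presLift_presGen (f : Fin n → A) (hf : ∀ a ∈ S, FreeAlgebra.lift k f a = 0)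
    (i : Fin n) : presLift f hf (presGen S i) = f i := by
  simp [presLift, presGen]

theorem presented_algHom_ext {f g : RingQuot (relOf S) →ₐ[k] A}
    (h : ∀ i, f (presGen S i) = g (presGen S i)) : f = g := by
  apply RingQuot.ringQuot_ext'
  apply FreeAlgebra.hom_ext
  funext i
  exact h i

end Presentations

section Semidihedral

/-- The defining relations of the semidihedral algebra, together with their consequences after
right multiplication, as a terminating rewriting system on right-associated words. -/
theorem semidihedral_rewriting {A : Type*} [Ring A] {y z : A} (hy : y * y = 0)
    (hz : z * z = y * z * y) (hyz : y * z * y * z = z * y * z * y) :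
    z * z = y * (z * y) ∧ z * (y * (z * y)) = y * (z * (y * z)) ∧
      (∀ t, y * (y * t) = 0) ∧ (∀ t, z * (z * t) = y * (z * (y * t))) ∧
      ∀ t, z * (y * (z * (y * t))) = y * (z * (y * (z * t))) := by
  simp only [← mul_assoc, hy, hz, hyz, zero_mul, implies_true, and_self]

variable (k : Type*) [Field k]

theorem semidihedral_relations :
    let y := presGen (semidihedralRelators k) 0
    let z := presGen (semidihedralRelators k) 1
    y * y = 0 ∧ z * z = y * z * y ∧ y * z * y * z = z * y * z * y := by
  refine ⟨?_, ?_, ?_⟩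
  · have h := mkAlgHom_eq_zero (S := semidihedralRelators k)
      (a := FreeAlgebra.ι k (0 : Fin 2) ^ 2) (by simp)
    simpa [presGen, pow_two] using h
  · have h := mkAlgHom_eq_zero (S := semidihedralRelators k)
      (a := FreeAlgebra.ι k (1 : Fin 2) ^ 2 -
        FreeAlgebra.ι k 0 * FreeAlgebra.ι k 1 * FreeAlgebra.ι k 0) (by simp)
    simpa [presGen, pow_two, sub_eq_zero] using h
  · have h := mkAlgHom_eq_zero (S := semidihedralRelators k)
      (a := (FreeAlgebra.ι k (0 : Fin 2) * FreeAlgebra.ι k 1) ^ 2 -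
        (FreeAlgebra.ι k (1 : Fin 2) * FreeAlgebra.ι k 0) ^ 2) (by simp)
    simpa [presGen, pow_two, sub_eq_zero, mul_assoc] using h

/-- Left multiplication by `y` in the basis `1, y, z, yz, zy, yzy, zyz, yzyz`. -/
def leftMulY : Module.End k (Fin 8 → k) where
  toFun v := ![0, v 0, 0, v 2, 0, v 4, 0, v 6]
  map_add' u v := by ext i; fin_cases i <;> simp
  map_smul' c v := by ext i; fin_cases i <;> simp

/-- Left multiplication by `z` in the basis `1, y, z, yz, zy, yzy, zyz, yzyz`. -/
def leftMulZ : Module.End k (Fin 8 → k) where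
  toFun v := ![0, 0, v 0, 0, v 1, v 2, v 3, v 5]
  map_add' u v := by ext i; fin_cases i <;> simp
  map_smul' c v := by ext i; fin_cases i <;> simp

/-- The regular representation of the semidihedral algebra on coordinates. -/
def semidihedralRep :
    RingQuot (relOf (semidihedralRelators k)) →ₐ[k] Module.End k (Fin 8 → k) :=
  presLift ![leftMulY k, leftMulZ k] (by
    rintro a (rfl | rfl | rfl) <;> refine LinearMap.ext fun v => ?_ <;> ext i <;>
      fin_cases i <;> simp [pow_two, leftMulY, leftMulZ])

/-- The monomials `1, y, z, yz, zy, yzy, zyz, yzyz`. -/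
def semidihedralMonomial : Fin 8 → RingQuot (relOf (semidihedralRelators k)) :=
  let y := presGen (semidihedralRelators k) 0
  let z := presGen (semidihedralRelators k) 1
  ![1, y, z, y * z, z * y, y * z * y, z * y * z, y * z * y * z]

/-- The linear combination of the monomials with given coefficients. -/
def semidihedralComb : (Fin 8 → k) →ₗ[k] RingQuot (relOf (semidihedralRelators k)) :=
  Fintype.linearCombination k (semidihedralMonomial k)

theorem semidihedralComb_rep_presGen (i : Fin 2) (v : Fin 8 → k) :
    semidihedralComb k (semidihedralRep k (presGen _ i) v) =
      presGen _ i * semidihedralComb k v := by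
  obtain ⟨hy, hz, hyz⟩ := semidihedral_relations k
  obtain ⟨hz, hyz, hyt, hzt, hyzt⟩ := semidihedral_rewriting hy hz hyz
  simp only [semidihedralComb, Fintype.linearCombination_apply, semidihedralRep,
    presLift_presGen, Fin.sum_univ_eight, semidihedralMonomial]
  fin_cases i <;>
    simp [leftMulY, leftMulZ, mul_add, mul_assoc, hy, hz, hyz, hyt, hzt, hyzt]

theorem semidihedralComb_rep (a : RingQuot (relOf (semidihedralRelators k)))
    (v : Fin 8 → k) :
    semidihedralComb k (semidihedralRep k a v) = a * semidihedralComb k v := by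
  obtain ⟨a, rfl⟩ := RingQuot.mkAlgHom_surjective k _ a
  induction a using FreeAlgebra.induction generalizing v with
  | grade0 c => simp [Algebra.algebraMap_eq_smul_one]
  | grade1 i => exact semidihedralComb_rep_presGen k i v
  | mul a b ha hb => simp [ha, hb, mul_assoc]
  | add a b ha hb => simp [ha, hb, add_mul]

theorem semidihedralComb_one :
    semidihedralComb k ![1, 0, 0, 0, 0, 0, 0, 0] = 1 := by
  simp [semidihedralComb, semidihedralMonomial, Fintype.linearCombination_apply,
    Fin.sum_univ_eight]

theorem semidihedralRep_comb (v : Fin 8 → k) :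
    semidihedralRep k (semidihedralComb k v) ![1, 0, 0, 0, 0, 0, 0, 0] = v := by
  ext i
  simp only [semidihedralComb, Fintype.linearCombination_apply, Fin.sum_univ_eight,
    semidihedralMonomial, semidihedralRep]
  fin_cases i <;> simp [leftMulY, leftMulZ]

/-- Coordinates on the semidihedral algebra with respect to the monomials. -/
def semidihedralEquiv :
    (Fin 8 → k) ≃ₗ[k] RingQuot (relOf (semidihedralRelators k)) :=
  LinearEquiv.ofBijective (semidihedralComb k)
    ⟨Function.LeftInverse.injective
        (g := fun a => semidihedralRep k a ![1, 0, 0, 0, 0, 0, 0, 0]) (semidihedralRep_comb k),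
      fun a => ⟨semidihedralRep k a ![1, 0, 0, 0, 0, 0, 0, 0], by
        rw [semidihedralComb_rep, semidihedralComb_one, mul_one]⟩⟩

theorem finrank_semidihedral :
    Module.finrank k (RingQuot (relOf (semidihedralRelators k))) = 8 := by
  rw [← (semidihedralEquiv k).finrank_eq, Module.finrank_fin_fun]

end Semidihedral

section Isomorphism

variable (k : Type*) [Field k]

theorem typeA5_relations :
    let x := presGen (typeA5Relators k) 0
    let y := presGen (typeA5Relators k) 1
    let z := presGen (typeA5Relators k) 2
    x * x = 0 ∧ y * y = 0 ∧ x * y = y * x ∧ x * z = z * x ∧ y * z - z * y = x ∧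
      z * z + x * y = 0 := by
  have h (a) (ha : a ∈ typeA5Relators k) := mkAlgHom_eq_zero ha
  simpa [presGen, pow_two, commutator', sub_eq_zero] using h

variable [CharP k 2]

theorem neg_eq_self_of_charTwo {A : Type*} [Ring A] [Algebra k A] (a : A) : -a = a := by
  rw [neg_eq_iff_add_eq_zero, ← two_smul k a, CharTwo.two_eq_zero, zero_smul]

theorem semidihedral_of_typeA5 {A : Type*} [Ring A] {x y z : A} (hneg : ∀ a : A, -a = a)
    (hx : x * x = 0) (hy : y * y = 0) (hyz : y * z - z * y = x) (hz : z * z + x * y = 0) :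
    z * z = y * z * y ∧ y * z * (y * z) = z * y * (z * y) := by
  subst hyz
  have hzz : z * z = y * (z * y) := by
    rw [eq_neg_of_add_eq_zero_left hz, hneg]
    simp [sub_mul, mul_assoc, hy]
  refine ⟨by rw [hzz, mul_assoc], ?_⟩
  have hyt (t : A) : y * (y * t) = 0 := by rw [← mul_assoc, hy, zero_mul]
  have hzt (t : A) : z * (z * t) = y * (z * (y * t)) := by
    rw [← mul_assoc, hzz, mul_assoc, mul_assoc]
  rw [← sub_eq_zero, sub_eq_add_neg, hneg]
  simpa [mul_add, add_mul, mul_assoc, hyt, hzt, hy, sub_eq_add_neg, hneg] using hx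

/-- The homomorphism with `x ↦ yz - zy`, `y ↦ y`, `z ↦ z`. -/
def typeA5ToSemidihedral :
    RingQuot (relOf (typeA5Relators k)) →ₐ[k] RingQuot (relOf (semidihedralRelators k)) :=
  presLift
    (let y := presGen (semidihedralRelators k) 0
     let z := presGen (semidihedralRelators k) 1
     ![y * z - z * y, y, z])
    (by
      obtain ⟨hy, hz, hyz⟩ := semidihedral_relations k
      obtain ⟨hz, hyz, hyt, hzt, hyzt⟩ := semidihedral_rewriting hy hz hyz
      have hneg := neg_eq_self_of_charTwo k (A := RingQuot (relOf (semidihedralRelators k)))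
      have hadd (a : RingQuot (relOf (semidihedralRelators k))) : a + a = 0 :=
        neg_eq_iff_add_eq_zero.mp (hneg a)
      rintro a (rfl | rfl | rfl | rfl | rfl | rfl) <;>
        simp [commutator', pow_two, mul_add, add_mul, mul_assoc, hy, hz, hyz,
          hyt, hzt, sub_eq_add_neg, hneg, hadd])

/-- The homomorphism with `y ↦ y`, `z ↦ z`. -/
def semidihedralToTypeA5 :
    RingQuot (relOf (semidihedralRelators k)) →ₐ[k] RingQuot (relOf (typeA5Relators k)) :=
  presLift ![presGen (typeA5Relators k) 1, presGen (typeA5Relators k) 2] (by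
    obtain ⟨hx, hy, hxy, hxz, hyz, hz⟩ := typeA5_relations k
    have hneg := neg_eq_self_of_charTwo k (A := RingQuot (relOf (typeA5Relators k)))
    obtain ⟨hzz, hyzyz⟩ := semidihedral_of_typeA5 hneg hx hy hyz hz
    rintro a (rfl | rfl | rfl) <;> simp [pow_two, hy, hzz, hyzyz])

/-- In characteristic `2` the algebra of type A5 is semidihedral. -/
def typeA5EquivSemidihedral :
    RingQuot (relOf (typeA5Relators k)) ≃ₐ[k] RingQuot (relOf (semidihedralRelators k)) :=
  AlgEquiv.ofAlgHom (typeA5ToSemidihedral k) (semidihedralToTypeA5 k)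
    (presented_algHom_ext fun i => by
      fin_cases i <;> simp [typeA5ToSemidihedral, semidihedralToTypeA5])
    (presented_algHom_ext fun i => by
      obtain ⟨-, -, -, -, hyz, -⟩ := typeA5_relations k
      fin_cases i <;> simp [typeA5ToSemidihedral, semidihedralToTypeA5, hyz])

end Isomorphism

/-- In characteristic `2`, the algebra of type A5,
`k⟨x,y,z⟩/⟨x², y², [x,y], [x,z], [y,z] − x, z² + xy⟩`, is isomorphic as a
`k`-algebra to the `8`-dimensional algebra `k⟨y,z⟩/⟨(yz)² − (zy)², y², z² − yzy⟩`. -/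
theorem stmt15 (k : Type*) [Field k] [CharP k 2] :
    Module.finrank k
      (RingQuot (relOf
        (({(FreeAlgebra.ι k (0 : Fin 2) * FreeAlgebra.ι k 1) ^ 2 -
             (FreeAlgebra.ι k (1 : Fin 2) * FreeAlgebra.ι k 0) ^ 2,
           FreeAlgebra.ι k (0 : Fin 2) ^ 2,
           FreeAlgebra.ι k (1 : Fin 2) ^ 2 -
             FreeAlgebra.ι k 0 * FreeAlgebra.ι k 1 * FreeAlgebra.ι k 0} :
          Set (FreeAlgebra k (Fin 2)))))) = 8 ∧
    Nonempty
      (RingQuot (relOf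
          (({FreeAlgebra.ι k (0 : Fin 3) ^ 2,
             FreeAlgebra.ι k (1 : Fin 3) ^ 2,
             commutator' (FreeAlgebra.ι k (0 : Fin 3)) (FreeAlgebra.ι k 1),
             commutator' (FreeAlgebra.ι k (0 : Fin 3)) (FreeAlgebra.ι k 2),
             commutator' (FreeAlgebra.ι k (1 : Fin 3)) (FreeAlgebra.ι k 2) -
               FreeAlgebra.ι k 0,
             FreeAlgebra.ι k (2 : Fin 3) ^ 2 +
               FreeAlgebra.ι k 0 * FreeAlgebra.ι k 1} :
            Set (FreeAlgebra k (Fin 3))))) ≃ₐ[k]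
        RingQuot (relOf
          (({(FreeAlgebra.ι k (0 : Fin 2) * FreeAlgebra.ι k 1) ^ 2 -
               (FreeAlgebra.ι k (1 : Fin 2) * FreeAlgebra.ι k 0) ^ 2,
             FreeAlgebra.ι k (0 : Fin 2) ^ 2,
             FreeAlgebra.ι k (1 : Fin 2) ^ 2 -
               FreeAlgebra.ι k 0 * FreeAlgebra.ι k 1 * FreeAlgebra.ι k 0} :
            Set (FreeAlgebra k (Fin 2)))))) :=
  ⟨finrank_semidihedral k, ⟨typeA5EquivSemidihedral k⟩⟩
end
end

section
/- Let k be an algebraically closed field of characteristic 2 and let Λ = k⟨x,y,z⟩/⟨x^2, y^2, [x,y], [x,z], [y,z] − x, z^2 + xy⟩ (the algebra of type A5 for p = 2). Then Λ is not isomorphic as a k-algebra to the group algebra kG of any finite group G. -/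
noncomputable section

/-- A group generated by elements satisfying the relations of `Q₈` receives a map from `Q₈`. -/
def quaternionGroupTwoHom {G : Type*} [Group G] (g h : G) (hg : g ^ 4 = 1)
    (hh : h * h = g ^ 2) (hgh : g * h = h * g⁻¹) : QuaternionGroup 2 →* G :=
  have hadd (i j : ZMod (2 * 2)) : g ^ (i + j).val = g ^ i.val * g ^ j.val := by
    rw [ZMod.val_add, ← pow_eq_pow_mod _ (by simpa using hg), pow_add]
  have hneg (i : ZMod (2 * 2)) : g ^ (-i).val = (g ^ i.val)⁻¹ := by
    rw [eq_inv_iff_mul_eq_one, ← hadd]; simp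
  have hcomm (i : ZMod (2 * 2)) : g ^ i.val * h = h * g ^ (-i).val := by
    rw [hneg, ← inv_pow]
    exact (SemiconjBy.pow_right (show SemiconjBy h g⁻¹ g from hgh.symm) _).eq.symm
  have htwo : g ^ (2 : ZMod (2 * 2)).val = h * h := hh.symm
  { toFun := fun
      | .a i => g ^ i.val
      | .xa i => h * g ^ i.val
    map_one' := by simp [QuaternionGroup.one_def, -QuaternionGroup.a_zero]
    map_mul' := by
      rintro (i | i) (j | j)
      · simp [hadd]
      · simp only [QuaternionGroup.a_mul_xa]
        rw [← mul_assoc, hcomm, mul_assoc, ← hadd, neg_add_eq_sub]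
      · simp [hadd, mul_assoc]
      · simp only [QuaternionGroup.xa_mul_xa]
        rw [show ((2 : ℕ) : ZMod (2 * 2)) + j - i = 2 + (-i + j) by push_cast; ring, hadd, hadd,
          htwo, mul_assoc h (g ^ i.val), ← mul_assoc (g ^ i.val) h, hcomm]
        simp only [mul_assoc] }

theorem conj_eq_inv_of_card_eq_eight {G : Type*} [Group G] (hG : Nat.card G = 8) {g h : G}
    (hg : orderOf g = 4) (hgh : g * h ≠ h * g) :
    g * h = h * g⁻¹ ∧ (h * h = 1 ∨ h * h = g ^ 2) := by
  have hidx : (Subgroup.zpowers g).index = 2 := by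
    have := (Subgroup.zpowers g).card_mul_index
    rw [Nat.card_zpowers, hg, hG] at this
    omega
  have hg4 : g ^ 4 = 1 := hg ▸ pow_orderOf_eq_one g
  have hfin : IsOfFinOrder g := orderOf_pos_iff.mp (by omega)
  have hmem : ∀ x ∈ Subgroup.zpowers g, x = 1 ∨ x = g ∨ x = g ^ 2 ∨ x = g ^ 3 := by
    classical
    intro x hx
    rw [hfin.mem_zpowers_iff_mem_range_orderOf, hg] at hx
    obtain ⟨n, hn, rfl⟩ := Finset.mem_image.mp hx
    have := Finset.mem_range.mp hn
    interval_cases n <;> simp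
  have hinv : g ^ 3 = g⁻¹ := by rw [eq_inv_iff_mul_eq_one, ← pow_succ, hg4]
  have hg2 : g ^ 2 ≠ 1 := fun h2 => by
    have := orderOf_dvd_of_pow_eq_one h2
    rw [hg] at this
    omega
  have hne : g ≠ 1 := by rintro rfl; simp at hgh
  constructor
  · have hn := Subgroup.normal_of_index_eq_two hidx
    have := hmem _ (hn.conj_mem g (Subgroup.mem_zpowers g) h⁻¹)
    rw [inv_inv] at this
    rcases this with H | H | H | H
    · have : g = 1 := by
        calc g = h * (h⁻¹ * g * h) * h⁻¹ := by group
          _ = 1 := by rw [H]; group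
      exact absurd this hne
    · exact absurd (by calc g * h = h * (h⁻¹ * g * h) := by group
          _ = h * g := by rw [H]) hgh
    · have : g ^ 2 = 1 := by
        calc g ^ 2 = h * (h⁻¹ * g * h) ^ 2 * h⁻¹ := by rw [pow_two, pow_two]; group
          _ = 1 := by rw [H, ← pow_mul, hg4]; group
      exact absurd this hg2
    · calc g * h = h * (h⁻¹ * g * h) := by group
        _ = h * g⁻¹ := by rw [H, hinv]
  · rcases hmem _ (Subgroup.mul_self_mem_of_index_two hidx h) with H | H | H | H
    · exact .inl H
    · exact absurd (by rw [← H, mul_assoc]) hgh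
    · exact .inr H
    · have h' : g⁻¹ * h = h * g⁻¹ := by rw [← hinv, ← H, mul_assoc]
      exact absurd (by
        calc g * h = g * (h * g⁻¹) * g := by group
          _ = h * g := by rw [← h']; group) hgh

theorem exists_involutions_or_quaternion {G : Type*} [Group G] (hG : Nat.card G = 8) {a b : G}
    (hab : a * b ≠ b * a) :
    (∃ s t : G, s * s = 1 ∧ t * t = 1 ∧ s * t ≠ t * s) ∨
      Nonempty (QuaternionGroup 2 ≃* G) := by
  have hfin : Finite G := Nat.finite_of_card_ne_zero (by omega)
  have horder (x : G) : x * x = 1 ∨ orderOf x = 4 := by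
    have hdvd : orderOf x ∣ 2 ^ 3 := by simpa [hG] using orderOf_dvd_natCard x
    obtain ⟨m, hm, hx⟩ := (Nat.dvd_prime_pow Nat.prime_two).mp hdvd
    interval_cases m
    · left; rw [orderOf_eq_one_iff.mp hx, one_mul]
    · left; rw [← pow_two, ← pow_one 2, ← hx, pow_orderOf_eq_one]
    · right; exact hx
    · have hc : IsCyclic G := isCyclic_of_orderOf_eq_card x (by rw [hx, hG]; rfl)
      exact absurd (hc.isMulCommutative.is_comm.comm a b) hab
  have key : ∀ g h : G, g * h ≠ h * g → orderOf g = 4 →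
      (∃ s t : G, s * s = 1 ∧ t * t = 1 ∧ s * t ≠ t * s) ∨
        Nonempty (QuaternionGroup 2 ≃* G) := by
    intro g h hgh hg
    obtain ⟨hconj, hsq | hsq⟩ := conj_eq_inv_of_card_eq_eight hG hg hgh
    · refine .inl ⟨h, h * g, hsq, ?_, fun H => hgh ?_⟩
      · rw [mul_assoc, ← mul_assoc g, hconj, inv_mul_cancel_right, hsq]
      · rw [mul_assoc] at H
        exact (mul_left_cancel H).symm
    · refine .inr ⟨MulEquiv.ofBijective
        (quaternionGroupTwoHom g h (hg ▸ pow_orderOf_eq_one g) hsq hconj) ?_⟩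
      rw [Nat.bijective_iff_injective_and_card]
      refine ⟨?_, by rw [Nat.card_eq_fintype_card, QuaternionGroup.card, hG]⟩
      rw [injective_iff_map_eq_one]
      rintro (i | i) hi
      · change g ^ i.val = 1 at hi
        have hdvd := orderOf_dvd_of_pow_eq_one hi
        rw [hg] at hdvd
        have := Nat.eq_zero_of_dvd_of_lt hdvd (ZMod.val_lt i)
        rw [(ZMod.val_eq_zero i).mp this, QuaternionGroup.one_def]
      · change h * g ^ i.val = 1 at hi
        rw [eq_inv_of_mul_eq_one_left hi] at hgh
        exact absurd ((Commute.refl g).pow_right _).inv_right.eq hgh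
  rcases horder a with ha | ha
  · rcases horder b with hb | hb
    · exact .inl ⟨a, b, ha, hb, hab⟩
    · exact key b a (Ne.symm hab) hb
  · exact key a b hab ha

theorem single_add_one_mul_self {k G : Type*} [Field k] [CharP k 2] [Group G] {g : G}
    (hg : g * g = 1) :
    ((.single g 1 + 1 : MonoidAlgebra k G)) * (.single g 1 + 1) = 0 := by
  rw [MonoidAlgebra.one_def]
  simp only [add_mul, mul_add, MonoidAlgebra.single_mul_single, one_mul, mul_one, hg]
  rw [add_comm (MonoidAlgebra.single g 1), ← add_add_add_comm, ← MonoidAlgebra.single_add,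
    ← MonoidAlgebra.single_add, CharTwo.add_self_eq_zero]
  simp

open QuaternionGroup in
theorem mul_mul_self_eq_zero_of_quaternion {k : Type*} [Field k] [CharP k 2]
    (u v : MonoidAlgebra k (QuaternionGroup 2)) (hu : u * u = 0) : u * v * u = 0 := by
  have hsum (f : QuaternionGroup 2 → k) : ∑ g, f g =
      f (a 0) + (f (a 1) + (f (a 2) + (f (a 3) +
        (f (xa 0) + (f (xa 1) + (f (xa 2) + f (xa 3))))))) := by
    have huniv : (Finset.univ : Finset (QuaternionGroup 2)) =
      {a 0, a 1, a 2, a 3, xa 0, xa 1, xa 2, xa 3} := by decide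
    rw [huniv]
    repeat rw [Finset.sum_insert (by decide)]
    rw [Finset.sum_singleton]
  have hc (h : QuaternionGroup 2) : ∑ g, u.coeff g * u.coeff (g⁻¹ * h) = 0 := by
    have := congrArg (fun w => MonoidAlgebra.coeff w h) hu
    simp only [MonoidAlgebra.coeff_mul_apply_left] at this
    rw [Finsupp.sum_fintype _ _ (by simp)] at this
    simpa using this
  obtain ⟨c, hcu⟩ : ∃ c : QuaternionGroup 2 → k, ∀ g, u.coeff g = c g := ⟨_, fun _ => rfl⟩
  simp only [hsum, hcu] at hc
  have e0 : c (a 0) * c (a 0) + (c (a 1) * c (a 3) + (c (a 2) * c (a 2) + (c (a 3) * c (a 1) +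
    (c (xa 0) * c (xa 2) + (c (xa 1) * c (xa 3) + (c (xa 2) * c (xa 0) +
      c (xa 3) * c (xa 1))))))) = 0 := hc (a 0)
  have e1 : c (a 0) * c (a 1) + (c (a 1) * c (a 0) + (c (a 2) * c (a 3) + (c (a 3) * c (a 2) +
    (c (xa 0) * c (xa 3) + (c (xa 1) * c (xa 0) + (c (xa 2) * c (xa 1) +
      c (xa 3) * c (xa 2))))))) = 0 := hc (a 1)
  have e2 : c (a 0) * c (a 2) + (c (a 1) * c (a 1) + (c (a 2) * c (a 0) + (c (a 3) * c (a 3) +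
    (c (xa 0) * c (xa 0) + (c (xa 1) * c (xa 1) + (c (xa 2) * c (xa 2) +
      c (xa 3) * c (xa 3))))))) = 0 := hc (a 2)
  have e3 : c (a 0) * c (xa 0) + (c (a 1) * c (xa 1) + (c (a 2) * c (xa 2) + (c (a 3) * c (xa 3) +
    (c (xa 0) * c (a 0) + (c (xa 1) * c (a 3) + (c (xa 2) * c (a 2) +
      c (xa 3) * c (a 1))))))) = 0 := hc (xa 0)
  have e4 : c (a 0) * c (xa 1) + (c (a 1) * c (xa 2) + (c (a 2) * c (xa 3) + (c (a 3) * c (xa 0) +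
    (c (xa 0) * c (a 1) + (c (xa 1) * c (a 0) + (c (xa 2) * c (a 3) +
      c (xa 3) * c (a 2))))))) = 0 := hc (xa 1)
  have two : (2 : k) = 0 := CharTwo.two_eq_zero
  have hA : (c (a 0) + c (a 2)) ^ 2 = 0 := by grind
  have hBC : (c (a 1) + c (a 3)) * (c (xa 0) + c (xa 2)) = 0 := by grind
  have hBD : (c (a 1) + c (a 3)) * (c (xa 1) + c (xa 3)) = 0 := by grind
  have hCD : (c (xa 0) + c (xa 2)) * (c (xa 1) + c (xa 3)) = 0 := by grind
  have hB : ((c (a 1) + c (a 3)) + (c (xa 0) + c (xa 2)) + (c (xa 1) + c (xa 3))) ^ 2 = 0 := by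
    grind
  have h0 : c (a 2) = c (a 0) := by grind
  have h1 : c (a 3) = c (a 1) := by grind
  have h2 : c (xa 2) = c (xa 0) := by grind
  have h3 : c (xa 3) = c (xa 1) := by grind
  set s : MonoidAlgebra k (QuaternionGroup 2) := .single 1 1 + .single (a 2) 1 with hs
  obtain ⟨w, rfl⟩ : ∃ w, u = s * w := by
    refine ⟨.single (a 0) (c (a 0)) + .single (a 1) (c (a 1)) + .single (xa 0) (c (xa 0)) +
      .single (xa 1) (c (xa 1)), ?_⟩
    ext g
    rw [hcu, hs]
    simp only [add_mul, mul_add, MonoidAlgebra.single_mul_single, one_mul, MonoidAlgebra.coeff_add,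
      MonoidAlgebra.coeff_single, Finsupp.add_apply, Finsupp.single_apply]
    have hg : g ∈ ({a 0, a 1, a 2, a 3, xa 0, xa 1, xa 2, xa 3} : Finset (QuaternionGroup 2)) := by
      revert g; decide
    simp only [Finset.mem_insert, Finset.mem_singleton] at hg
    rcases hg with rfl | rfl | rfl | rfl | rfl | rfl | rfl | rfl
    all_goals
      repeat first | rw [if_pos (by decide)] | rw [if_neg (by decide)]
      simp [*]
  have hss : s * s = 0 := by
    rw [hs, add_comm, ← MonoidAlgebra.one_def]
    exact single_add_one_mul_self (by decide)
  have hcomm (v : MonoidAlgebra k (QuaternionGroup 2)) : v * s = s * v := by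
    induction v using MonoidAlgebra.induction_linear with
    | zero => simp
    | add f g hf hg => rw [add_mul f, mul_add s, hf, hg]
    | single g r =>
      have hg : g * a 2 = a 2 * g := by revert g; decide
      simp [hs, add_mul, mul_add, MonoidAlgebra.single_mul_single, hg]
  calc s * w * v * (s * w) = s * (w * v * s) * w := by simp only [mul_assoc]
    _ = 0 := by rw [hcomm, ← mul_assoc, hss, zero_mul, zero_mul]

theorem involutions_mul_ne_zero {k G : Type*} [Field k] [CharP k 2] [Group G] {s t : G}
    (hs : s * s = 1) (ht : t * t = 1) (hst : s * t ≠ t * s) :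
    ((.single s 1 + 1 : MonoidAlgebra k G) * (.single t 1 + 1)) *
      ((.single s 1 + 1) * (.single t 1 + 1)) ≠ 0 := by
  classical
  have hs' : s⁻¹ = s := inv_eq_of_mul_eq_one_left hs
  have ht' : t⁻¹ = t := inv_eq_of_mul_eq_one_left ht
  have s1 : s ≠ 1 := by rintro rfl; simp at hst
  have t1 : t ≠ 1 := by rintro rfl; simp at hst
  have st1 : s * t ≠ 1 := fun H => hst (by
    rw [eq_inv_of_mul_eq_one_left H, inv_mul_cancel, mul_inv_cancel])
  have ts1 : t * s ≠ 1 := fun H => hst (by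
    rw [eq_inv_of_mul_eq_one_left H, inv_mul_cancel, mul_inv_cancel])
  have sst : s * (s * t) = t := by rw [← mul_assoc, hs, one_mul]
  have tt' : t * (s * t) ≠ 1 := fun H => s1 (by
    rw [← mul_assoc, mul_eq_one_iff_eq_inv, ht'] at H
    exact mul_eq_left.mp H)
  have ss' : s * (t * s) ≠ 1 := fun H => t1 (by
    rw [← mul_assoc, mul_eq_one_iff_eq_inv, hs'] at H
    exact mul_eq_left.mp H)
  have stst : s * (t * (s * t)) ≠ 1 := fun H => hst (by
    rw [← mul_assoc, mul_eq_one_iff_eq_inv, mul_inv_rev, hs', ht'] at H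
    exact H)
  intro H
  have := congrArg (fun w => MonoidAlgebra.coeff w 1) H
  rw [MonoidAlgebra.one_def] at this
  simp [CharTwo.add_self_eq_zero, add_mul, mul_add, MonoidAlgebra.single_mul_single, mul_assoc,
    hs, ht, MonoidAlgebra.coeff_single, s1, t1, st1, ts1, sst, tt', ss', stst] at this

/-- The commutative algebra `k[x, y] / (x², y²)`, realised as iterated dual numbers. -/
abbrev BiDual (k : Type*) [CommRing k] := DualNumber (DualNumber k)

namespace BiDual

variable {k : Type*} [Field k]

/-- The element `a + b x + c y + d x y`. -/
def mk (a b c d : k) : BiDual k := (⟨⟨a, b⟩, ⟨c, d⟩⟩ : (k × k) × (k × k))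

theorem zero_eq : (0 : BiDual k) = mk 0 0 0 0 := rfl

theorem one_eq : (1 : BiDual k) = mk 1 0 0 0 := rfl

theorem mk_add (a b c d a' b' c' d' : k) :
    mk a b c d + mk a' b' c' d' = mk (a + a') (b + b') (c + c') (d + d') := rfl

theorem mk_sub (a b c d a' b' c' d' : k) :
    mk a b c d - mk a' b' c' d' = mk (a - a') (b - b') (c - c') (d - d') := rfl

theorem smul_mk (r a b c d : k) : r • mk a b c d = mk (r * a) (r * b) (r * c) (r * d) := rfl

theorem mk_mul (a b c d a' b' c' d' : k) :
    mk a b c d * mk a' b' c' d' =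
      mk (a * a') (a * b' + b * a') (a * c' + c * a') (a * d' + b * c' + c * b' + d * a') := by
  refine TrivSqZeroExt.ext (TrivSqZeroExt.ext rfl rfl) (TrivSqZeroExt.ext rfl ?_)
  change (a * d' + b * c') + (c * b' + d * a') = _
  simp only [← add_assoc]
  rfl

theorem mk_inj {a b c d a' b' c' d' : k} :
    mk a b c d = mk a' b' c' d' ↔ a = a' ∧ b = b' ∧ c = c' ∧ d = d' :=
  ⟨fun h => ⟨congrArg (fun m => m.1.1) h, congrArg (fun m => m.1.2) h,
    congrArg (fun m => m.2.1) h, congrArg (fun m => m.2.2) h⟩,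
    by rintro ⟨rfl, rfl, rfl, rfl⟩; rfl⟩

end BiDual

namespace TypeA5

variable (k : Type*) [Field k]

/-- The matrix of left multiplication by `x` on the algebra of type A5, viewed as a free right
module over `k[x, y] / (x², y²)` with basis `1, z`. -/
def matX : Matrix (Fin 2) (Fin 2) (BiDual k) :=
  !![.mk 0 1 0 0, .mk 0 0 0 0; .mk 0 0 0 0, .mk 0 1 0 0]

/-- The matrix of left multiplication by `y`; see `matX`. -/
def matY : Matrix (Fin 2) (Fin 2) (BiDual k) :=
  !![.mk 0 0 1 0, .mk 0 1 0 0; .mk 0 0 0 0, .mk 0 0 1 0]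

/-- The matrix of left multiplication by `z`; see `matX`. -/
def matZ : Matrix (Fin 2) (Fin 2) (BiDual k) :=
  !![.mk 0 0 0 0, .mk 0 0 0 1; .mk 1 0 0 0, .mk 0 0 0 0]

variable {k}

/-- The monomials `zᶜ xᵃ yᵇ` with exponents at most `1`. -/
def monomials {A : Type*} [Monoid A] (x y z : A) : Fin 8 → A :=
  ![1, x, y, x * y, z, z * x, z * y, z * (x * y)]

theorem sum_smul_monomials_mat (c : Fin 8 → k) :
    ∑ i, c i • monomials (matX k) (matY k) (matZ k) i =
      !![.mk (c 0) (c 1) (c 2) (c 3), .mk 0 (c 2) 0 (c 4);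
        .mk (c 4) (c 5) (c 6) (c 7), .mk (c 0) (c 1 + c 6) (c 2) (c 3)] := by
  simp [Fin.sum_univ_succ, monomials, matX, matY, matZ, BiDual.mk_mul, BiDual.mk_add,
    BiDual.smul_mk, Matrix.one_fin_two, BiDual.zero_eq, BiDual.one_eq]

theorem coeff_eq_zero_of_sq_eq_zero (c : Fin 8 → k) [CharP k 2]
    (h : (∑ i, c i • monomials (matX k) (matY k) (matZ k) i) *
      (∑ i, c i • monomials (matX k) (matY k) (matZ k) i) = 0) :
    c 0 = 0 ∧ c 4 = 0 ∧ c 6 = 0 := by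
  rw [sum_smul_monomials_mat] at h
  have h0 := congrArg (fun m => m 0 0) h
  have h1 := congrArg (fun m => m 1 0) h
  simp [BiDual.mk_mul, BiDual.mk_add, BiDual.zero_eq, BiDual.mk_inj] at h0 h1
  have two : (2 : k) = 0 := CharTwo.two_eq_zero
  have hc0 : c 0 = 0 := h0.1
  have hc6 : c 6 = 0 := by
    have : c 6 ^ 2 = 0 := by grind
    exact pow_eq_zero_iff two_ne_zero |>.mp this
  have hc4 : c 4 = 0 := by
    have : c 4 ^ 2 = 0 := by grind
    exact pow_eq_zero_iff two_ne_zero |>.mp this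
  exact ⟨hc0, hc4, hc6⟩

theorem coeff_eq_zero_of_eq_zero (c : Fin 8 → k)
    (h : ∑ i, c i • monomials (matX k) (matY k) (matZ k) i = 0) : c = 0 := by
  rw [sum_smul_monomials_mat] at h
  have h0 := congrArg (fun m => m 0 0) h
  have h1 := congrArg (fun m => m 1 0) h
  simp [BiDual.zero_eq, BiDual.mk_inj] at h0 h1
  ext i
  fin_cases i <;> simp [h0, h1]

theorem mat_relations [CharP k 2] :
    matX k * matX k = 0 ∧ matY k * matY k = 0 ∧ matX k * matY k = matY k * matX k ∧
      matX k * matZ k = matZ k * matX k ∧ matY k * matZ k - matZ k * matY k = matX k ∧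
      matZ k * matZ k + matX k * matY k = 0 := by
  have neg : (-1 : k) = 1 := CharTwo.neg_eq 1
  refine ⟨?_, ?_, ?_, ?_, ?_, ?_⟩ <;> ext i j : 1 <;> fin_cases i <;> fin_cases j <;>
    simp [matX, matY, matZ, BiDual.mk_mul, BiDual.mk_add, BiDual.mk_sub, BiDual.zero_eq,
      CharTwo.add_self_eq_zero, neg]

section Relations

variable {A : Type*} [Ring A] [Algebra k A] {x y z : A}

/-- The elements `x, y, z` generate `A`, satisfy the defining relations of the algebra of type A5
in characteristic two, and act through its matrix representation. -/
structure IsPresented (k : Type*) {A : Type*} [Field k] [Ring A] [Algebra k A] (x y z : A) :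
    Prop where
  xx : x * x = 0
  yy : y * y = 0
  yx : y * x = x * y
  xz : x * z = z * x
  yz : y * z = z * y + x
  zz : z * z = x * y
  adjoin_eq_top : Algebra.adjoin k {x, y, z} = ⊤
  exists_hom : ∃ φ : A →ₐ[k] Matrix (Fin 2) (Fin 2) (BiDual k),
    φ x = matX k ∧ φ y = matY k ∧ φ z = matZ k

namespace IsPresented

variable (h : IsPresented k x y z)
include h

theorem mul_comm_x (u : A) : u * x = x * u := by
  have hu : u ∈ Algebra.adjoin k {x, y, z} := h.adjoin_eq_top ▸ Algebra.mem_top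
  induction hu using Algebra.adjoin_induction with
  | mem t ht =>
    rcases ht with rfl | rfl | rfl
    exacts [rfl, h.yx, h.xz.symm]
  | algebraMap r => exact Algebra.commutes r x
  | add a b _ _ ha hb => rw [add_mul, mul_add, ha, hb]
  | mul a b _ _ ha hb => rw [mul_assoc, hb, ← mul_assoc, ha, mul_assoc]

theorem generator_mul_mem (S : Submodule k A) (mem : ∀ j, monomials x y z j ∈ S) (t : A)
    (ht : t ∈ ({x, y, z} : Set A)) (i : Fin 8) : t * monomials x y z i ∈ S := by
  have hx := mem 1
  have hy := mem 2
  have hxy := mem 3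
  have hz := mem 4
  have hzx := mem 5
  have hzy := mem 6
  have hzxy := mem 7
  have xx' (u : A) : x * (x * u) = 0 := by rw [← mul_assoc, h.xx, zero_mul]
  have yx' (u : A) : y * (x * u) = x * (y * u) := by rw [← mul_assoc, h.yx, mul_assoc]
  have xz' (u : A) : x * (z * u) = z * (x * u) := by rw [← mul_assoc, h.xz, mul_assoc]
  have yz' (u : A) : y * (z * u) = z * (y * u) + x * u := by
    rw [← mul_assoc, h.yz, add_mul, mul_assoc]
  have zz' (u : A) : z * (z * u) = x * (y * u) := by rw [← mul_assoc, h.zz, mul_assoc]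
  simp only [monomials, Matrix.cons_val] at hx hy hxy hz hzx hzy hzxy
  have sum_mem := Submodule.add_mem _ hzy hx
  rcases ht with rfl | rfl | rfl <;> fin_cases i <;>
    simp [monomials, h.xx, h.yy, h.yx, h.xz, h.yz, h.zz, xx', yx', xz', yz', zz',
      hx, hy, hxy, hz, hzx, hzy, hzxy, sum_mem]

theorem span_monomials : Submodule.span k (Set.range (monomials x y z)) = ⊤ := by
  have mul_mem (t : A) : ∀ v ∈ Submodule.span k (Set.range (monomials x y z)),
      t * v ∈ Submodule.span k (Set.range (monomials x y z)) := by
    have ht : t ∈ Algebra.adjoin k {x, y, z} := h.adjoin_eq_top ▸ Algebra.mem_top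
    induction ht using Algebra.adjoin_induction with
    | mem t ht =>
      intro v hv
      induction hv using Submodule.span_induction with
      | mem v hv =>
        obtain ⟨i, rfl⟩ := hv
        exact h.generator_mul_mem _ (fun j => Submodule.subset_span (Set.mem_range_self j)) t ht i
      | zero => simp
      | add a b _ _ ha hb => rw [mul_add]; exact Submodule.add_mem _ ha hb
      | smul r a _ ha => rw [mul_smul_comm]; exact Submodule.smul_mem _ r ha
    | algebraMap r =>
      intro v hv
      rw [← Algebra.smul_def]
      exact Submodule.smul_mem _ r hv
    | add a b _ _ ha hb =>
      intro v hv
      rw [add_mul]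
      exact Submodule.add_mem _ (ha v hv) (hb v hv)
    | mul a b _ _ ha hb =>
      intro v hv
      rw [mul_assoc]
      exact ha _ (hb v hv)
  rw [eq_top_iff]
  intro t _
  rw [← mul_one t]
  exact mul_mem t 1 (Submodule.subset_span ⟨0, rfl⟩)

theorem exists_eq_sum (u : A) : ∃ c : Fin 8 → k, ∑ i, c i • monomials x y z i = u :=
  (Submodule.mem_span_range_iff_exists_fun k).mp (h.span_monomials ▸ Submodule.mem_top)

theorem exists_hom_sum : ∃ φ : A →ₐ[k] Matrix (Fin 2) (Fin 2) (BiDual k), ∀ c : Fin 8 → k,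
    φ (∑ i, c i • monomials x y z i) =
      ∑ i, c i • monomials (matX k) (matY k) (matZ k) i := by
  obtain ⟨φ, hx, hy, hz⟩ := h.exists_hom
  exact ⟨φ, fun c => by simp [Fin.sum_univ_succ, monomials, hx, hy, hz]⟩

theorem linearIndependent_monomials : LinearIndependent k (monomials x y z) := by
  obtain ⟨φ, hφ⟩ := h.exists_hom_sum
  rw [Fintype.linearIndependent_iff]
  intro c hc
  have := hφ c
  rw [hc, map_zero] at this
  exact congrFun (coeff_eq_zero_of_eq_zero c this.symm)

theorem finrank_eq : Module.finrank k A = 8 := by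
  simpa using Module.finrank_eq_card_basis
    (Module.Basis.mk h.linearIndependent_monomials h.span_monomials.ge)

theorem exists_eq_of_mul_self_eq_zero [CharP k 2] (u : A) (hu : u * u = 0) :
    ∃ (r : k) (w : A), u = r • y + x * w := by
  obtain ⟨φ, hφ⟩ := h.exists_hom_sum
  obtain ⟨c, rfl⟩ := h.exists_eq_sum u
  obtain ⟨h0, h4, h6⟩ := coeff_eq_zero_of_sq_eq_zero c (by rw [← hφ, ← map_mul, hu, map_zero])
  refine ⟨c 2, c 1 • 1 + c 3 • y + c 5 • z + c 7 • (z * y), ?_⟩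
  simp [Fin.sum_univ_succ, monomials, h0, h4, h6, mul_add, ← h.xz, ← mul_assoc]
  abel

theorem mul_mul_mul_eq_zero [CharP k 2] (u v : A) (hu : u * u = 0) (hv : v * v = 0) :
    u * v * (u * v) = 0 := by
  obtain ⟨r, w, rfl⟩ := h.exists_eq_of_mul_self_eq_zero u hu
  obtain ⟨r', w', rfl⟩ := h.exists_eq_of_mul_self_eq_zero v hv
  obtain ⟨t, ht⟩ : ∃ t, (r • y + x * w) * (r' • y + x * w') = x * t := by
    refine ⟨r • (y * w') + r' • (w * y) + w * (x * w'), ?_⟩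
    simp only [add_mul, mul_add, smul_mul_assoc, mul_smul_comm, h.yy, smul_zero, zero_add,
      mul_assoc, ← mul_assoc y x, h.yx]
    abel
  rw [ht, mul_assoc, ← mul_assoc t, h.mul_comm_x, mul_assoc, ← mul_assoc, h.xx, zero_mul]

theorem y_mul_z_ne : y * z ≠ z * y := by
  intro H
  have := h.linearIndependent_monomials.ne_zero 1
  have hyz := h.yz
  rw [H, left_eq_add] at hyz
  exact this (by simpa [monomials] using hyz)

theorem y_mul_z_mul_y_ne_zero : y * z * y ≠ 0 := by
  have := h.linearIndependent_monomials.ne_zero 3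
  rw [h.yz, add_mul, mul_assoc, h.yy, mul_zero, zero_add]
  simpa [monomials] using this

theorem isEmpty_algEquiv [CharP k 2] (G : Type*) [Group G] [Finite G] :
    IsEmpty (A ≃ₐ[k] MonoidAlgebra k G) := by
  refine ⟨fun e => ?_⟩
  have hcard : Nat.card G = 8 := by
    have := e.toLinearEquiv.finrank_eq
    rw [h.finrank_eq] at this
    let b : Module.Basis G k (MonoidAlgebra k G) := .ofRepr (MonoidAlgebra.coeffLinearEquiv k)
    rw [this, Module.finrank_eq_nat_card_basis b]
  obtain ⟨a, b, hab⟩ : ∃ a b : G, a * b ≠ b * a := by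
    by_contra! hcomm
    let _ : CommGroup G := { ‹Group G› with mul_comm := hcomm }
    refine h.y_mul_z_ne (e.injective ?_)
    rw [map_mul, map_mul]
    exact mul_comm (e y) (e z)
  rcases exists_involutions_or_quaternion hcard hab with ⟨s, t, hs, ht, hst⟩ | ⟨⟨f⟩⟩
  · have hsq (g : G) (hg : g * g = 1) :
        e.symm (.single g 1 + 1) * e.symm (.single g 1 + 1) = 0 := by
      rw [← map_mul, single_add_one_mul_self hg, map_zero]
    have := h.mul_mul_mul_eq_zero _ _ (hsq s hs) (hsq t ht)
    rw [← map_mul, ← map_mul, map_eq_zero_iff _ e.symm.injective] at this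
    exact involutions_mul_ne_zero hs ht hst this
  · let E := e.trans (MonoidAlgebra.domCongr k k f.symm)
    refine h.y_mul_z_mul_y_ne_zero (E.injective ?_)
    rw [map_mul, map_mul, map_zero]
    exact mul_mul_self_eq_zero_of_quaternion _ _ (by rw [← map_mul, h.yy, map_zero])

end IsPresented
end Relations
end TypeA5

/-- Over an algebraically closed field `k` of characteristic `2`, the algebra of
type A5, `k⟨x,y,z⟩/⟨x², y², [x,y], [x,z], [y,z] − x, z² + xy⟩`, is not isomorphic
as a `k`-algebra to the group algebra `kG` of any finite group `G`. -/
theorem stmt16 (k : Type*) [Field k] [IsAlgClosed k] [CharP k 2] :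
    ∀ (G : Type) [Group G] [Finite G],
      IsEmpty
        (RingQuot (relOf
            (({FreeAlgebra.ι k (0 : Fin 3) ^ 2,
               FreeAlgebra.ι k (1 : Fin 3) ^ 2,
               commutator' (FreeAlgebra.ι k (0 : Fin 3)) (FreeAlgebra.ι k 1),
               commutator' (FreeAlgebra.ι k (0 : Fin 3)) (FreeAlgebra.ι k 2),
               commutator' (FreeAlgebra.ι k (1 : Fin 3)) (FreeAlgebra.ι k 2) -
                 FreeAlgebra.ι k 0,
               FreeAlgebra.ι k (2 : Fin 3) ^ 2 +
                 FreeAlgebra.ι k 0 * FreeAlgebra.ι k 1} :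
              Set (FreeAlgebra k (Fin 3))))) ≃ₐ[k]
          MonoidAlgebra k G) := by
  intro G _ _
  set S : Set (FreeAlgebra k (Fin 3)) := {FreeAlgebra.ι k 0 ^ 2, FreeAlgebra.ι k 1 ^ 2,
    commutator' (FreeAlgebra.ι k 0) (FreeAlgebra.ι k 1),
    commutator' (FreeAlgebra.ι k 0) (FreeAlgebra.ι k 2),
    commutator' (FreeAlgebra.ι k 1) (FreeAlgebra.ι k 2) - FreeAlgebra.ι k 0,
    FreeAlgebra.ι k 2 ^ 2 + FreeAlgebra.ι k 0 * FreeAlgebra.ι k 1}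
  let π := RingQuot.mkAlgHom k (relOf S)
  have hrel {a : FreeAlgebra k (Fin 3)} (ha : a ∈ S) : π a = 0 := by
    rw [← map_zero π]
    exact RingQuot.mkAlgHom_rel k ⟨ha, rfl⟩
  let X := π (FreeAlgebra.ι k 0)
  let Y := π (FreeAlgebra.ι k 1)
  let Z := π (FreeAlgebra.ι k 2)
  have xx : X ^ 2 = 0 := by rw [← map_pow]; exact hrel (by simp [S])
  have yy : Y ^ 2 = 0 := by rw [← map_pow]; exact hrel (by simp [S])
  have xy : X * Y - Y * X = 0 := by
    simp only [X, Y, ← map_mul, ← map_sub]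
    exact hrel (by simp [S, commutator'])
  have xz : X * Z - Z * X = 0 := by
    simp only [X, Z, ← map_mul, ← map_sub]
    exact hrel (by simp [S, commutator'])
  have yz : Y * Z - Z * Y - X = 0 := by
    simp only [X, Y, Z, ← map_mul, ← map_sub]
    exact hrel (by simp [S, commutator'])
  have zz : Z ^ 2 + X * Y = 0 := by
    simp only [X, Y, Z, ← map_mul, ← map_add, ← map_pow]
    exact hrel (by simp [S])
  have two (u : RingQuot (relOf S)) : -u = u := by
    rw [← one_smul k u, ← neg_smul, CharTwo.neg_eq]
  refine TypeA5.IsPresented.isEmpty_algEquiv (x := X) (y := Y) (z := Z) ?_ G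
  refine ⟨by rw [← pow_two, xx], by rw [← pow_two, yy], (sub_eq_zero.mp xy).symm,
    sub_eq_zero.mp xz, ?_, ?_, ?_, ?_⟩
  · rw [← sub_eq_iff_eq_add', sub_eq_zero.mp yz]
  · rw [← pow_two, eq_neg_of_add_eq_zero_left zz, two]
  · rw [show ({X, Y, Z} : Set _) = π '' Set.range (FreeAlgebra.ι k) by
      ext u; simp [Fin.exists_fin_succ, X, Y, Z, eq_comm], ← AlgHom.map_adjoin,
      FreeAlgebra.adjoin_range_ι, Algebra.map_top, AlgHom.range_eq_top]
    exact RingQuot.mkAlgHom_surjective k _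
  · obtain ⟨mxx, myy, mxy, mxz, myz, mzz⟩ := TypeA5.mat_relations (k := k)
    let F := FreeAlgebra.lift k ![TypeA5.matX k, TypeA5.matY k, TypeA5.matZ k]
    have hF : ∀ ⦃a b⦄, relOf S a b → F a = F b := by
      rintro a _ ⟨ha, rfl⟩
      simp only [S, Set.mem_insert_iff, Set.mem_singleton_iff, commutator'] at ha
      rcases ha with rfl | rfl | rfl | rfl | rfl | rfl <;>
        simp [F, pow_two, mxx, myy, ← mxy, mxz, myz, mzz]
    refine ⟨RingQuot.liftAlgHom k ⟨F, hF⟩, ?_, ?_, ?_⟩ <;>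
      simp [X, Y, Z, π, F, RingQuot.liftAlgHom_mkAlgHom_apply]
end
end
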